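/- Let d ≥ 2. Given N ∈ ℤ_{>0}, 0 < η < π/100, C ≥ 10 and ε > 0, there exists ρ₀ > 0 such that for every ρ ∈ (0,ρ₀), every (η,C)-admissible sequence (m₀,m₁,…,mₙ) of points of ℝᵈ with 1 ≤ n ≤ N, and every C¹ function β: S₁^{d−1} → ℝᵈ with sup‖β‖ ≤ C and ‖D_hβ‖ ≤ C for all unit tangent vectors h, the following hold (with sₖ = mₖ−m_{k−1}): (i) there is a C¹ diffeomorphism Φ from an open subset Δ ⊂ S₁^{d−1} onto V_{sₙ}^η such that for all v ∈ S₁^{d−1} and all u ∈ V_{sₙ}^η, there is a particle trajectory with scattering sequence (m₀,…,mₙ), initial velocity v and final velocity u if and only if v ∈ Δ and Φ(v) = u; (ii) the map β̄: V_{sₙ}^η → S₁^{d−1} assigning to u the impact location on the last scatterer (the unique w ∈ S₁^{d−1} such that the final collision point of the trajectory with Φ(v) = u equals mₙ+ρw) is C¹ and satisfies ‖β̄(u) − β_{ŝₙ}(u)‖ < ε for all u ∈ V_{sₙ}^η, and ‖D_hβ̄‖ < C_η for all unit tangent vectors h at points of V_{sₙ}^η; (iii) if μ is vol_{S₁^{d−1}}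 restricted to Δ and rescaled to a probability measure, then Φ_*μ = g·λ_{sₙ}^η for some continuous g: V_{sₙ}^η → [1−ε,1+ε]. -/

import Mathlib

open MeasureTheory Metric Set Filter InnerProductGeometry
open scoped Topology ENNReal RealInnerProductSpace

noncomputable section

/-- Euclidean space `ℝᵈ`. -/
abbrev Vec (d : ℕ) : Type := EuclideanSpace ℝ (Fin d)

/-- The unit sphere `S₁^{d-1} ⊂ ℝᵈ`. -/
def sph (d : ℕ) : Set (Vec d) := Metric.sphere (0 : Vec d) 1

/-- The Lebesgue surface measure on the unit sphere, viewed as a measure on `ℝᵈ`. -/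
def sphVol (d : ℕ) : Measure (Vec d) :=
  Measure.map Subtype.val (volume : Measure (Vec d)).toSphere

/-- Normalized direction `Ŝ = S/‖S‖`. -/
def dir {d : ℕ} (x : Vec d) : Vec d := ‖x‖⁻¹ • x

/-- Direction of the outgoing ray after specular reflection in the unit sphere. -/
def scatterDir {d : ℕ} (s x : Vec d) : Vec d :=
  dir s - (2 * ⟪dir s, x - Real.sqrt (1 - ‖x‖ ^ 2) • dir s⟫) •
    (x - Real.sqrt (1 - ‖x‖ ^ 2) • dir s)

/-- `(d-1)`-dimensional Lebesgue measure on the unit disc `{s}^⊥ ∩ B₁ᵈ`. -/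
def discMeas {d : ℕ} (s : Vec d) : Measure (Vec d) :=
  (μH[(d : ℝ) - 1]).restrict {x | ⟪x, s⟫ = 0 ∧ ‖x‖ < 1}

/-- The exit-direction law `λ_s`. -/
def lamS {d : ℕ} (s : Vec d) : Measure (Vec d) :=
  (discMeas s Set.univ)⁻¹ • Measure.map (scatterDir s) (discMeas s)

/-- `V_s^η = {u ∈ S₁^{d-1} : φ(u,s) > η}`. -/
def Vseta {d : ℕ} (s : Vec d) (η : ℝ) : Set (Vec d) :=
  {u ∈ sph d | η < angle u s}

/-- `λ_s^η`: the measure `λ_s` restricted to `V_s^η` and renormalized. -/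
def lamSeta {d : ℕ} (s : Vec d) (η : ℝ) : Measure (Vec d) :=
  (lamS s (Vseta s η))⁻¹ • (lamS s).restrict (Vseta s η)

/-- The impact location `β_v(u) = (u-v)/‖u-v‖`. -/
def impact {d : ℕ} (v u : Vec d) : Vec d := ‖u - v‖⁻¹ • (u - v)

/-- The constant `C_η = 1 + sup ‖D_h β_v(u)‖`. -/
def Ceta (d : ℕ) (η : ℝ) : ℝ :=
  1 + sSup {c | ∃ v ∈ sph d, ∃ u ∈ sph d, η < angle u v ∧
    ∃ h : Vec d, ⟪u, h⟫ = 0 ∧ ‖h‖ = 1 ∧ c = ‖fderiv ℝ (impact v) u h‖}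

/-- `f` is C¹ on `s` (with derivatives along `s`). -/
def C1On {d : ℕ} (f : Vec d → Vec d) (s : Set (Vec d)) : Prop :=
  ∃ Df : Vec d → Vec d →L[ℝ] Vec d, ContinuousOn Df s ∧
    ∀ x ∈ s, HasFDerivWithinAt f (Df x) s x

/-- The ray from `p` in direction `v` meets the open ball of radius `ρ` about `c`. -/
def rayHits {d : ℕ} (ρ : ℝ) (c p v : Vec d) : Prop :=
  ∃ t > (0:ℝ), p + t • v ∈ ball c ρ

/-- First hitting time of the ball `c + B_ρᵈ` along the ray `p + ℝ_{>0}v`. -/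
def hitTime {d : ℕ} (ρ : ℝ) (c p v : Vec d) : ℝ :=
  sInf {t | 0 < t ∧ p + t • v ∈ ball c ρ}

/-- First intersection point with the ball `c + B_ρᵈ`. -/
def hitPoint {d : ℕ} (ρ : ℝ) (c p v : Vec d) : Vec d := p + hitTime ρ c p v • v

/-- The impact location on the unit sphere for scattering at `c + B_ρᵈ`. -/
def hitW {d : ℕ} (ρ : ℝ) (c p v : Vec d) : Vec d := ρ⁻¹ • (hitPoint ρ c p v - c)

/-- Outgoing direction after specular reflection at `c + B_ρᵈ`. -/
def hitV {d : ℕ} (ρ : ℝ) (c p v : Vec d) : Vec d :=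
  v - (2 * ⟪v, hitW ρ c p v⟫) • hitW ρ c p v

/-- The chain of (exit point, exit direction) states of the particle scattered
successively at the balls `m 1 + B_ρᵈ, m 2 + B_ρᵈ, …`, started at `m 0 + ρβ(v)` with
direction `v`. -/
def chain {d : ℕ} (ρ : ℝ) (m : ℕ → Vec d) (β : Vec d → Vec d) (v : Vec d) :
    ℕ → Vec d × Vec d
  | 0 => (m 0 + ρ • β v, v)
  | k + 1 =>
      (hitPoint ρ (m (k + 1)) (chain ρ m β v k).1 (chain ρ m β v k).2,
        hitV ρ (m (k + 1)) (chain ρ m β v k).1 (chain ρ m β v k).2)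

/-- There is a particle trajectory with scattering sequence `(m 0, …, m n)`, initial
velocity `v` and final velocity `u`. -/
def IsTrajectory {d : ℕ} (ρ : ℝ) (m : ℕ → Vec d) (β : Vec d → Vec d) (n : ℕ)
    (v u : Vec d) : Prop :=
  (∀ k < n, rayHits ρ (m (k + 1)) (chain ρ m β v k).1 (chain ρ m β v k).2) ∧
  (chain ρ m β v n).2 = u

/-- `(η,C)`-admissibility of the scattering sequence `(m 0, …, m n)`. -/
def Admissible {d : ℕ} (η C : ℝ) (m : ℕ → Vec d) (n : ℕ) : Prop :=
  (∀ k, 1 ≤ k → k ≤ n → C⁻¹ ≤ ‖m k - m (k - 1)‖) ∧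
  (∀ k, 1 ≤ k → k + 1 ≤ n → 2 * η < angle (m (k + 1) - m k) (m k - m (k - 1)))

/-! ### The normalization map and its derivative -/

lemma dir_of_norm_eq_one {d : ℕ} {x : Vec d} (h : ‖x‖ = 1) : dir x = x := by
  simp [dir, h]

lemma norm_dir {d : ℕ} {x : Vec d} (h : x ≠ 0) : ‖dir x‖ = 1 := by
  rw [dir, norm_smul, norm_inv, norm_norm, inv_mul_cancel₀ (norm_ne_zero_iff.2 h)]

lemma dir_zero {d : ℕ} : dir (0 : Vec d) = 0 := by
  simp [dir]

lemma norm_dir_le {d : ℕ} (x : Vec d) : ‖dir x‖ ≤ 1 := by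
  rcases eq_or_ne x 0 with rfl | h
  · simp [dir_zero]
  · exact (norm_dir h).le

lemma norm_smul_dir {d : ℕ} (x : Vec d) : ‖x‖ • dir x = x := by
  rcases eq_or_ne x 0 with rfl | h
  · simp
  · rw [dir, smul_smul, mul_inv_cancel₀ (norm_ne_zero_iff.2 h), one_smul]

lemma dir_smul {d : ℕ} {t : ℝ} (ht : 0 < t) (x : Vec d) : dir (t • x) = dir x := by
  rw [dir, dir, norm_smul, Real.norm_of_nonneg ht.le, smul_smul, mul_inv, mul_comm t⁻¹, mul_assoc,
    inv_mul_cancel₀ ht.ne', mul_one]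

lemma dir_dir {d : ℕ} (x : Vec d) : dir (dir x) = dir x := by
  rcases eq_or_ne x 0 with rfl | h
  · simp [dir_zero]
  · exact dir_of_norm_eq_one (norm_dir h)

lemma norm_dir_sub_le {d : ℕ} {x : Vec d} (hx : x ≠ 0) (y : Vec d) :
    ‖dir x - dir y‖ ≤ 2 * ‖x‖⁻¹ * ‖x - y‖ := by
  have hx' : 0 < ‖x‖ := norm_pos_iff.2 hx
  have h1 : dir x - dir y = ‖x‖⁻¹ • ((x - y) + (‖y‖ - ‖x‖) • dir y) := by
    rw [sub_smul, norm_smul_dir, sub_add_sub_cancel, smul_sub, smul_smul, inv_mul_cancel₀ hx'.ne',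
      one_smul, dir]
  have h2 : ‖(‖y‖ - ‖x‖) • dir y‖ ≤ ‖x - y‖ := by
    rw [norm_smul]
    have := abs_norm_sub_norm_le y x
    rw [norm_sub_rev y x] at this
    calc ‖‖y‖ - ‖x‖‖ * ‖dir y‖ ≤ ‖x - y‖ * 1 := by
          gcongr
          · exact this
          · exact norm_dir_le y
      _ = _ := mul_one _
  rw [h1, norm_smul, norm_inv, norm_norm]
  calc ‖x‖⁻¹ * ‖x - y + (‖y‖ - ‖x‖) • dir y‖ ≤ ‖x‖⁻¹ * (‖x - y‖ + ‖x - y‖) := by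
        gcongr
        exact (norm_add_le _ _).trans (by gcongr)
    _ = _ := by ring

/-- The derivative of the normalization map `dir`. -/
def ddir {d : ℕ} (x : Vec d) : Vec d →L[ℝ] Vec d :=
  ‖x‖⁻¹ • (ContinuousLinearMap.id ℝ (Vec d) - (innerSL ℝ (dir x)).smulRight (dir x))

lemma ddir_apply {d : ℕ} (x h : Vec d) :
    ddir x h = ‖x‖⁻¹ • (h - ⟪dir x, h⟫ • dir x) := by
  simp [ddir]

lemma hasFDerivAt_dir {d : ℕ} {x : Vec d} (hx : x ≠ 0) : HasFDerivAt dir (ddir x) x := by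
  have hx' : ‖x‖ ≠ 0 := norm_ne_zero_iff.2 hx
  have hn : HasFDerivAt (fun y : Vec d => ‖y‖) (innerSL ℝ (dir x)) x := by
    have h1 := (hasStrictFDerivAt_norm_sq x).hasFDerivAt.sqrt (pow_ne_zero 2 hx')
    have h2 : (fun y : Vec d => Real.sqrt (‖y‖ ^ 2)) = fun y => ‖y‖ := by
      ext y; exact Real.sqrt_sq (norm_nonneg y)
    rw [h2] at h1
    refine h1.congr_fderiv (ContinuousLinearMap.ext fun h => ?_)
    simp [dir, Real.sqrt_sq (norm_nonneg x)]
    field_simp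
  have h3 := ((hasDerivAt_inv hx').comp_hasFDerivAt x hn).smul (hasFDerivAt_id x)
  refine h3.congr_fderiv (ContinuousLinearMap.ext fun h => ?_)
  have h4 : (1 / ‖x‖) * (⟪x, h⟫ / ‖x‖ ^ 2) = ⟪x, h⟫ / ‖x‖ ^ 3 := by
    field_simp
  simp only [ddir_apply, add_apply, smul_apply, ContinuousLinearMap.smulRight_apply,
    ContinuousLinearMap.id_apply, innerSL_apply_apply, id, sub_eq_add_neg, dir,
    inner_smul_left, smul_smul, smul_eq_mul, ← neg_smul]
  simp
  field_simp
  rw [← h4, mul_smul]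

lemma contDiffAt_dir {d : ℕ} {x : Vec d} (hx : x ≠ 0) {n : WithTop ℕ∞} : ContDiffAt ℝ n dir x := by
  unfold dir
  exact ((contDiffAt_norm ℝ hx).inv (norm_ne_zero_iff.2 hx)).smul contDiffAt_id

lemma continuousAt_ddir {d : ℕ} {x : Vec d} (hx : x ≠ 0) : ContinuousAt ddir x := by
  have hd : ContinuousAt (dir : Vec d → Vec d) x := (hasFDerivAt_dir hx).continuousAt
  have hx' : ‖x‖ ≠ 0 := norm_ne_zero_iff.2 hx
  unfold ddir
  refine (continuousAt_id.norm.inv₀ hx').smul (continuousAt_const.sub ?_)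
  have : Continuous fun y : Vec d => (innerSL ℝ y).smulRight y := by fun_prop
  exact this.continuousAt.comp hd

lemma norm_ddir_le {d : ℕ} (x : Vec d) : ‖ddir x‖ ≤ 2 * ‖x‖⁻¹ := by
  refine ContinuousLinearMap.opNorm_le_bound _ (by positivity) fun h => ?_
  rw [ddir_apply, norm_smul, norm_inv, norm_norm, mul_comm 2, mul_assoc]
  gcongr
  have h1 : ‖⟪dir x, h⟫ • dir x‖ ≤ ‖h‖ := by
    rw [norm_smul]
    have := norm_inner_le_norm (𝕜 := ℝ) (dir x) h
    have h2 := norm_dir_le x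
    have h3 : ‖dir x‖ * ‖h‖ ≤ ‖h‖ := mul_le_of_le_one_left (norm_nonneg _) h2
    calc ‖⟪dir x, h⟫‖ * ‖dir x‖ ≤ ‖h‖ * 1 := by
          gcongr
          exact this.trans h3
      _ = _ := mul_one _
  linarith [norm_sub_le h (⟪dir x, h⟫ • dir x)]

lemma inner_ddir {d : ℕ} {u : Vec d} (hu : ‖u‖ = 1) (h : Vec d) : ⟪u, ddir u h⟫ = 0 := by
  rw [ddir_apply, dir_of_norm_eq_one hu, hu, inv_one, one_smul, inner_sub_right, inner_smul_right,
    real_inner_self_eq_norm_sq, hu]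
  ring

lemma norm_ddir_apply_le {d : ℕ} {u : Vec d} (hu : ‖u‖ = 1) (h : Vec d) : ‖ddir u h‖ ≤ ‖h‖ := by
  have h1 : h = ddir u h + ⟪u, h⟫ • u := by
    rw [ddir_apply, dir_of_norm_eq_one hu, hu, inv_one, one_smul, sub_add_cancel]
  have h2 : ‖h‖ ^ 2 = ‖ddir u h‖ ^ 2 + ⟪u, h⟫ ^ 2 := by
    conv_lhs => rw [h1]
    rw [norm_add_sq_real, inner_smul_right, real_inner_comm u, inner_ddir hu, norm_smul, hu]
    simp
  exact le_of_sq_le_sq (by nlinarith [sq_nonneg ⟪u, h⟫]) (norm_nonneg _)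

/-- The open cone of vectors making an angle larger than `η` with `e`. -/
def openCone {d : ℕ} (η : ℝ) (e : Vec d) : Set (Vec d) := {x | x ≠ 0 ∧ η < angle x e}

lemma isOpen_openCone {d : ℕ} (η : ℝ) {e : Vec d} (he : e ≠ 0) : IsOpen (openCone η e) := by
  rw [isOpen_iff_mem_nhds]
  rintro x ⟨hx, hxe⟩
  have h1 : ContinuousAt (fun y : Vec d => angle y e) x := by
    have := (continuousAt_angle (x := (x, e)) hx he).comp
      (f := fun y : Vec d => (y, e)) (x := x) (by fun_prop)
    exact this
  filter_upwards [isOpen_ne.mem_nhds hx, h1.eventually (lt_mem_nhds hxe)] with y hy hy'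
  exact ⟨hy, hy'⟩

lemma angle_dir_left {d : ℕ} (x y : Vec d) (hx : x ≠ 0) : angle (dir x) y = angle x y := by
  unfold dir
  exact angle_smul_left_of_pos _ _ (by positivity)

lemma angle_dir_right {d : ℕ} (x y : Vec d) (hy : y ≠ 0) : angle x (dir y) = angle x y := by
  unfold dir
  exact angle_smul_right_of_pos _ _ (by positivity)

lemma dir_mem_openCone {d : ℕ} {η : ℝ} {e x : Vec d} (hx : x ∈ openCone η e) :
    dir x ∈ openCone η e := by
  refine ⟨?_, ?_⟩
  · rw [← norm_pos_iff, norm_dir hx.1]; exact one_pos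
  · rw [angle_dir_left _ _ hx.1]; exact hx.2

lemma ne_zero_of_norm_eq_one {d : ℕ} {x : Vec d} (h : ‖x‖ = 1) : x ≠ 0 := by
  rw [← norm_pos_iff, h]; exact one_pos

lemma Vseta_eq {d : ℕ} {s : Vec d} (hs : s ≠ 0) (η : ℝ) :
    Vseta s η = {u | ‖u‖ = 1 ∧ u ∈ openCone η (dir s)} := by
  ext u
  simp only [Vseta, sph, openCone, mem_ofPred_eq, mem_sphere_zero_iff_norm,
    angle_dir_right _ _ hs]
  constructor
  · rintro ⟨h1, h2⟩
    exact ⟨h1, ne_zero_of_norm_eq_one h1, h2⟩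
  · rintro ⟨h1, h2, h3⟩
    exact ⟨h1, h3⟩

/-- The chord length subtending the angle `η` on the unit circle. -/
def chord (η : ℝ) : ℝ := Real.sqrt (2 - 2 * Real.cos η)

lemma chord_pos {η : ℝ} (h0 : 0 < η) (hπ : η < Real.pi) : 0 < chord η := by
  apply Real.sqrt_pos.2
  have := Real.cos_lt_cos_of_nonneg_of_le_pi le_rfl hπ.le h0
  rw [Real.cos_zero] at this
  linarith

lemma norm_sub_eq_chord {d : ℕ} {u e : Vec d} (hu : ‖u‖ = 1) (he : ‖e‖ = 1) :
    ‖u - e‖ = chord (angle u e) := by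
  rw [chord, ← Real.sqrt_sq (norm_nonneg (u - e)), norm_sub_sq_real, hu, he, cos_angle, hu, he]
  congr 1
  ring

lemma chord_le_norm_sub {d : ℕ} {η : ℝ} (h0 : 0 ≤ η) {u e : Vec d} (hu : ‖u‖ = 1) (he : ‖e‖ = 1)
    (h : η ≤ angle u e) : chord η ≤ ‖u - e‖ := by
  rw [norm_sub_eq_chord hu he]
  apply Real.sqrt_le_sqrt
  have := Real.cos_le_cos_of_nonneg_of_le_pi h0 (angle_le_pi u e) h
  linarith

lemma angle_le_of_norm_sub_lt {d : ℕ} {η : ℝ} (h0 : 0 ≤ η) {u e : Vec d} (hu : ‖u‖ = 1)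
    (he : ‖e‖ = 1) (h : ‖u - e‖ < chord η) : angle u e ≤ η := by
  by_contra! h'
  exact absurd (chord_le_norm_sub h0 hu he h'.le) (not_le.2 h)

/-! ### Specular reflection and the projection of the impact location -/

lemma dir_reflect_sub {d : ℕ} {v w : Vec d} (hw : ‖w‖ = 1) (hvw : ⟪v, w⟫ < 0) :
    dir (v - (2 * ⟪v, w⟫) • w - v) = w := by
  have : v - (2 * ⟪v, w⟫) • w - v = (-(2 * ⟪v, w⟫)) • w := by
    rw [neg_smul]; abel
  rw [this, dir_smul (by linarith), dir_of_norm_eq_one hw]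

lemma norm_reflect {d : ℕ} {v w : Vec d} (hv : ‖v‖ = 1) (hw : ‖w‖ = 1) :
    ‖v - (2 * ⟪v, w⟫) • w‖ = 1 := by
  have : ‖v - (2 * ⟪v, w⟫) • w‖ ^ 2 = 1 ^ 2 := by
    rw [norm_sub_sq_real, inner_smul_right, norm_smul, hv, hw, mul_one, Real.norm_eq_abs, sq_abs]
    ring
  exact (pow_left_inj₀ (norm_nonneg _) zero_le_one two_ne_zero).1 this

lemma inner_dir_sub {d : ℕ} {v u : Vec d} (hv : ‖v‖ = 1) (hu : ‖u‖ = 1) (huv : u ≠ v) :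
    ⟪v, dir (u - v)⟫ = -(‖u - v‖ / 2) := by
  have h0 : ‖u - v‖ ≠ 0 := norm_ne_zero_iff.2 (sub_ne_zero.2 huv)
  have h1 : ‖u - v‖ ^ 2 = 2 - 2 * ⟪v, u⟫ := by
    rw [norm_sub_sq_real, hu, hv, real_inner_comm]; ring
  rw [dir, inner_smul_right, inner_sub_right, real_inner_self_eq_norm_sq, hv]
  field_simp
  linarith

lemma inner_dir_sub_neg {d : ℕ} {v u : Vec d} (hv : ‖v‖ = 1) (hu : ‖u‖ = 1) (huv : u ≠ v) :
    ⟪v, dir (u - v)⟫ < 0 := by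
  rw [inner_dir_sub hv hu huv]
  have := norm_pos_iff.2 (sub_ne_zero.2 huv)
  linarith

lemma reflect_dir_sub {d : ℕ} {v u : Vec d} (hv : ‖v‖ = 1) (hu : ‖u‖ = 1) (huv : u ≠ v) :
    v - (2 * ⟪v, dir (u - v)⟫) • dir (u - v) = u := by
  rw [inner_dir_sub hv hu huv]
  have : -(2 * -(‖u - v‖ / 2)) = ‖u - v‖ := by ring
  rw [sub_eq_add_neg, ← neg_smul, this, norm_smul_dir]
  abel

lemma inner_self_of_norm_eq_one {d : ℕ} {e : Vec d} (he : ‖e‖ = 1) : ⟪e, e⟫ = 1 := by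
  rw [real_inner_self_eq_norm_sq, he, one_pow]

lemma ddir_apply_of_norm_eq_one {d : ℕ} {e : Vec d} (he : ‖e‖ = 1) (h : Vec d) :
    ddir e h = h - ⟪e, h⟫ • e := by
  rw [ddir_apply, dir_of_norm_eq_one he, he, inv_one, one_smul]

lemma ddir_self {d : ℕ} {e : Vec d} (he : ‖e‖ = 1) : ddir e e = 0 := by
  rw [ddir_apply_of_norm_eq_one he, inner_self_of_norm_eq_one he, one_smul, sub_self]

lemma ddir_ddir {d : ℕ} {e : Vec d} (he : ‖e‖ = 1) (h : Vec d) : ddir e (ddir e h) = ddir e h := by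
  rw [ddir_apply_of_norm_eq_one he (ddir e h), inner_ddir he, zero_smul, sub_zero]

lemma norm_ddir_sq {d : ℕ} {e : Vec d} (he : ‖e‖ = 1) (h : Vec d) :
    ‖ddir e h‖ ^ 2 = ‖h‖ ^ 2 - ⟪e, h⟫ ^ 2 := by
  rw [ddir_apply_of_norm_eq_one he, norm_sub_sq_real, inner_smul_right, norm_smul, he, mul_one,
    Real.norm_eq_abs, sq_abs, real_inner_comm]
  ring

/-- The impact parameter (in the disc orthogonal to `e`) of the ray with incoming direction `e`
which is scattered in direction `u` by the unit sphere. -/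
def impactParam {d : ℕ} (e u : Vec d) : Vec d := ddir e (dir (u - e))

lemma inner_impactParam {d : ℕ} {e : Vec d} (he : ‖e‖ = 1) (u : Vec d) :
    ⟪e, impactParam e u⟫ = 0 := inner_ddir he _

lemma norm_impactParam_lt {d : ℕ} {e u : Vec d} (he : ‖e‖ = 1) (hu : ‖u‖ = 1) (hue : u ≠ e) :
    ‖impactParam e u‖ < 1 := by
  have h1 := norm_ddir_sq he (dir (u - e))
  rw [norm_dir (sub_ne_zero.2 hue)] at h1
  have h2 := inner_dir_sub_neg he hu hue
  have h3 : ‖impactParam e u‖ ^ 2 < 1 ^ 2 := by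
    rw [impactParam, h1]; nlinarith
  exact lt_of_pow_lt_pow_left₀ 2 zero_le_one h3

lemma impactParam_sub_sqrt {d : ℕ} {e u : Vec d} (he : ‖e‖ = 1) (hu : ‖u‖ = 1) (hue : u ≠ e) :
    impactParam e u - Real.sqrt (1 - ‖impactParam e u‖ ^ 2) • e = dir (u - e) := by
  have h1 := norm_ddir_sq he (dir (u - e))
  rw [norm_dir (sub_ne_zero.2 hue)] at h1
  have h2 := inner_dir_sub_neg he hu hue
  have h3 : 1 - ‖impactParam e u‖ ^ 2 = (-⟪e, dir (u - e)⟫) ^ 2 := by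
    rw [impactParam, h1]; ring
  rw [h3, Real.sqrt_sq (by linarith), impactParam, ddir_apply_of_norm_eq_one he, neg_smul]
  abel

lemma scatterDir_impactParam {d : ℕ} {e u : Vec d} (he : ‖e‖ = 1) (hu : ‖u‖ = 1) (hue : u ≠ e) :
    scatterDir e (impactParam e u) = u := by
  rw [scatterDir, dir_of_norm_eq_one he, impactParam_sub_sqrt he hu hue,
    reflect_dir_sub he hu hue]

lemma norm_sub_sqrt_smul {d : ℕ} {e x : Vec d} (he : ‖e‖ = 1) (hx : ⟪e, x⟫ = 0) (hx1 : ‖x‖ < 1) :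
    ‖x - Real.sqrt (1 - ‖x‖ ^ 2) • e‖ = 1 := by
  have h0 : 0 < 1 - ‖x‖ ^ 2 := by nlinarith [norm_nonneg x]
  have : ‖x - Real.sqrt (1 - ‖x‖ ^ 2) • e‖ ^ 2 = 1 ^ 2 := by
    rw [norm_sub_sq_real, inner_smul_right, norm_smul, he, real_inner_comm, hx, mul_one,
      Real.norm_eq_abs, sq_abs, Real.sq_sqrt h0.le]
    ring
  exact (pow_left_inj₀ (norm_nonneg _) zero_le_one two_ne_zero).1 this

lemma inner_sub_sqrt_smul {d : ℕ} {e x : Vec d} (he : ‖e‖ = 1) (hx : ⟪e, x⟫ = 0) :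
    ⟪e, x - Real.sqrt (1 - ‖x‖ ^ 2) • e⟫ = -Real.sqrt (1 - ‖x‖ ^ 2) := by
  rw [inner_sub_right, inner_smul_right, hx, inner_self_of_norm_eq_one he]
  ring

lemma norm_scatterDir {d : ℕ} {e x : Vec d} (he : ‖e‖ = 1) (hx : ⟪e, x⟫ = 0) (hx1 : ‖x‖ < 1) :
    ‖scatterDir e x‖ = 1 := by
  rw [scatterDir, dir_of_norm_eq_one he]
  exact norm_reflect he (norm_sub_sqrt_smul he hx hx1)

lemma impactParam_scatterDir {d : ℕ} {e x : Vec d} (he : ‖e‖ = 1) (hx : ⟪e, x⟫ = 0)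
    (hx1 : ‖x‖ < 1) : impactParam e (scatterDir e x) = x := by
  have h0 : 0 < 1 - ‖x‖ ^ 2 := by nlinarith [norm_nonneg x]
  have h1 := inner_sub_sqrt_smul he hx
  rw [impactParam, scatterDir, dir_of_norm_eq_one he, dir_reflect_sub (norm_sub_sqrt_smul he hx hx1)
    (by rw [h1]; exact neg_lt_zero.2 (Real.sqrt_pos.2 h0)), map_sub, map_smul, ddir_self he,
    ddir_apply_of_norm_eq_one he, hx]
  simp

/-- The extension of a map on the unit sphere which is positively homogeneous of degree one. -/
def homog {d : ℕ} (f : Vec d → Vec d) (x : Vec d) : Vec d := ‖x‖ • f (dir x)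

lemma hasFDerivAt_homog {d : ℕ} {f : Vec d → Vec d} {A : Vec d →L[ℝ] Vec d} {u : Vec d}
    (hu : ‖u‖ = 1) (hf : HasFDerivAt (fun x => f (dir x)) A u) :
    HasFDerivAt (homog f) ((innerSL ℝ u).smulRight (f u) + A) u := by
  have hu0 : u ≠ 0 := ne_zero_of_norm_eq_one hu
  have hn : HasFDerivAt (fun y : Vec d => ‖y‖) (innerSL ℝ u) u := by
    have h1 := (hasStrictFDerivAt_norm_sq u).hasFDerivAt.sqrt (by simp [hu])
    have h2 : (fun y : Vec d => Real.sqrt (‖y‖ ^ 2)) = fun y => ‖y‖ := by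
      ext y; exact Real.sqrt_sq (norm_nonneg y)
    rw [h2] at h1
    refine h1.congr_fderiv (ContinuousLinearMap.ext fun h => ?_)
    simp [hu]
  have h3 := hn.smul hf
  refine h3.congr_fderiv ?_
  rw [hu, one_smul, dir_of_norm_eq_one hu, add_comm]

lemma homog_smul {d : ℕ} (f : Vec d → Vec d) {t : ℝ} (ht : 0 < t) (x : Vec d) :
    homog f (t • x) = t • homog f x := by
  rw [homog, homog, dir_smul ht, norm_smul, Real.norm_of_nonneg ht.le, mul_smul]

lemma hasFDerivAt_dir_dir_sub {d : ℕ} {e u : Vec d} (hu : ‖u‖ = 1) (hue : u ≠ e) :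
    HasFDerivAt (fun x => dir (dir x - e)) (ddir (u - e) ∘L ddir u) u := by
  have h1 : HasFDerivAt (fun x : Vec d => dir x - e) (ddir u) u :=
    (hasFDerivAt_dir (ne_zero_of_norm_eq_one hu)).sub_const e
  have h2 : dir u - e ≠ 0 := by rw [dir_of_norm_eq_one hu]; exact sub_ne_zero.2 hue
  have h3 := (hasFDerivAt_dir h2).comp u h1
  rw [dir_of_norm_eq_one hu] at h3
  exact h3

/-- The derivative at `u` of the homogeneous extension of `u ↦ e + impactParam e u`. -/
def coneDeriv {d : ℕ} (e u : Vec d) : Vec d →L[ℝ] Vec d :=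
  (innerSL ℝ u).smulRight (e + impactParam e u) + ddir e ∘L (ddir (u - e) ∘L ddir u)

lemma hasFDerivAt_homog_impactParam {d : ℕ} {e u : Vec d} (hu : ‖u‖ = 1) (hue : u ≠ e) :
    HasFDerivAt (homog fun x => e + impactParam e x) (coneDeriv e u) u := by
  refine hasFDerivAt_homog (f := fun x => e + impactParam e x) hu ?_
  exact ((ddir e).hasFDerivAt.comp u (hasFDerivAt_dir_dir_sub hu hue)).const_add e

/-- The tangential Jacobian of `impactParam e` at `u`. -/
def coneJac {d : ℕ} (e u : Vec d) : ℝ := |(coneDeriv e u).det|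

lemma continuousAt_coneDeriv {d : ℕ} {e u : Vec d} (he : e ≠ 0) (hu : u ≠ 0) (hue : u ≠ e) :
    ContinuousAt (fun p : Vec d × Vec d => coneDeriv p.1 p.2) (e, u) := by
  have h1 : ContinuousAt (fun p : Vec d × Vec d => ddir p.1) (e, u) :=
    ContinuousAt.comp (g := ddir) (continuousAt_ddir he) continuousAt_fst
  have h2 : ContinuousAt (fun p : Vec d × Vec d => ddir p.2) (e, u) :=
    ContinuousAt.comp (g := ddir) (continuousAt_ddir hu) continuousAt_snd
  have h3 : ContinuousAt (fun p : Vec d × Vec d => ddir (p.2 - p.1)) (e, u) :=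
    ContinuousAt.comp (g := ddir) (f := fun p : Vec d × Vec d => p.2 - p.1)
      (continuousAt_ddir (sub_ne_zero.2 hue)) (by fun_prop)
  have h4 : ContinuousAt (fun p : Vec d × Vec d => dir (p.2 - p.1)) (e, u) :=
    ContinuousAt.comp (g := dir) (f := fun p : Vec d × Vec d => p.2 - p.1)
      (hasFDerivAt_dir (sub_ne_zero.2 hue)).continuousAt (by fun_prop)
  have h5 : ContinuousAt (fun p : Vec d × Vec d => p.1 + ddir p.1 (dir (p.2 - p.1))) (e, u) :=
    continuousAt_fst.add (h1.clm_apply h4)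
  have h6 : Continuous fun q : Vec d × Vec d => (innerSL ℝ q.1).smulRight q.2 := by fun_prop
  have h7 : ContinuousAt (fun p : Vec d × Vec d =>
      (innerSL ℝ p.2).smulRight (p.1 + ddir p.1 (dir (p.2 - p.1)))) (e, u) :=
    ContinuousAt.comp (f := fun p : Vec d × Vec d => (p.2, p.1 + ddir p.1 (dir (p.2 - p.1))))
      h6.continuousAt (continuousAt_snd.prodMk h5)
  exact h7.add (h1.clm_comp (h3.clm_comp h2))

lemma continuousAt_coneJac {d : ℕ} {e u : Vec d} (he : e ≠ 0) (hu : u ≠ 0) (hue : u ≠ e) :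
    ContinuousAt (fun p : Vec d × Vec d => coneJac p.1 p.2) (e, u) :=
  ((ContinuousLinearMap.continuous_det (𝕜 := ℝ) (E := Vec d)).continuousAt.comp
    (continuousAt_coneDeriv he hu hue)).abs

lemma scatterDir_smul_sub_homog {d : ℕ} {e x : Vec d} (he : ‖e‖ = 1) (hx : x ≠ 0)
    (hxe : dir x ≠ e) :
    ⟪e, homog (fun u => e + impactParam e u) x⟫ • scatterDir e
      (⟪e, homog (fun u => e + impactParam e u) x⟫⁻¹ • homog (fun u => e + impactParam e u) x - e)
      = x := by
  have h1 : ⟪e, homog (fun u => e + impactParam e u) x⟫ = ‖x‖ := by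
    rw [homog, inner_smul_right, inner_add_right, inner_impactParam he,
      inner_self_of_norm_eq_one he]
    ring
  rw [h1, homog, smul_smul, inv_mul_cancel₀ (norm_ne_zero_iff.2 hx), one_smul, add_sub_cancel_left,
    scatterDir_impactParam he (norm_dir hx) hxe, norm_smul_dir]

lemma coneJac_pos {d : ℕ} {e u : Vec d} (he : ‖e‖ = 1) (hu : ‖u‖ = 1) (hue : u ≠ e) :
    0 < coneJac e u := by
  have hu0 := ne_zero_of_norm_eq_one hu
  set K := homog fun x => e + impactParam e x with hK
  set Q : Vec d → Vec d := fun z => ⟪e, z⟫ • scatterDir e (⟪e, z⟫⁻¹ • z - e) with hQ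
  have hKu : K u = e + impactParam e u := by
    rw [hK, homog, hu, one_smul, dir_of_norm_eq_one hu]
  have h1 : ⟪e, K u⟫ = 1 := by
    rw [hKu, inner_add_right, inner_impactParam he, inner_self_of_norm_eq_one he, add_zero]
  have hlt := norm_impactParam_lt he hu hue
  have hdQ : DifferentiableAt ℝ Q (K u) := by
    have d1 : DifferentiableAt ℝ (fun z : Vec d => ⟪e, z⟫) (K u) :=
      (innerSL ℝ e).differentiableAt
    have d2 : DifferentiableAt ℝ (fun z : Vec d => ⟪e, z⟫⁻¹ • z - e) (K u) :=
      ((d1.inv (by rw [h1]; exact one_ne_zero)).smul differentiableAt_id).sub_const e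
    have d3 : DifferentiableAt ℝ (scatterDir e) (⟪e, K u⟫⁻¹ • K u - e) := by
      rw [h1, inv_one, one_smul, hKu, add_sub_cancel_left]
      have d4 : DifferentiableAt ℝ (fun x : Vec d => Real.sqrt (1 - ‖x‖ ^ 2)) (impactParam e u) := by
        refine DifferentiableAt.sqrt ?_ (by nlinarith [norm_nonneg (impactParam e u)])
        exact (differentiableAt_const _).sub (differentiableAt_id.norm_sq ℝ)
      have d5 : DifferentiableAt ℝ (fun x : Vec d => x - Real.sqrt (1 - ‖x‖ ^ 2) • dir e)
          (impactParam e u) := differentiableAt_id.sub (d4.smul_const _)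
      unfold scatterDir
      exact (differentiableAt_const _).sub
        ((((differentiableAt_const _).inner ℝ d5).const_mul 2).smul d5)
    have d6 : DifferentiableAt ℝ (fun z : Vec d => scatterDir e (⟪e, z⟫⁻¹ • z - e)) (K u) :=
      DifferentiableAt.comp (g := scatterDir e) (K u) d3 d2
    exact d1.smul d6
  have hcomp := hdQ.hasFDerivAt.comp u (hasFDerivAt_homog_impactParam hu hue)
  have hev : Q ∘ K =ᶠ[𝓝 u] id := by
    have hc : ContinuousAt (dir : Vec d → Vec d) u := (hasFDerivAt_dir hu0).continuousAt
    have hne : dir u ≠ e := by rwa [dir_of_norm_eq_one hu]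
    filter_upwards [isOpen_ne.mem_nhds hu0, hc.eventually_ne hne] with x hx hxe
    exact scatterDir_smul_sub_homog he hx hxe
  have hid : fderiv ℝ Q (K u) ∘L coneDeriv e u = ContinuousLinearMap.id ℝ (Vec d) :=
    hcomp.unique ((hasFDerivAt_id u).congr_of_eventuallyEq hev)
  have hdet : (fderiv ℝ Q (K u)).det * (coneDeriv e u).det = 1 := by
    have := congrArg ContinuousLinearMap.det hid
    simpa [ContinuousLinearMap.det, LinearMap.det_comp] using this
  exact abs_pos.2 (right_ne_zero_of_mul (hdet ▸ one_ne_zero))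

/-! ### Uniform estimates by compactness -/

/-- Pairs of unit vectors at distance at least `c`. -/
def farPairs (d : ℕ) (c : ℝ) : Set (Vec d × Vec d) :=
  {p | ‖p.1‖ = 1 ∧ ‖p.2‖ = 1 ∧ c ≤ ‖p.2 - p.1‖}

lemma isCompact_farPairs (d : ℕ) (c : ℝ) : IsCompact (farPairs d c) := by
  have h : farPairs d c = (sphere (0 : Vec d) 1 ×ˢ sphere (0 : Vec d) 1) ∩
      {p | c ≤ ‖p.2 - p.1‖} := by
    ext p
    simp [farPairs, and_assoc]
  rw [h]
  exact ((isCompact_sphere _ _).prod (isCompact_sphere _ _)).inter_right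
    (isClosed_le continuous_const (by fun_prop))

lemma ne_of_pos_le_norm_sub {d : ℕ} {c : ℝ} (hc : 0 < c) {u e : Vec d} (h : c ≤ ‖u - e‖) :
    u ≠ e := by
  rintro rfl
  simp at h
  linarith

lemma continuousOn_coneJac {d : ℕ} {c : ℝ} (hc : 0 < c) :
    ContinuousOn (fun p : Vec d × Vec d => coneJac p.1 p.2) (farPairs d c) :=
  fun _ hp => (continuousAt_coneJac (ne_zero_of_norm_eq_one hp.1) (ne_zero_of_norm_eq_one hp.2.1)
    (ne_of_pos_le_norm_sub hc hp.2.2)).continuousWithinAt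

lemma exists_coneJac_lower_bound (d : ℕ) {c : ℝ} (hc : 0 < c) :
    ∃ j > 0, ∀ e u : Vec d, ‖e‖ = 1 → ‖u‖ = 1 → c ≤ ‖u - e‖ → j ≤ coneJac e u := by
  rcases (farPairs d c).eq_empty_or_nonempty with h | h
  · refine ⟨1, one_pos, fun e u he hu hc => ?_⟩
    have : (e, u) ∈ farPairs d c := ⟨he, hu, hc⟩
    simp [h] at this
  · obtain ⟨p, hp, hmin⟩ := (isCompact_farPairs d c).exists_isMinOn h (continuousOn_coneJac hc)
    exact ⟨coneJac p.1 p.2, coneJac_pos hp.1 hp.2.1 (ne_of_pos_le_norm_sub hc hp.2.2),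
      fun e u he hu h => isMinOn_iff.1 hmin (e, u) ⟨he, hu, h⟩⟩

lemma exists_coneJac_oscillation (d : ℕ) {c : ℝ} (hc : 0 < c) {ε : ℝ} (hε : 0 < ε) :
    ∃ r > 0, ∀ e u u' : Vec d, ‖e‖ = 1 → ‖u‖ = 1 → ‖u'‖ = 1 → c ≤ ‖u - e‖ → c ≤ ‖u' - e‖ →
      ‖u - u'‖ < r → |coneJac e u - coneJac e u'| ≤ ε * coneJac e u' := by
  obtain ⟨j, hj, hj'⟩ := exists_coneJac_lower_bound d hc
  have h := (isCompact_farPairs d c).uniformContinuousOn_of_continuous (continuousOn_coneJac hc)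
  obtain ⟨r, hr, h⟩ := Metric.uniformContinuousOn_iff.1 h (ε * j) (by positivity)
  refine ⟨r, hr, fun e u u' he hu hu' h1 h2 h3 => ?_⟩
  have := h (e, u) ⟨he, hu, h1⟩ (e, u') ⟨he, hu', h2⟩ (by
    rw [Prod.dist_eq, dist_self, dist_eq_norm]; exact max_lt hr h3)
  rw [Real.dist_eq] at this
  exact this.le.trans (mul_le_mul_of_nonneg_left (hj' e u' he hu' h2) hε.le)

lemma exists_ddir_oscillation (d : ℕ) {c : ℝ} (hc : 0 < c) {ε : ℝ} (hε : 0 < ε) :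
    ∃ r > 0, ∀ x y : Vec d, c ≤ ‖x‖ → ‖x‖ ≤ 3 → c ≤ ‖y‖ → ‖y‖ ≤ 3 → ‖x - y‖ < r →
      ‖ddir x - ddir y‖ < ε := by
  set S : Set (Vec d) := closedBall 0 3 ∩ {x | c ≤ ‖x‖}
  have hS : IsCompact S := (isCompact_closedBall _ _).inter_right
    (isClosed_le continuous_const continuous_norm)
  have hcont : ContinuousOn (ddir : Vec d → _) S := fun x hx =>
    (continuousAt_ddir (norm_pos_iff.1 (hc.trans_le hx.2))).continuousWithinAt
  obtain ⟨r, hr, h⟩ := Metric.uniformContinuousOn_iff.1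
    (hS.uniformContinuousOn_of_continuous hcont) ε hε
  refine ⟨r, hr, fun x y hx hx' hy hy' hxy => ?_⟩
  rw [← dist_eq_norm]
  exact h x ⟨by simpa using hx', hx⟩ y ⟨by simpa using hy', hy⟩ (by rwa [dist_eq_norm])

/-- The rescaled derivative of a scattering step, as a function of the parameter `τ`, the incoming
direction `e`, the outgoing direction `u`, the shift `b`, the impact offset `a` and its
derivative `A`. -/
def stepDeriv {d : ℕ} (τ : ℝ) (e u b a : Vec d) (A : Vec d →L[ℝ] Vec d) : Vec d →L[ℝ] Vec d :=
  (innerSL ℝ u).smulRight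
      (‖e + τ • a‖⁻¹ • ((1 + τ * ⟪e, a⟫) • (e + ddir e b) + ddir e a)) +
    (ddir e + τ • (innerSL ℝ e).smulRight (e + ddir e b)) ∘L (ddir (e + τ • a) ∘L A)

lemma stepDeriv_zero {d : ℕ} {e : Vec d} (he : ‖e‖ = 1) (u b : Vec d) :
    stepDeriv 0 e u b (dir (u - e) - b) (ddir (u - e) ∘L ddir u) = coneDeriv e u := by
  refine ContinuousLinearMap.ext fun h => ?_
  simp [stepDeriv, coneDeriv, he, ddir_ddir he, impactParam]

lemma continuousAt_stepDeriv {d : ℕ}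
    (p : ℝ × Vec d × Vec d × Vec d × Vec d × (Vec d →L[ℝ] Vec d)) (he : p.2.1 ≠ 0)
    (ha : p.2.1 + p.1 • p.2.2.2.2.1 ≠ 0) :
    ContinuousAt (fun p : ℝ × Vec d × Vec d × Vec d × Vec d × (Vec d →L[ℝ] Vec d) =>
      stepDeriv p.1 p.2.1 p.2.2.1 p.2.2.2.1 p.2.2.2.2.1 p.2.2.2.2.2) p := by
  have h1 : ContinuousAt (fun p : ℝ × Vec d × Vec d × Vec d × Vec d × (Vec d →L[ℝ] Vec d) =>
      ddir p.2.1) p :=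
    ContinuousAt.comp (g := ddir)
      (f := fun p : ℝ × Vec d × Vec d × Vec d × Vec d × (Vec d →L[ℝ] Vec d) => p.2.1)
      (continuousAt_ddir he) (by fun_prop)
  have h2 : ContinuousAt (fun p : ℝ × Vec d × Vec d × Vec d × Vec d × (Vec d →L[ℝ] Vec d) =>
      ddir (p.2.1 + p.1 • p.2.2.2.2.1)) p :=
    ContinuousAt.comp (g := ddir)
      (f := fun p : ℝ × Vec d × Vec d × Vec d × Vec d × (Vec d →L[ℝ] Vec d) =>
        p.2.1 + p.1 • p.2.2.2.2.1)
      (continuousAt_ddir ha) (by fun_prop)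
  have h3 : ContinuousAt (fun p : ℝ × Vec d × Vec d × Vec d × Vec d × (Vec d →L[ℝ] Vec d) =>
      ‖p.2.1 + p.1 • p.2.2.2.2.1‖⁻¹) p :=
    ContinuousAt.inv₀ (by fun_prop) (norm_ne_zero_iff.2 ha)
  have h4 : ContinuousAt (fun p : ℝ × Vec d × Vec d × Vec d × Vec d × (Vec d →L[ℝ] Vec d) =>
      p.2.1 + ddir p.2.1 p.2.2.2.1) p :=
    ContinuousAt.add (by fun_prop) (h1.clm_apply (by fun_prop))
  have h5 : ContinuousAt (fun p : ℝ × Vec d × Vec d × Vec d × Vec d × (Vec d →L[ℝ] Vec d) =>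
      ddir p.2.1 p.2.2.2.2.1) p := h1.clm_apply (by fun_prop)
  have h6 : ContinuousAt (fun p : ℝ × Vec d × Vec d × Vec d × Vec d × (Vec d →L[ℝ] Vec d) =>
      1 + p.1 * ⟪p.2.1, p.2.2.2.2.1⟫) p := by
    refine continuousAt_const.add (continuousAt_fst.mul (ContinuousAt.inner ?_ ?_)) <;> fun_prop
  have h7 : Continuous fun q : Vec d × Vec d => (innerSL ℝ q.1).smulRight q.2 := by fun_prop
  have h8 : ∀ f g : ℝ × Vec d × Vec d × Vec d × Vec d × (Vec d →L[ℝ] Vec d) → Vec d,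
      ContinuousAt f p → ContinuousAt g p →
      ContinuousAt (fun p => (innerSL ℝ (f p)).smulRight (g p)) p := fun f g hf hg =>
    ContinuousAt.comp (f := fun p => (f p, g p)) h7.continuousAt (hf.prodMk hg)
  unfold stepDeriv
  refine (h8 _ _ (by fun_prop) (h3.smul ((h6.smul h4).add h5))).add ?_
  exact (h1.add (continuousAt_fst.smul (h8 _ _ (by fun_prop) h4))).clm_comp
    (h2.clm_comp (by fun_prop))

lemma exists_det_stepDeriv_near (d : ℕ) {c : ℝ} (hc : 0 < c) (C : ℝ) {ε : ℝ} (hε : 0 < ε) :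
    ∃ δ > 0, ∀ (τ : ℝ) (e u b a : Vec d) (A : Vec d →L[ℝ] Vec d), 0 ≤ τ → τ < δ → ‖e‖ = 1 →
      ‖u‖ = 1 → c ≤ ‖u - e‖ → ‖b‖ ≤ C → ‖a - (dir (u - e) - b)‖ < δ →
      ‖A - ddir (u - e) ∘L ddir u‖ < δ →
      |(|(stepDeriv τ e u b a A).det|) - coneJac e u| < ε := by
  rcases lt_or_ge C 0 with hC | hC
  · exact ⟨1, one_pos, fun τ e u b a A _ _ _ _ _ hb => absurd (norm_nonneg b) (by linarith)⟩
  set S : Set (ℝ × Vec d × Vec d × Vec d × Vec d × (Vec d →L[ℝ] Vec d)) :=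
    Icc 0 (1 / (2 * (C + 2))) ×ˢ sphere 0 1 ×ˢ sphere 0 1 ×ˢ closedBall 0 C ×ˢ
      closedBall 0 (C + 2) ×ˢ closedBall 0 (4 * c⁻¹ + 1) with hS
  have : ProperSpace (Vec d →L[ℝ] Vec d) := FiniteDimensional.proper ℝ _
  have hScomp : IsCompact S := isCompact_Icc.prod ((isCompact_sphere _ _).prod
    ((isCompact_sphere _ _).prod ((isCompact_closedBall _ _).prod
      ((isCompact_closedBall _ _).prod (isCompact_closedBall _ _)))))
  have hcont : ContinuousOn (fun p : ℝ × Vec d × Vec d × Vec d × Vec d × (Vec d →L[ℝ] Vec d) =>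
      |(stepDeriv p.1 p.2.1 p.2.2.1 p.2.2.2.1 p.2.2.2.2.1 p.2.2.2.2.2).det|) S := by
    rintro ⟨τ, e, u, b, a, A⟩ ⟨hτ, he, hu, hb, ha, hA⟩
    simp only [mem_sphere_zero_iff_norm, mem_closedBall_zero_iff] at he hu hb ha hA
    refine (ContinuousAt.abs (ContinuousAt.comp (g := ContinuousLinearMap.det)
      (ContinuousLinearMap.continuous_det (𝕜 := ℝ) (E := Vec d)).continuousAt
        (continuousAt_stepDeriv _ ?_ ?_))).continuousWithinAt
    · exact ne_zero_of_norm_eq_one he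
    · intro h0
      have h0' : e + τ • a = 0 := h0
      have hτ' : 0 ≤ τ := hτ.1
      have h1 : ‖e‖ = ‖τ • a‖ := by rw [eq_neg_of_add_eq_zero_left h0', norm_neg]
      rw [he, norm_smul, Real.norm_of_nonneg hτ'] at h1
      have h2 : τ * ‖a‖ ≤ 1 / (2 * (C + 2)) * (C + 2) :=
        mul_le_mul hτ.2 ha (norm_nonneg _) (by positivity)
      have h3 : 1 / (2 * (C + 2)) * (C + 2) = 1 / 2 := by field_simp
      linarith
  obtain ⟨r, hr, h⟩ := Metric.uniformContinuousOn_iff.1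
    (hScomp.uniformContinuousOn_of_continuous hcont) ε hε
  refine ⟨min r (min 1 (1 / (2 * (C + 2)))), by positivity,
    fun τ e u b a A hτ0 hτ he hu hue hb ha hA => ?_⟩
  have hτ1 := hτ.trans_le (min_le_left _ _)
  have hτ2 := hτ.trans_le ((min_le_right _ _).trans (min_le_right _ _))
  have ha1 := ha.trans_le (min_le_left _ _)
  have ha2 := ha.trans_le ((min_le_right _ _).trans (min_le_left _ _))
  have hA1 := hA.trans_le (min_le_left _ _)
  have hA2 := hA.trans_le ((min_le_right _ _).trans (min_le_left _ _))
  have hb0 : ‖dir (u - e) - b‖ ≤ C + 1 :=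
    (norm_sub_le _ _).trans (by linarith [norm_dir_le (u - e)])
  have hA0 : ‖ddir (u - e) ∘L ddir u‖ ≤ 4 * c⁻¹ := by
    refine (ContinuousLinearMap.opNorm_comp_le _ _).trans ?_
    have h1 := norm_ddir_le (u - e)
    have h2 := norm_ddir_le u
    rw [hu] at h2
    have h3 : ‖u - e‖⁻¹ ≤ c⁻¹ := inv_anti₀ hc hue
    calc ‖ddir (u - e)‖ * ‖ddir u‖ ≤ (2 * c⁻¹) * (2 * 1⁻¹) := by
          gcongr
          linarith
      _ = _ := by ring
  have hp : (τ, e, u, b, a, A) ∈ S := by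
    refine ⟨⟨hτ0, hτ2.le⟩, by simpa using he, by simpa using hu, by simpa using hb, ?_, ?_⟩
    · rw [mem_closedBall_zero_iff]
      have := norm_sub_norm_le a (dir (u - e) - b)
      dsimp only
      linarith
    · rw [mem_closedBall_zero_iff]
      have := norm_sub_norm_le A (ddir (u - e) ∘L ddir u)
      dsimp only
      linarith
  have hq : ((0 : ℝ), e, u, b, dir (u - e) - b, ddir (u - e) ∘L ddir u) ∈ S := by
    refine ⟨⟨le_rfl, by positivity⟩, by simpa using he, by simpa using hu, by simpa using hb,
      ?_, ?_⟩
    · rw [mem_closedBall_zero_iff]; dsimp only; linarith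
    · rw [mem_closedBall_zero_iff]; dsimp only; linarith
  have := h _ hp _ hq (by
    simp only [Prod.dist_eq, dist_self]
    refine max_lt ?_ (max_lt hr (max_lt hr (max_lt hr (max_lt ?_ ?_))))
    · rwa [Real.dist_eq, sub_zero, abs_of_nonneg hτ0]
    · rwa [dist_eq_norm]
    · rwa [dist_eq_norm])
  rw [Real.dist_eq] at this
  simpa only [stepDeriv_zero he, coneJac] using this

/-! ### A single scattering step as a contraction -/

/-- The incoming direction produced by one scattering step with parameter `τ`, when the particle
starts near the impact location `B v` and leaves in direction `u`. -/
def stepMap {d : ℕ} (τ : ℝ) (e : Vec d) (B : Vec d → Vec d) (u v : Vec d) : Vec d :=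
  dir (e + τ • (dir (u - v) - B v))

/-- The solution `v` of `stepMap τ e B (dir x) v = v` with `‖v - e‖ ≤ R`, if it exists. -/
def stepInv {d : ℕ} (τ : ℝ) (e : Vec d) (B : Vec d → Vec d) (R : ℝ) (x : Vec d) : Vec d :=
  open Classical in
  if h : ∃ v ∈ closedBall e R, stepMap τ e B (dir x) v = v then h.choose else 0

lemma stepInv_dir {d : ℕ} (τ : ℝ) (e : Vec d) (B : Vec d → Vec d) (R : ℝ) (x : Vec d) :
    stepInv τ e B R (dir x) = stepInv τ e B R x := by
  unfold stepInv
  generalize hy : dir (dir x) = y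
  rw [dir_dir] at hy
  subst hy
  rfl

/-- The standing assumptions under which a scattering step is a contraction. -/
structure StepHyp {d : ℕ} (c r C τ : ℝ) (e : Vec d) (B : Vec d → Vec d) : Prop where
  c_pos : 0 < c
  r_pos : 0 < r
  norm_e : ‖e‖ = 1
  τ_pos : 0 < τ
  C_nonneg : 0 ≤ C
  contDiffOn : ContDiffOn ℝ 1 B (ball e r)
  norm_le : ∀ v ∈ ball e r, ‖B v‖ ≤ C
  norm_fderiv_le : ∀ v ∈ ball e r, ‖fderiv ℝ B v‖ ≤ C
  τ_small : 8 * (τ * (1 + C + 4 / c)) ≤ 1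
  τ_small' : 4 * (τ * (1 + C + 4 / c)) ≤ min r c

namespace StepHyp

variable {d : ℕ} {c r C τ : ℝ} {e : Vec d} {B : Vec d → Vec d}

lemma mem_ball (H : StepHyp c r C τ e B) {v : Vec d} (hv : v ∈ closedBall e (min r c / 2)) :
    v ∈ ball e r := by
  rw [mem_closedBall] at hv
  rw [Metric.mem_ball]
  linarith [min_le_left r c, H.r_pos]

lemma le_norm_sub {u v : Vec d} (hu : c ≤ ‖u - e‖)
    (hv : v ∈ closedBall e (min r c / 2)) : c / 2 ≤ ‖u - v‖ := by
  rw [mem_closedBall, dist_eq_norm] at hv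
  have : ‖u - e‖ ≤ ‖u - v‖ + ‖v - e‖ := norm_sub_le_norm_sub_add_norm_sub _ _ _
  linarith [min_le_right r c]

lemma outgoing_sub_ne_zero (H : StepHyp c r C τ e B) {u v : Vec d} (hu : c ≤ ‖u - e‖)
    (hv : v ∈ closedBall e (min r c / 2)) : u - v ≠ 0 := by
  rw [← norm_pos_iff]
  linarith [StepHyp.le_norm_sub hu hv, H.c_pos]

lemma norm_offset_le (H : StepHyp c r C τ e B) (u : Vec d) {v : Vec d}
    (hv : v ∈ closedBall e (min r c / 2)) : ‖dir (u - v) - B v‖ ≤ 1 + C :=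
  (norm_sub_le _ _).trans (add_le_add (norm_dir_le _) (H.norm_le v (H.mem_ball hv)))

lemma four_div_pos (H : StepHyp c r C τ e B) : 0 < 4 / c := div_pos (by norm_num) H.c_pos

lemma le_norm_arg (H : StepHyp c r C τ e B) (u : Vec d) {v : Vec d}
    (hv : v ∈ closedBall e (min r c / 2)) : 1 / 2 ≤ ‖e + τ • (dir (u - v) - B v)‖ := by
  have h1 := norm_sub_le (e + τ • (dir (u - v) - B v)) (τ • (dir (u - v) - B v))
  rw [add_sub_cancel_right, H.norm_e, norm_smul, Real.norm_of_nonneg H.τ_pos.le] at h1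
  have h2 := mul_le_mul_of_nonneg_left (H.norm_offset_le u hv) H.τ_pos.le
  have h3 := H.τ_small
  nlinarith [mul_pos H.τ_pos H.four_div_pos]

lemma arg_ne_zero (H : StepHyp c r C τ e B) (u : Vec d) {v : Vec d}
    (hv : v ∈ closedBall e (min r c / 2)) : e + τ • (dir (u - v) - B v) ≠ 0 := by
  rw [← norm_pos_iff]
  linarith [H.le_norm_arg u hv]

lemma norm_stepMap_sub_le (H : StepHyp c r C τ e B) (u : Vec d) {v : Vec d}
    (hv : v ∈ closedBall e (min r c / 2)) : ‖stepMap τ e B u v - e‖ ≤ 2 * (τ * (1 + C)) := by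
  have h1 := norm_dir_sub_le (ne_zero_of_norm_eq_one H.norm_e) (e + τ • (dir (u - v) - B v))
  rw [dir_of_norm_eq_one H.norm_e, H.norm_e, sub_add_cancel_left, norm_neg, norm_smul,
    Real.norm_of_nonneg H.τ_pos.le, norm_sub_rev] at h1
  have h2 := mul_le_mul_of_nonneg_left (H.norm_offset_le u hv) H.τ_pos.le
  rw [stepMap]
  linarith

lemma two_mul_lt (H : StepHyp c r C τ e B) : 2 * (τ * (1 + C)) < min r c / 2 := by
  have := mul_pos H.τ_pos H.four_div_pos
  linarith [H.τ_small']

lemma stepMap_mem (H : StepHyp c r C τ e B) (u : Vec d) {v : Vec d}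
    (hv : v ∈ closedBall e (min r c / 2)) :
    stepMap τ e B u v ∈ closedBall e (min r c / 2) := by
  rw [mem_closedBall, dist_eq_norm]
  exact (H.norm_stepMap_sub_le u hv).trans H.two_mul_lt.le

lemma norm_B_sub_le (H : StepHyp c r C τ e B) {v v' : Vec d}
    (hv : v ∈ closedBall e (min r c / 2)) (hv' : v' ∈ closedBall e (min r c / 2)) :
    ‖B v - B v'‖ ≤ C * ‖v - v'‖ :=
  (convex_ball e r).norm_image_sub_le_of_norm_fderiv_le
    (fun _ hx => (H.contDiffOn.contDiffAt (isOpen_ball.mem_nhds hx)).differentiableAt one_ne_zero)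
    H.norm_fderiv_le (H.mem_ball hv') (H.mem_ball hv)

lemma norm_dir_sub_sub_le (H : StepHyp c r C τ e B) {u u' v v' : Vec d} (hu : c ≤ ‖u - e‖)
    (hv : v ∈ closedBall e (min r c / 2)) :
    ‖dir (u - v) - dir (u' - v')‖ ≤ 4 / c * (‖u - u'‖ + ‖v - v'‖) := by
  have h1 : ‖u - v‖⁻¹ ≤ (c / 2)⁻¹ := inv_anti₀ (half_pos H.c_pos) (StepHyp.le_norm_sub hu hv)
  have h2 : ‖(u - v) - (u' - v')‖ ≤ ‖u - u'‖ + ‖v - v'‖ := by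
    rw [sub_sub_sub_comm]; exact norm_sub_le _ _
  calc _ ≤ 2 * ‖u - v‖⁻¹ * ‖(u - v) - (u' - v')‖ := norm_dir_sub_le (H.outgoing_sub_ne_zero hu hv) _
    _ ≤ 2 * (c / 2)⁻¹ * (‖u - u'‖ + ‖v - v'‖) := by have := H.c_pos; gcongr
    _ = _ := by rw [inv_div]; ring

lemma norm_stepMap_sub_stepMap_le (H : StepHyp c r C τ e B) {u u' v v' : Vec d}
    (hu : c ≤ ‖u - e‖) (hv : v ∈ closedBall e (min r c / 2))
    (hv' : v' ∈ closedBall e (min r c / 2)) :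
    ‖stepMap τ e B u v - stepMap τ e B u' v'‖ ≤
      4 * (τ * (1 + C + 4 / c)) * (‖u - u'‖ + ‖v - v'‖) := by
  have h1 : ‖e + τ • (dir (u - v) - B v)‖⁻¹ ≤ (1 / 2)⁻¹ :=
    inv_anti₀ (by norm_num) (H.le_norm_arg u hv)
  have h2 : ‖(e + τ • (dir (u - v) - B v)) - (e + τ • (dir (u' - v') - B v'))‖ ≤
      τ * ((1 + C + 4 / c) * (‖u - u'‖ + ‖v - v'‖)) := by
    rw [add_sub_add_left_eq_sub, ← smul_sub, norm_smul, Real.norm_of_nonneg H.τ_pos.le,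
      sub_sub_sub_comm]
    refine mul_le_mul_of_nonneg_left ((norm_sub_le _ _).trans ?_) H.τ_pos.le
    have h3 := H.norm_dir_sub_sub_le (u' := u') (v' := v') hu hv
    have h4 := H.norm_B_sub_le hv hv'
    have h5 := H.C_nonneg
    nlinarith [norm_nonneg (u - u'), norm_nonneg (v - v')]
  calc _ ≤ 2 * ‖e + τ • (dir (u - v) - B v)‖⁻¹ *
        ‖(e + τ • (dir (u - v) - B v)) - (e + τ • (dir (u' - v') - B v'))‖ :=
        norm_dir_sub_le (H.arg_ne_zero u hv) _
    _ ≤ 2 * (1 / 2)⁻¹ * (τ * ((1 + C + 4 / c) * (‖u - u'‖ + ‖v - v'‖))) := by gcongr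
    _ = _ := by ring

lemma center_mem (H : StepHyp c r C τ e B) : e ∈ closedBall e (min r c / 2) :=
  mem_closedBall_self (by linarith [lt_min H.r_pos H.c_pos])

lemma exists_fixed (H : StepHyp c r C τ e B) {u : Vec d} (hu : c ≤ ‖u - e‖) :
    ∃ v ∈ closedBall e (min r c / 2), stepMap τ e B u v = v := by
  have hm : MapsTo (stepMap τ e B u) (closedBall e (min r c / 2)) (closedBall e (min r c / 2)) :=
    fun v hv => H.stepMap_mem u hv
  have hc : ContractingWith (1 / 2) (hm.restrict _ _ _) := by
    refine ⟨NNReal.half_lt_self one_ne_zero, LipschitzWith.of_dist_le_mul fun v v' => ?_⟩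
    rw [Subtype.dist_eq, Subtype.dist_eq, dist_eq_norm, dist_eq_norm]
    have h := H.norm_stepMap_sub_stepMap_le (u' := u) hu v.2 v'.2
    rw [sub_self, norm_zero, zero_add] at h
    have h' := H.τ_small
    refine h.trans (mul_le_mul_of_nonneg_right ?_ (norm_nonneg _))
    push_cast
    linarith
  obtain ⟨v, hv, h, -⟩ := hc.exists_fixedPoint' isClosed_closedBall.isComplete hm H.center_mem
    (edist_ne_top _ _)
  exact ⟨v, hv, h⟩

lemma norm_fixed_sub_le (H : StepHyp c r C τ e B) {u u' v v' : Vec d} (hu : c ≤ ‖u - e‖)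
    (hv : v ∈ closedBall e (min r c / 2)) (hv' : v' ∈ closedBall e (min r c / 2))
    (h : stepMap τ e B u v = v) (h' : stepMap τ e B u' v' = v') :
    ‖v - v'‖ ≤ 8 * (τ * (1 + C + 4 / c)) * ‖u - u'‖ := by
  have h1 := H.norm_stepMap_sub_stepMap_le (u' := u') hu hv hv'
  rw [h, h'] at h1
  nlinarith [mul_nonneg (sub_nonneg.2 H.τ_small) (norm_nonneg (v - v'))]

lemma stepInv_spec (H : StepHyp c r C τ e B) {x : Vec d} (hx : c ≤ ‖dir x - e‖) :
    stepInv τ e B (min r c / 2) x ∈ closedBall e (min r c / 2) ∧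
      stepMap τ e B (dir x) (stepInv τ e B (min r c / 2) x) = stepInv τ e B (min r c / 2) x := by
  have h := H.exists_fixed hx
  rw [stepInv, dif_pos h]
  exact h.choose_spec

lemma eq_stepInv (H : StepHyp c r C τ e B) {x v : Vec d} (hx : c ≤ ‖dir x - e‖)
    (hv : v ∈ closedBall e (min r c / 2)) (h : stepMap τ e B (dir x) v = v) :
    v = stepInv τ e B (min r c / 2) x := by
  have h1 := H.norm_fixed_sub_le (u' := dir x) hx hv (H.stepInv_spec hx).1 h (H.stepInv_spec hx).2
  rw [sub_self, norm_zero, mul_zero] at h1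
  exact sub_eq_zero.1 (norm_le_zero_iff.1 h1)

lemma norm_stepInv (H : StepHyp c r C τ e B) {x : Vec d} (hx : c ≤ ‖dir x - e‖) :
    ‖stepInv τ e B (min r c / 2) x‖ = 1 := by
  obtain ⟨h1, h2⟩ := H.stepInv_spec hx
  rw [← h2, stepMap, norm_dir (H.arg_ne_zero _ h1)]

lemma norm_stepInv_sub_le (H : StepHyp c r C τ e B) {x : Vec d} (hx : c ≤ ‖dir x - e‖) :
    ‖stepInv τ e B (min r c / 2) x - e‖ ≤ 2 * (τ * (1 + C)) := by
  obtain ⟨h1, h2⟩ := H.stepInv_spec hx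
  rw [← h2]
  exact H.norm_stepMap_sub_le _ h1

lemma stepInv_mem_ball (H : StepHyp c r C τ e B) {x : Vec d} (hx : c ≤ ‖dir x - e‖) :
    stepInv τ e B (min r c / 2) x ∈ ball e (min r c / 2) := by
  rw [Metric.mem_ball, dist_eq_norm]
  exact (H.norm_stepInv_sub_le hx).trans_lt H.two_mul_lt

lemma continuousAt_stepInv (H : StepHyp c r C τ e B) {x : Vec d} (hx0 : x ≠ 0)
    (hx : ∀ᶠ y in 𝓝 x, c ≤ ‖dir y - e‖) :
    ContinuousAt (stepInv τ e B (min r c / 2)) x := by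
  have hd : Tendsto (fun y => 8 * (τ * (1 + C + 4 / c)) * ‖dir y - dir x‖) (𝓝 x) (𝓝 0) := by
    have h1 : Tendsto (fun y => dir y - dir x) (𝓝 x) (𝓝 0) := by
      rw [← sub_self (dir x)]
      exact ((hasFDerivAt_dir hx0).continuousAt.tendsto).sub_const _
    simpa using h1.norm.const_mul (8 * (τ * (1 + C + 4 / c)))
  rw [ContinuousAt, tendsto_iff_norm_sub_tendsto_zero]
  refine squeeze_zero' (Eventually.of_forall fun _ => norm_nonneg _) ?_ hd
  filter_upwards [hx] with y hy
  have hx' := hx.self_of_nhds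
  exact H.norm_fixed_sub_le hy (H.stepInv_spec hy).1 (H.stepInv_spec hx').1 (H.stepInv_spec hy).2
    (H.stepInv_spec hx').2

lemma contDiffAt_stepMap (H : StepHyp c r C τ e B) {x v : Vec d} (hx0 : x ≠ 0)
    (hx : c ≤ ‖dir x - e‖) (hv : v ∈ closedBall e (min r c / 2)) :
    ContDiffAt ℝ 1 (fun p : Vec d × Vec d => stepMap τ e B (dir p.1) p.2) (x, v) := by
  have h1 : ContDiffAt ℝ 1 (fun p : Vec d × Vec d => dir p.1 - p.2) (x, v) :=
    ((contDiffAt_dir hx0).comp (x, v) contDiffAt_fst).sub contDiffAt_snd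
  have h2 : ContDiffAt ℝ 1 (fun p : Vec d × Vec d => dir (dir p.1 - p.2)) (x, v) :=
    ContDiffAt.comp (g := dir) (x, v) (contDiffAt_dir (H.outgoing_sub_ne_zero hx hv)) h1
  have h3 : ContDiffAt ℝ 1 (fun p : Vec d × Vec d => B p.2) (x, v) :=
    ContDiffAt.comp (g := B) (x, v)
      (H.contDiffOn.contDiffAt (isOpen_ball.mem_nhds (H.mem_ball hv))) contDiffAt_snd
  exact ContDiffAt.comp (g := dir) (x, v) (contDiffAt_dir (H.arg_ne_zero _ hv))
    (contDiffAt_const.add ((h2.sub h3).const_smul τ))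

lemma contDiffAt_stepInv (H : StepHyp c r C τ e B) {x : Vec d} (hx0 : x ≠ 0)
    (hx : ∀ᶠ y in 𝓝 x, c ≤ ‖dir y - e‖) :
    ContDiffAt ℝ 1 (stepInv τ e B (min r c / 2)) x := by
  have hx' := hx.self_of_nhds
  set V := stepInv τ e B (min r c / 2) with hV
  obtain ⟨hm, hfix⟩ := H.stepInv_spec hx'
  rw [← hV] at hm hfix
  set f : Vec d × Vec d → Vec d := fun p => p.2 - stepMap τ e B (dir p.1) p.2 with hf
  have hs := H.contDiffAt_stepMap hx0 hx' hm
  have cdf : ContDiffAt ℝ 1 f (x, V x) := contDiffAt_snd.sub hs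
  have hfx : f (x, V x) = 0 := by rw [hf]; exact sub_eq_zero.2 hfix.symm
  have hinv : (fderiv ℝ f (x, V x) ∘L .inr ℝ (Vec d) (Vec d)).IsInvertible := by
    set D := fderiv ℝ (fun p : Vec d × Vec d => stepMap τ e B (dir p.1) p.2) (x, V x) ∘L
      .inr ℝ (Vec d) (Vec d) with hD
    have h1 : fderiv ℝ f (x, V x) ∘L .inr ℝ (Vec d) (Vec d) = 1 - D := by
      have h2 := (hasFDerivAt_snd (𝕜 := ℝ) (p := (x, V x))).sub
        (hs.differentiableAt one_ne_zero).hasFDerivAt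
      rw [show fderiv ℝ f (x, V x) = _ from h2.fderiv, hD]
      ext h
      simp
    have h2 : HasFDerivAt (fun v => stepMap τ e B (dir x) v) D (V x) := by
      have h3 : HasFDerivAt (fun v : Vec d => (x, v)) (.inr ℝ (Vec d) (Vec d)) (V x) :=
        hasFDerivAt_prodMk_right x (V x)
      exact ((hs.differentiableAt one_ne_zero).hasFDerivAt).comp (V x) h3
    have h3 : ‖D‖ ≤ 1 / 2 := by
      refine h2.le_of_lip' (by norm_num) ?_
      filter_upwards [isOpen_ball.mem_nhds (H.stepInv_mem_ball hx')] with v hv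
      have h := H.norm_stepMap_sub_stepMap_le (u' := dir x) hx' (ball_subset_closedBall hv) hm
      rw [sub_self, norm_zero, zero_add] at h
      exact h.trans (mul_le_mul_of_nonneg_right (by linarith [H.τ_small]) (norm_nonneg _))
    have h4 : IsUnit (1 - D) := isUnit_one_sub_of_norm_lt_one (by linarith)
    rw [h1]
    obtain ⟨U, hU⟩ := h4
    exact ⟨ContinuousLinearEquiv.unitsEquiv ℝ (Vec d) U, by rw [← hU]; rfl⟩
  have h1 := cdf.eventually_apply_eq_iff_implicitFunction one_ne_zero hinv
  have h2 : Tendsto (fun y => (y, V y)) (𝓝 x) (𝓝 (x, V x)) :=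
    (continuousAt_id.prodMk (H.continuousAt_stepInv hx0 hx)).tendsto
  refine (cdf.contDiffAt_implicitFunction one_ne_zero hinv).congr_of_eventuallyEq ?_
  filter_upwards [h2.eventually h1, hx] with y hy hy'
  refine (hy.1 ?_).symm
  rw [hfx]
  exact sub_eq_zero.2 (H.stepInv_spec hy').2.symm

lemma norm_fderiv_stepInv_le (H : StepHyp c r C τ e B) {x : Vec d} (hx1 : ‖x‖ = 1)
    (hx : ∀ᶠ y in 𝓝 x, c ≤ ‖dir y - e‖) :
    ‖fderiv ℝ (stepInv τ e B (min r c / 2)) x‖ ≤ 16 * (τ * (1 + C + 4 / c)) := by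
  have hx0 := ne_zero_of_norm_eq_one hx1
  have hx' := hx.self_of_nhds
  have h0 : 0 ≤ τ * (1 + C + 4 / c) :=
    mul_nonneg H.τ_pos.le (by linarith [H.C_nonneg, H.four_div_pos])
  refine ((H.contDiffAt_stepInv hx0 hx).differentiableAt one_ne_zero).hasFDerivAt.le_of_lip'
    (by positivity) ?_
  filter_upwards [hx] with y hy
  have h1 := H.norm_fixed_sub_le hy (H.stepInv_spec hy).1 (H.stepInv_spec hx').1
    (H.stepInv_spec hy).2 (H.stepInv_spec hx').2
  have h2 := norm_dir_sub_le hx0 y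
  rw [hx1, norm_sub_rev, norm_sub_rev x] at h2
  refine h1.trans ?_
  have := mul_le_mul_of_nonneg_left h2 (mul_nonneg (by norm_num : (0:ℝ) ≤ 8) h0)
  linarith

end StepHyp

/-! ### Distortion estimates for a single scattering step -/

/-- A linear map normalizing the derivative of a scattering step. -/
def stepRescale {d : ℕ} (τ : ℝ) (e b : Vec d) : Vec d →L[ℝ] Vec d :=
  (innerSL ℝ e).smulRight (e + ddir e b) + τ⁻¹ • ddir e

lemma stepRescale_apply {d : ℕ} (τ : ℝ) (e b z : Vec d) :
    stepRescale τ e b z = ⟪e, z⟫ • (e + ddir e b) + τ⁻¹ • ddir e z := by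
  simp [stepRescale]

lemma det_ne_zero_of_forall_eq_zero {d : ℕ} (R : Vec d →L[ℝ] Vec d) (h : ∀ z, R z = 0 → z = 0) :
    R.det ≠ 0 := by
  rw [ContinuousLinearMap.det]
  intro h0
  have h1 := LinearMap.bot_lt_ker_of_det_eq_zero h0
  refine absurd (LinearMap.ker_eq_bot'.2 fun z hz => h z hz) h1.ne'

lemma det_stepRescale_ne_zero {d : ℕ} {τ : ℝ} (hτ : τ ≠ 0) {e : Vec d} (he : ‖e‖ = 1) (b : Vec d) :
    (stepRescale τ e b).det ≠ 0 := by
  refine det_ne_zero_of_forall_eq_zero _ fun z hz => ?_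
  rw [stepRescale_apply] at hz
  have h1 : ⟪e, z⟫ = 0 := by
    have h2 := congrArg (fun y => ⟪e, y⟫) hz
    simpa [inner_add_right, inner_smul_right, inner_ddir he, he] using h2
  rw [h1, zero_smul, zero_add, smul_eq_zero] at hz
  have h2 := hz.resolve_left (inv_ne_zero hτ)
  rwa [ddir_apply_of_norm_eq_one he, h1, zero_smul, sub_zero] at h2

namespace StepHyp

variable {d : ℕ} {c r C τ : ℝ} {e u : Vec d} {B : Vec d → Vec d}

lemma hasFDerivAt_stepInv (H : StepHyp c r C τ e B) (hu1 : ‖u‖ = 1)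
    (hu : ∀ᶠ y in 𝓝 u, c ≤ ‖dir y - e‖) :
    HasFDerivAt (stepInv τ e B (min r c / 2)) (fderiv ℝ (stepInv τ e B (min r c / 2)) u) u :=
  ((H.contDiffAt_stepInv (ne_zero_of_norm_eq_one hu1) hu).differentiableAt one_ne_zero).hasFDerivAt

lemma hasFDerivAt_dir_sub_stepInv (H : StepHyp c r C τ e B) (hu1 : ‖u‖ = 1)
    (hu : ∀ᶠ y in 𝓝 u, c ≤ ‖dir y - e‖) :
    HasFDerivAt (fun x => dir (dir x - stepInv τ e B (min r c / 2) x))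
      (ddir (u - stepInv τ e B (min r c / 2) u) ∘L
        (ddir u - fderiv ℝ (stepInv τ e B (min r c / 2)) u)) u := by
  have h1 := (hasFDerivAt_dir (ne_zero_of_norm_eq_one hu1)).sub (H.hasFDerivAt_stepInv hu1 hu)
  have h2 : dir u - stepInv τ e B (min r c / 2) u ≠ 0 :=
    H.outgoing_sub_ne_zero hu.self_of_nhds (H.stepInv_spec hu.self_of_nhds).1
  have h3 := (hasFDerivAt_dir h2).comp u h1
  rwa [dir_of_norm_eq_one hu1] at h3

lemma fderiv_stepInv (H : StepHyp c r C τ e B) (hu1 : ‖u‖ = 1)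
    (hu : ∀ᶠ y in 𝓝 u, c ≤ ‖dir y - e‖) :
    fderiv ℝ (stepInv τ e B (min r c / 2)) u =
      ddir (e + τ • (dir (u - stepInv τ e B (min r c / 2) u) - B (stepInv τ e B (min r c / 2) u)))
        ∘L (τ • (ddir (u - stepInv τ e B (min r c / 2) u) ∘L
          (ddir u - fderiv ℝ (stepInv τ e B (min r c / 2)) u) -
          fderiv ℝ B (stepInv τ e B (min r c / 2) u) ∘L
            fderiv ℝ (stepInv τ e B (min r c / 2)) u)) := by
  set V := stepInv τ e B (min r c / 2) with hV
  obtain ⟨hm, -⟩ := H.stepInv_spec hu.self_of_nhds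
  rw [← hV] at hm
  have h1 : HasFDerivAt B (fderiv ℝ B (V u)) (V u) :=
    ((H.contDiffOn.contDiffAt (isOpen_ball.mem_nhds (H.mem_ball hm))).differentiableAt
      one_ne_zero).hasFDerivAt
  have h2 := (((H.hasFDerivAt_dir_sub_stepInv hu1 hu).sub
    (h1.comp u (H.hasFDerivAt_stepInv hu1 hu))).const_smul τ).const_add e
  have h3 := H.arg_ne_zero (dir u) hm
  have h4 := (hasFDerivAt_dir (x := e + τ • (dir (dir u - V u) - B (V u))) h3).comp u h2
  have h5 : V =ᶠ[𝓝 u] dir ∘ fun x => e + τ • (dir (dir x - V x) - B (V x)) := by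
    filter_upwards [hu] with y hy
    exact (H.stepInv_spec hy).2.symm
  have h6 := (h4.congr_of_eventuallyEq h5).fderiv
  rw [dir_of_norm_eq_one hu1] at h6
  exact h6

lemma hasFDerivAt_homog_stepInv (H : StepHyp c r C τ e B) (hu1 : ‖u‖ = 1)
    (hu : ∀ᶠ y in 𝓝 u, c ≤ ‖dir y - e‖) :
    HasFDerivAt (homog (stepInv τ e B (min r c / 2)))
      ((innerSL ℝ u).smulRight (stepInv τ e B (min r c / 2) u) +
        fderiv ℝ (stepInv τ e B (min r c / 2)) u) u := by
  refine hasFDerivAt_homog hu1 ?_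
  simp only [stepInv_dir]
  exact H.hasFDerivAt_stepInv hu1 hu

lemma stepRescale_comp_fderiv (H : StepHyp c r C τ e B) (hu1 : ‖u‖ = 1)
    (hu : ∀ᶠ y in 𝓝 u, c ≤ ‖dir y - e‖) (b : Vec d) :
    stepRescale τ e b ∘L fderiv ℝ (homog (stepInv τ e B (min r c / 2))) u =
      stepDeriv τ e u b
        (dir (u - stepInv τ e B (min r c / 2) u) - B (stepInv τ e B (min r c / 2) u))
        (ddir (u - stepInv τ e B (min r c / 2) u) ∘L
          (ddir u - fderiv ℝ (stepInv τ e B (min r c / 2)) u) -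
          fderiv ℝ B (stepInv τ e B (min r c / 2) u) ∘L
            fderiv ℝ (stepInv τ e B (min r c / 2)) u) := by
  rw [(H.hasFDerivAt_homog_stepInv hu1 hu).fderiv]
  have h1 := H.fderiv_stepInv hu1 hu
  have h2 := (H.stepInv_spec hu.self_of_nhds).2
  rw [dir_of_norm_eq_one hu1] at h2
  set V := stepInv τ e B (min r c / 2) with hV
  set A := ddir (u - V u) ∘L (ddir u - fderiv ℝ V u) - fderiv ℝ B (V u) ∘L fderiv ℝ V u with hA
  set a := dir (u - V u) - B (V u) with ha
  have hτ := H.τ_pos.ne'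
  have he := H.norm_e
  have h3 : V u = ‖e + τ • a‖⁻¹ • (e + τ • a) := by
    rw [← h2, stepMap, dir]
  refine ContinuousLinearMap.ext fun h => ?_
  have h4 : stepRescale τ e b (V u) =
      ‖e + τ • a‖⁻¹ • ((1 + τ * ⟪e, a⟫) • (e + ddir e b) + ddir e a) := by
    rw [h3, map_smul, stepRescale_apply, inner_add_right, inner_smul_right,
      inner_self_of_norm_eq_one he, map_add, map_smul, ddir_self he, zero_add, smul_smul,
      inv_mul_cancel₀ hτ, one_smul]
  have h5 : stepRescale τ e b (fderiv ℝ V u h) = ddir e (ddir (e + τ • a) (A h)) +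
      (τ * ⟪e, ddir (e + τ • a) (A h)⟫) • (e + ddir e b) := by
    rw [h1, ContinuousLinearMap.comp_apply, smul_apply, map_smul, map_smul,
      stepRescale_apply, smul_add, smul_smul, smul_smul, mul_inv_cancel₀ hτ, one_smul, add_comm]
  rw [ContinuousLinearMap.comp_apply, add_apply, map_add,
    ContinuousLinearMap.smulRight_apply, map_smul, h4, h5]
  simp [stepDeriv, smul_smul]

end StepHyp

lemma exists_step_estimates (d : ℕ) {c r C ε : ℝ} (hc : 0 < c) (hr : 0 < r) (hC : 0 ≤ C)
    (hε : 0 < ε) :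
    ∃ τ₀ > 0, ∀ τ ∈ Ioo 0 τ₀, ∀ (e : Vec d) (B : Vec d → Vec d), ‖e‖ = 1 →
      ContDiffOn ℝ 1 B (ball e r) → (∀ v ∈ ball e r, ‖B v‖ ≤ C) →
      (∀ v ∈ ball e r, ‖fderiv ℝ B v‖ ≤ C) →
      StepHyp c r C τ e B ∧ ∃ κ > 0, ∀ u : Vec d, ‖u‖ = 1 → (∀ᶠ y in 𝓝 u, c ≤ ‖dir y - e‖) →
        ‖dir (u - stepInv τ e B (min r c / 2) u) - dir (u - e)‖ < ε ∧
        ‖fderiv ℝ (fun x => dir (dir x - stepInv τ e B (min r c / 2) x)) u -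
          ddir (u - e) ∘L ddir u‖ < ε ∧
        |(|(fderiv ℝ (homog (stepInv τ e B (min r c / 2))) u).det|) - κ * coneJac e u| ≤
          ε * (κ * coneJac e u) := by
  obtain ⟨j, hj, hj'⟩ := exists_coneJac_lower_bound d hc
  obtain ⟨δ, hδ, hdet⟩ := exists_det_stepDeriv_near d hc C (mul_pos hε hj)
  set σ := min ε δ with hσ
  have hσ0 : 0 < σ := lt_min hε hδ
  obtain ⟨q, hq, hosc⟩ := exists_ddir_oscillation d (half_pos hc) (show 0 < σ / 4 by positivity)
  set M := 1 + C + 4 / c with hM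
  have h4c : 0 < 4 / c := by positivity
  have hM0 : 1 ≤ M := by linarith
  have hmin : 0 < min r c := lt_min hr hc
  set τ₀ := min (min (1 / (8 * M)) (min r c / (4 * M)))
    (min (min (q / (2 * M)) (σ / (32 * M ^ 2 * 2))) δ) with hτ₀
  refine ⟨τ₀, by positivity, fun τ hτ e B he hB hBC hDB => ?_⟩
  have hτ0 := hτ.1
  have t1 : τ * (8 * M) ≤ 1 :=
    (le_div_iff₀ (by positivity)).1
      (hτ.2.le.trans ((min_le_left _ _).trans (min_le_left _ _)))
  have t2 : τ * (4 * M) ≤ min r c :=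
    (le_div_iff₀ (by positivity)).1
      (hτ.2.le.trans ((min_le_left _ _).trans (min_le_right _ _)))
  have t3 : τ * (2 * M) < q :=
    (lt_div_iff₀ (by positivity)).1 (hτ.2.trans_le
      ((min_le_right _ _).trans ((min_le_left _ _).trans (min_le_left _ _))))
  have t4 : τ * (32 * M ^ 2 * 2) < σ :=
    (lt_div_iff₀ (by positivity)).1 (hτ.2.trans_le
      ((min_le_right _ _).trans ((min_le_left _ _).trans (min_le_right _ _))))
  have t5 : τ < δ := hτ.2.trans_le ((min_le_right _ _).trans (min_le_right _ _))
  have H : StepHyp c r C τ e B := ⟨hc, hr, he, hτ0, hC, hB, hBC, hDB, by linarith, by linarith⟩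
  have hκ := det_stepRescale_ne_zero hτ0.ne' he (B e)
  refine ⟨H, |(stepRescale τ e (B e)).det|⁻¹, by positivity, fun u hu1 hu => ?_⟩
  have huc := hu.self_of_nhds
  have hVm := (H.stepInv_spec huc).1
  have hVe := H.norm_stepInv_sub_le huc
  have hV1 := H.norm_stepInv huc
  have hDV := H.norm_fderiv_stepInv_le hu1 hu
  have hdF := (H.hasFDerivAt_dir_sub_stepInv hu1 hu).fderiv
  have hcomp := H.stepRescale_comp_fderiv hu1 hu (B e)
  rw [dir_of_norm_eq_one hu1] at huc
  set V := stepInv τ e B (min r c / 2) with hV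
  have hVe' : ‖V u - e‖ ≤ τ * (2 * M) := by nlinarith
  have hVq : ‖V u - e‖ < q := hVe'.trans_lt t3
  have hlow := StepHyp.le_norm_sub huc hVm
  have hlow' := StepHyp.le_norm_sub huc H.center_mem
  have hup : ‖u - V u‖ ≤ 3 := (norm_sub_le _ _).trans (by rw [hu1, hV1]; norm_num)
  have hup' : ‖u - e‖ ≤ 3 := (norm_sub_le _ _).trans (by rw [hu1, he]; norm_num)
  have b1 : ‖dir (u - V u) - dir (u - e)‖ ≤ τ * (2 * M ^ 2) := by
    have h := H.norm_dir_sub_sub_le (u' := u) (v' := e) huc hVm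
    rw [sub_self, norm_zero, zero_add] at h
    have h2 : 4 / c * ‖V u - e‖ ≤ M * (τ * (2 * M)) :=
      mul_le_mul (by linarith) hVe' (norm_nonneg _) (by linarith)
    linarith
  have b2 : ‖B (V u) - B e‖ ≤ τ * (2 * M ^ 2) := by
    have h := H.norm_B_sub_le hVm H.center_mem
    have h2 : C * ‖V u - e‖ ≤ M * (τ * (2 * M)) :=
      mul_le_mul (by linarith) hVe' (norm_nonneg _) (by linarith)
    linarith
  have hdu : ‖ddir u‖ ≤ 2 := by have := norm_ddir_le u; rwa [hu1, inv_one, mul_one] at this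
  have hduv : ‖ddir (u - V u)‖ ≤ M := by
    refine (norm_ddir_le _).trans ?_
    have h : ‖u - V u‖⁻¹ ≤ (c / 2)⁻¹ := inv_anti₀ (half_pos hc) hlow
    rw [inv_div] at h
    have : 2 * (2 / c) = 4 / c := by ring
    linarith
  have b3 : ‖ddir (u - V u) ∘L fderiv ℝ V u‖ ≤ τ * (16 * M ^ 2) := by
    refine (ContinuousLinearMap.opNorm_comp_le _ _).trans ?_
    have h := mul_le_mul hduv hDV (norm_nonneg _) (by linarith)
    linarith
  have b4 : ‖fderiv ℝ B (V u) ∘L fderiv ℝ V u‖ ≤ τ * (16 * M ^ 2) := by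
    refine (ContinuousLinearMap.opNorm_comp_le _ _).trans ?_
    have h := mul_le_mul ((hDB _ (H.mem_ball hVm)).trans (by linarith : C ≤ M)) hDV
      (norm_nonneg _) (by linarith)
    linarith
  have b5 : ‖(ddir (u - V u) - ddir (u - e)) ∘L ddir u‖ ≤ σ / 4 * 2 := by
    refine (ContinuousLinearMap.opNorm_comp_le _ _).trans ?_
    have h := hosc (u - V u) (u - e) hlow hup hlow' hup'
      (by rw [sub_sub_sub_cancel_left, norm_sub_rev]; exact hVq)
    exact mul_le_mul h.le hdu (norm_nonneg _) (by positivity)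
  have t6 : τ * M ^ 2 * 64 < σ := by linarith
  have b6 : ‖ddir (u - V u) ∘L (ddir u - fderiv ℝ V u) - ddir (u - e) ∘L ddir u‖ ≤
      σ / 4 * 2 + τ * (16 * M ^ 2) := by
    have h : ddir (u - V u) ∘L (ddir u - fderiv ℝ V u) - ddir (u - e) ∘L ddir u =
        (ddir (u - V u) - ddir (u - e)) ∘L ddir u - ddir (u - V u) ∘L fderiv ℝ V u := by
      rw [ContinuousLinearMap.comp_sub, ContinuousLinearMap.sub_comp]
      abel
    rw [h]
    exact (norm_sub_le _ _).trans (add_le_add b5 b3)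
  have hτM : 0 < τ * M ^ 2 := by positivity
  have hσε : σ ≤ ε := min_le_left _ _
  have hσδ : σ ≤ δ := min_le_right _ _
  refine ⟨by linarith, ?_, ?_⟩
  · rw [hdF]
    linarith
  · have h := hdet τ e u (B e) _ _ hτ0.le t5 he hu1 huc (hBC e (mem_ball_self hr))
      (show ‖(dir (u - V u) - B (V u)) - (dir (u - e) - B e)‖ < δ by
        rw [sub_sub_sub_comm]
        have := norm_sub_le (dir (u - V u) - dir (u - e)) (B (V u) - B e)
        linarith)
      (show ‖(ddir (u - V u) ∘L (ddir u - fderiv ℝ V u) - fderiv ℝ B (V u) ∘L fderiv ℝ V u) -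
          ddir (u - e) ∘L ddir u‖ < δ by
        rw [sub_right_comm]
        have := norm_sub_le (ddir (u - V u) ∘L (ddir u - fderiv ℝ V u) - ddir (u - e) ∘L ddir u)
          (fderiv ℝ B (V u) ∘L fderiv ℝ V u)
        linarith)
    rw [← hcomp] at h
    have hmul : (stepRescale τ e (B e) ∘L fderiv ℝ (homog V) u).det =
        (stepRescale τ e (B e)).det * (fderiv ℝ (homog V) u).det := by
      simp only [ContinuousLinearMap.det, ContinuousLinearMap.toLinearMap_comp,
        LinearMap.det_comp]
    rw [hmul, abs_mul] at h
    have hJ := hj' e u he hu1 huc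
    set k := |(stepRescale τ e (B e)).det| with hk
    have hk0 : 0 < k := abs_pos.2 hκ
    have h' : |k⁻¹ * (k * |(fderiv ℝ (homog V) u).det| - coneJac e u)| ≤
        k⁻¹ * (ε * coneJac e u) := by
      rw [abs_mul, abs_of_pos (inv_pos.2 hk0)]
      refine mul_le_mul_of_nonneg_left (h.le.trans ?_) (inv_pos.2 hk0).le
      exact mul_le_mul_of_nonneg_left hJ hε.le
    rw [mul_sub, inv_mul_cancel_left₀ hk0.ne'] at h'
    calc _ ≤ _ := h'
      _ = _ := by ring

/-! ### A single collision -/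

section Hit

variable {d : ℕ} {ρ t : ℝ} {c p v w u : Vec d}

lemma norm_sq_add_smul_sub (hv : ‖v‖ = 1) (hw : ‖w‖ = 1) (h : p + t • v = c + ρ • w) (s : ℝ) :
    ‖p + s • v - c‖ ^ 2 = ρ ^ 2 + (s - t) * (s - t + 2 * ρ * ⟪v, w⟫) := by
  have h1 : p + s • v - c = (s - t) • v + ρ • w := by
    rw [sub_smul, eq_sub_of_add_eq h]; abel
  rw [h1, norm_add_sq_real, norm_smul, norm_smul, hv, hw, inner_smul_left, inner_smul_right,
    Real.norm_eq_abs, Real.norm_eq_abs, mul_one, mul_one, sq_abs, sq_abs]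
  simp
  ring

lemma hitTimes_eq (hρ : 0 < ρ) (hv : ‖v‖ = 1) (ht : 0 < t) (hw : ‖w‖ = 1) (hvw : ⟪v, w⟫ < 0)
    (h : p + t • v = c + ρ • w) :
    {s | 0 < s ∧ p + s • v ∈ ball c ρ} = Ioo t (t - 2 * ρ * ⟪v, w⟫) := by
  ext s
  have hneg : 2 * ρ * ⟪v, w⟫ < 0 := mul_neg_of_pos_of_neg (by positivity) hvw
  rw [mem_ofPred_eq, Metric.mem_ball, dist_eq_norm, ← sq_lt_sq₀ (norm_nonneg _) hρ.le,
    norm_sq_add_smul_sub hv hw h, mem_Ioo, add_lt_iff_neg_left, mul_neg_iff]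
  constructor
  · rintro ⟨-, h | h⟩
    · exact ⟨by linarith, by linarith⟩
    · exact absurd h.1 (by linarith)
  · rintro ⟨h1, h2⟩
    exact ⟨by linarith, Or.inl ⟨by linarith, by linarith⟩⟩

lemma hitTime_eq (hρ : 0 < ρ) (hv : ‖v‖ = 1) (ht : 0 < t) (hw : ‖w‖ = 1) (hvw : ⟪v, w⟫ < 0)
    (h : p + t • v = c + ρ • w) : hitTime ρ c p v = t := by
  rw [hitTime, hitTimes_eq hρ hv ht hw hvw h, csInf_Ioo]
  linarith [mul_neg_of_pos_of_neg (show 0 < 2 * ρ by positivity) hvw]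

lemma rayHits_of_eq (hρ : 0 < ρ) (hv : ‖v‖ = 1) (ht : 0 < t) (hw : ‖w‖ = 1) (hvw : ⟪v, w⟫ < 0)
    (h : p + t • v = c + ρ • w) : rayHits ρ c p v := by
  have h1 : t - ρ * ⟪v, w⟫ ∈ {s | 0 < s ∧ p + s • v ∈ ball c ρ} := by
    have := mul_neg_of_pos_of_neg hρ hvw
    rw [hitTimes_eq hρ hv ht hw hvw h]
    exact ⟨by linarith, by linarith⟩
  exact ⟨_, h1⟩

lemma hitPoint_eq (hρ : 0 < ρ) (hv : ‖v‖ = 1) (ht : 0 < t) (hw : ‖w‖ = 1) (hvw : ⟪v, w⟫ < 0)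
    (h : p + t • v = c + ρ • w) : hitPoint ρ c p v = c + ρ • w := by
  rw [hitPoint, hitTime_eq hρ hv ht hw hvw h, h]

lemma hitW_eq (hρ : 0 < ρ) (hv : ‖v‖ = 1) (ht : 0 < t) (hw : ‖w‖ = 1) (hvw : ⟪v, w⟫ < 0)
    (h : p + t • v = c + ρ • w) : hitW ρ c p v = w := by
  rw [hitW, hitPoint_eq hρ hv ht hw hvw h, add_sub_cancel_left, smul_smul,
    inv_mul_cancel₀ hρ.ne', one_smul]

lemma hitV_eq (hρ : 0 < ρ) (hv : ‖v‖ = 1) (ht : 0 < t) (hw : ‖w‖ = 1) (hvw : ⟪v, w⟫ < 0)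
    (h : p + t • v = c + ρ • w) : hitV ρ c p v = v - (2 * ⟪v, w⟫) • w := by
  rw [hitV, hitW_eq hρ hv ht hw hvw h]

lemma exists_of_rayHits (hρ : 0 < ρ) (hv : ‖v‖ = 1) (hp : ρ < ‖p - c‖) (h : rayHits ρ c p v) :
    ∃ t > (0 : ℝ), ∃ w : Vec d, ‖w‖ = 1 ∧ ⟪v, w⟫ < 0 ∧ p + t • v = c + ρ • w := by
  obtain ⟨s, hs, hsb⟩ := h
  have hf : ContinuousOn (fun t : ℝ => ‖p + t • v - c‖) (Icc 0 s) := by fun_prop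
  rw [Metric.mem_ball, dist_eq_norm] at hsb
  obtain ⟨t, ht, hteq⟩ := intermediate_value_Ioo' hs.le hf
    (show ρ ∈ Ioo ‖p + s • v - c‖ ‖p + (0 : ℝ) • v - c‖ from ⟨hsb, by simpa using hp⟩)
  have hteq : ‖p + t • v - c‖ = ρ := hteq
  set w := ρ⁻¹ • (p + t • v - c) with hw
  have hw1 : ‖w‖ = 1 := by
    rw [hw, norm_smul, hteq, norm_inv, Real.norm_of_nonneg hρ.le, inv_mul_cancel₀ hρ.ne']
  have heq : p + t • v = c + ρ • w := by
    rw [hw, smul_smul, mul_inv_cancel₀ hρ.ne', one_smul]; abel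
  refine ⟨t, ht.1, w, hw1, ?_, heq⟩
  have h1 := norm_sq_add_smul_sub hv hw1 heq s
  have h2 : ‖p + s • v - c‖ ^ 2 < ρ ^ 2 := (sq_lt_sq₀ (norm_nonneg _) hρ.le).2 hsb
  have h3 : 0 < s - t := sub_pos.2 ht.2
  have h4 : s - t + 2 * ρ * ⟪v, w⟫ < 0 := by
    by_contra! h5
    nlinarith [mul_nonneg h3.le h5]
  by_contra! h5
  nlinarith [mul_nonneg hρ.le h5]

lemma norm_hitV (hρ : 0 < ρ) (hv : ‖v‖ = 1) (hp : ρ < ‖p - c‖) (h : rayHits ρ c p v) :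
    ‖hitV ρ c p v‖ = 1 := by
  obtain ⟨t, ht, w, hw, hvw, heq⟩ := exists_of_rayHits hρ hv hp h
  rw [hitV_eq hρ hv ht hw hvw heq, norm_reflect hv hw]

lemma exists_hitPoint_eq (hρ : 0 < ρ) (hv : ‖v‖ = 1) (hp : ρ < ‖p - c‖) (h : rayHits ρ c p v) :
    ∃ w, ‖w‖ = 1 ∧ hitPoint ρ c p v = c + ρ • w := by
  obtain ⟨t, ht, w, hw, hvw, heq⟩ := exists_of_rayHits hρ hv hp h
  exact ⟨w, hw, hitPoint_eq hρ hv ht hw hvw heq⟩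

lemma exists_collision (hρ : 0 < ρ) (hv : ‖v‖ = 1) (hu : ‖u‖ = 1) {m b : Vec d} (hm : c - m ≠ 0)
    (huv : u ≠ v)
    (h : dir (dir (c - m) + (ρ / ‖c - m‖) • (dir (u - v) - b)) = v) :
    rayHits ρ c (m + ρ • b) v ∧ hitV ρ c (m + ρ • b) v = u ∧
      hitW ρ c (m + ρ • b) v = dir (u - v) ∧
      hitPoint ρ c (m + ρ • b) v = c + ρ • dir (u - v) := by
  set y := dir (c - m) + (ρ / ‖c - m‖) • (dir (u - v) - b) with hy
  have hm0 : 0 < ‖c - m‖ := norm_pos_iff.2 hm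
  have hy0 : y ≠ 0 := by
    intro h0
    rw [h0, dir_zero] at h
    rw [← h, norm_zero] at hv
    exact zero_ne_one hv
  have hw := norm_dir (sub_ne_zero.2 huv)
  have hvw := inner_dir_sub_neg hv hu huv
  have ht : 0 < ‖c - m‖ * ‖y‖ := mul_pos hm0 (norm_pos_iff.2 hy0)
  have heq : m + ρ • b + (‖c - m‖ * ‖y‖) • v = c + ρ • dir (u - v) := by
    have h1 : ‖y‖ • v = y := by rw [← h, norm_smul_dir]
    rw [mul_smul, h1, hy, smul_add, norm_smul_dir, smul_smul, mul_div_cancel₀ _ hm0.ne', smul_sub]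
    abel
  refine ⟨rayHits_of_eq hρ hv ht hw hvw heq, ?_, hitW_eq hρ hv ht hw hvw heq,
    hitPoint_eq hρ hv ht hw hvw heq⟩
  rw [hitV_eq hρ hv ht hw hvw heq, reflect_dir_sub hv hu huv]

lemma dir_eq_of_rayHits (hρ : 0 < ρ) (hv : ‖v‖ = 1) {m b : Vec d} (hm : c - m ≠ 0)
    (hp : ρ < ‖m + ρ • b - c‖) (h : rayHits ρ c (m + ρ • b) v)
    (hu : hitV ρ c (m + ρ • b) v = u) :
    dir (dir (c - m) + (ρ / ‖c - m‖) • (dir (u - v) - b)) = v := by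
  obtain ⟨t, ht, w, hw, hvw, heq⟩ := exists_of_rayHits hρ hv hp h
  have hm0 : 0 < ‖c - m‖ := norm_pos_iff.2 hm
  rw [hitV_eq hρ hv ht hw hvw heq] at hu
  have h1 : dir (u - v) = w := by rw [← hu, dir_reflect_sub hw hvw]
  have h2 : dir (c - m) + (ρ / ‖c - m‖) • (dir (u - v) - b) = (‖c - m‖⁻¹ * t) • v := by
    have h3 : t • v = (c - m) + ρ • (w - b) := by
      rw [smul_sub, eq_sub_of_add_eq' heq]; abel
    rw [mul_smul, h3, h1, smul_add, smul_smul, dir, div_eq_inv_mul]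
  rw [h2, dir_smul (by positivity), dir_of_norm_eq_one hv]

end Hit

/-! ### Trajectories -/

section Trajectory

variable {d : ℕ} {ρ C : ℝ} {m : ℕ → Vec d} {β : Vec d → Vec d} {v u : Vec d}

lemma isTrajectory_zero : IsTrajectory ρ m β 0 v u ↔ v = u := by
  simp [IsTrajectory, chain]

lemma isTrajectory_succ {k : ℕ} : IsTrajectory ρ m β (k + 1) v u ↔
    IsTrajectory ρ m β k v (chain ρ m β v k).2 ∧
      rayHits ρ (m (k + 1)) (chain ρ m β v k).1 (chain ρ m β v k).2 ∧
      hitV ρ (m (k + 1)) (chain ρ m β v k).1 (chain ρ m β v k).2 = u := by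
  constructor
  · rintro ⟨h1, h2⟩
    exact ⟨⟨fun j hj => h1 j (hj.trans k.lt_succ_self), rfl⟩, h1 k k.lt_succ_self, h2⟩
  · rintro ⟨⟨h1, -⟩, h2, h3⟩
    refine ⟨fun j hj => ?_, h3⟩
    rcases Nat.lt_succ_iff_lt_or_eq.1 hj with h | rfl
    · exact h1 j h
    · exact h2

lemma lt_norm_add_smul_sub {b c p : Vec d} (hρ : 0 < ρ) (hb : ‖b‖ ≤ C)
    (hcp : C⁻¹ ≤ ‖c - p‖) (hρC : ρ * (C + 1) < C⁻¹) : ρ < ‖p + ρ • b - c‖ := by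
  have h1 : ‖c - p‖ ≤ ‖p + ρ • b - c‖ + ‖ρ • b‖ := by
    rw [norm_sub_rev (p + ρ • b)]
    refine le_trans (le_of_eq ?_) (norm_add_le _ _)
    congr 1
    abel
  rw [norm_smul, Real.norm_of_nonneg hρ.le] at h1
  nlinarith

lemma chain_spec (hC : 1 ≤ C) (hρ : 0 < ρ) (hρC : ρ * (C + 1) < C⁻¹)
    (hβ : ∀ v ∈ sph d, ‖β v‖ ≤ C) (hv : ‖v‖ = 1) {k : ℕ}
    (hm : ∀ j < k, C⁻¹ ≤ ‖m (j + 1) - m j‖)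
    (h : ∀ j < k, rayHits ρ (m (j + 1)) (chain ρ m β v j).1 (chain ρ m β v j).2) :
    ‖(chain ρ m β v k).2‖ = 1 ∧ ∃ b, ‖b‖ ≤ C ∧ (chain ρ m β v k).1 = m k + ρ • b := by
  induction k with
  | zero => exact ⟨hv, β v, hβ v (by simpa [sph] using hv), rfl⟩
  | succ k ih =>
    obtain ⟨h1, b, hb, hb'⟩ := ih (fun j hj => hm j (hj.trans k.lt_succ_self))
      (fun j hj => h j (hj.trans k.lt_succ_self))
    have h2 := h k k.lt_succ_self
    have hp : ρ < ‖(chain ρ m β v k).1 - m (k + 1)‖ := by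
      rw [hb']
      exact lt_norm_add_smul_sub hρ hb (hm k k.lt_succ_self) hρC
    obtain ⟨w, hw, hw'⟩ := exists_hitPoint_eq hρ h1 hp h2
    exact ⟨norm_hitV hρ h1 hp h2, w, by linarith, hw'⟩

end Trajectory

/-! ### Inverting the scattering maps -/

/-- `Ψ` recovers the initial velocity of a trajectory with scattering sequence `(m 0, …, m k)` from
its final velocity in `S`, and `B` gives its last impact location; both are extended to be
homogeneous of degree zero. -/
structure IsScatterInverse {d : ℕ} (ρ : ℝ) (m : ℕ → Vec d) (β : Vec d → Vec d) (k : ℕ)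
    (S : Set (Vec d)) (Ψ B : Vec d → Vec d) : Prop where
  left_dir : ∀ x, Ψ (dir x) = Ψ x
  right_dir : ∀ x, B (dir x) = B x
  contDiffOn_left : ContDiffOn ℝ 1 Ψ S
  contDiffOn_right : ContDiffOn ℝ 1 B S
  isTrajectory_iff : ∀ v u, ‖v‖ = 1 → ‖u‖ = 1 → u ∈ S → (IsTrajectory ρ m β k v u ↔ v = Ψ u)
  norm_left : ∀ u ∈ S, ‖u‖ = 1 → ‖Ψ u‖ = 1
  chain_eq : ∀ u ∈ S, ‖u‖ = 1 → (chain ρ m β (Ψ u) k).1 = m k + ρ • B u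

/-- A scattering inverse on the ball `ball e r` with bounded impact map and Jacobian almost
constant. -/
structure IsLocalState {d : ℕ} (ρ : ℝ) (m : ℕ → Vec d) (β : Vec d → Vec d) (k : ℕ)
    (e : Vec d) (r C δ : ℝ) (Ψ B : Vec d → Vec d) : Prop
    extends IsScatterInverse ρ m β k (ball e r) Ψ B where
  norm_le : ∀ x ∈ ball e r, ‖B x‖ ≤ C
  norm_fderiv_le : ∀ x ∈ ball e r, ‖fderiv ℝ B x‖ ≤ C
  jacobian : ∃ κ > 0, ∀ u ∈ ball e r, ‖u‖ = 1 →
    |(|(fderiv ℝ (homog Ψ) u).det|) - κ| ≤ δ * κ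

/-- A scattering inverse on the cone `openCone η e`, close to the reflection in a fixed sphere. -/
structure IsConeState {d : ℕ} (ρ : ℝ) (m : ℕ → Vec d) (β : Vec d → Vec d) (k : ℕ)
    (e : Vec d) (η ε : ℝ) (Ψ B : Vec d → Vec d) : Prop
    extends IsScatterInverse ρ m β k (openCone η e) Ψ B where
  near : ∀ u ∈ openCone η e, ‖u‖ = 1 → ‖B u - dir (u - e)‖ < ε
  fderiv_near : ∀ u ∈ openCone η e, ‖u‖ = 1 → ‖fderiv ℝ B u - ddir (u - e) ∘L ddir u‖ < ε
  jacobian : ∃ κ > 0, ∀ u ∈ openCone η e, ‖u‖ = 1 →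
    |(|(fderiv ℝ (homog Ψ) u).det|) - κ * coneJac e u| ≤ ε * (κ * coneJac e u)

lemma IsScatterInverse.mono {d : ℕ} {ρ : ℝ} {m : ℕ → Vec d} {β : Vec d → Vec d} {k : ℕ}
    {S T : Set (Vec d)} {Ψ B : Vec d → Vec d} (H : IsScatterInverse ρ m β k S Ψ B) (h : T ⊆ S) :
    IsScatterInverse ρ m β k T Ψ B where
  left_dir := H.left_dir
  right_dir := H.right_dir
  contDiffOn_left := H.contDiffOn_left.mono h
  contDiffOn_right := H.contDiffOn_right.mono h
  isTrajectory_iff v u hv hu huT := H.isTrajectory_iff v u hv hu (h huT)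
  norm_left u hu := H.norm_left u (h hu)
  chain_eq u hu := H.chain_eq u (h hu)

/-- The regularity and size assumptions on the initial displacement map `β`. -/
def IsAdmissibleStart {d : ℕ} (C : ℝ) (β : Vec d → Vec d) : Prop :=
  (∀ v ∈ sph d, ‖β v‖ ≤ C) ∧
    ∃ Dβ : Vec d → Vec d →L[ℝ] Vec d, ContinuousOn Dβ (sph d) ∧
      ∀ v ∈ sph d, HasFDerivWithinAt β (Dβ v) (sph d) v ∧ ‖Dβ v‖ ≤ C

lemma dir_mem_sph {d : ℕ} {x : Vec d} (hx : x ≠ 0) : dir x ∈ sph d := by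
  simpa [sph] using norm_dir hx

lemma contDiffOn_one_of_hasFDerivAt {d : ℕ} {f : Vec d → Vec d} {Df : Vec d → Vec d →L[ℝ] Vec d}
    {S : Set (Vec d)} (hS : IsOpen S) (hf : ∀ x ∈ S, HasFDerivAt f (Df x) x)
    (hDf : ContinuousOn Df S) : ContDiffOn ℝ 1 f S := by
  rw [show (1 : WithTop ℕ∞) = 0 + 1 from rfl, contDiffOn_succ_iff_fderiv_of_isOpen hS]
  refine ⟨fun x hx => (hf x hx).differentiableAt.differentiableWithinAt, by simp, ?_⟩
  rw [contDiffOn_zero]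
  exact hDf.congr fun x hx => (hf x hx).fderiv

lemma half_le_norm_of_mem_ball {d : ℕ} {e x : Vec d} (he : ‖e‖ = 1) {r : ℝ} (hr : r ≤ 1 / 2)
    (hx : x ∈ ball e r) : 1 / 2 ≤ ‖x‖ := by
  rw [Metric.mem_ball, dist_eq_norm] at hx
  have := norm_sub_norm_le e x
  rw [norm_sub_rev, he] at this
  linarith

lemma norm_ddir_le_four {d : ℕ} {x : Vec d} (hx : 1 / 2 ≤ ‖x‖) : ‖ddir x‖ ≤ 4 := by
  have h1 : ‖x‖⁻¹ ≤ (1 / 2)⁻¹ := inv_anti₀ (by norm_num) hx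
  have h2 := norm_ddir_le x
  norm_num at h1
  linarith

lemma homog_dir {d : ℕ} : homog (dir : Vec d → Vec d) = id := by
  ext1 x
  rw [homog, dir_dir, norm_smul_dir, id]

lemma isLocalState_zero {d : ℕ} {ρ C C' δ : ℝ} {m : ℕ → Vec d} {β : Vec d → Vec d} {e : Vec d}
    (he : ‖e‖ = 1) (hC0 : 0 ≤ C) (hC : 4 * C ≤ C') (hδ : 0 ≤ δ) (hβ : IsAdmissibleStart C β) :
    IsLocalState ρ m β 0 e (1 / 2) C' δ dir (fun x => β (dir x)) := by
  obtain ⟨hβ1, Dβ, hDβ, hβ2⟩ := hβ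
  have hpos : ∀ x ∈ ball e (1 / 2), 1 / 2 ≤ ‖x‖ := fun x hx =>
    half_le_norm_of_mem_ball he le_rfl hx
  have hne : ∀ x ∈ ball e (1 / 2), x ≠ 0 := fun x hx => by
    rw [← norm_pos_iff]; linarith [hpos x hx]
  have hder : ∀ x ∈ ball e (1 / 2), HasFDerivAt (fun x => β (dir x)) (Dβ (dir x) ∘L ddir x) x := by
    intro x hx
    have h1 := (hβ2 _ (dir_mem_sph (hne x hx))).1
    have h2 := h1.comp (s := {0}ᶜ) x (hasFDerivAt_dir (hne x hx)).hasFDerivWithinAt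
      fun y hy => dir_mem_sph hy
    exact h2.hasFDerivAt (isOpen_compl_singleton.mem_nhds (hne x hx))
  refine ⟨⟨dir_dir, fun x => by rw [dir_dir], fun x hx => (contDiffAt_dir (hne x hx)).contDiffWithinAt,
    contDiffOn_one_of_hasFDerivAt isOpen_ball hder ?_, ?_, ?_, ?_⟩, ?_, ?_, ?_⟩
  · refine ContinuousOn.clm_comp ?_ fun x hx => (continuousAt_ddir (hne x hx)).continuousWithinAt
    exact hDβ.comp (fun x hx => (hasFDerivAt_dir (hne x hx)).continuousAt.continuousWithinAt)
      fun x hx => dir_mem_sph (hne x hx)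
  · intro v u _ hu _
    rw [isTrajectory_zero, dir_of_norm_eq_one hu]
  · intro u _ hu
    rw [dir_of_norm_eq_one hu, hu]
  · intro u _ hu
    simp only [dir_of_norm_eq_one hu, chain]
  · intro x hx
    linarith [hβ1 _ (dir_mem_sph (hne x hx))]
  · intro x hx
    rw [(hder x hx).fderiv]
    refine (ContinuousLinearMap.opNorm_comp_le _ _).trans ?_
    have := mul_le_mul (hβ2 _ (dir_mem_sph (hne x hx))).2 (norm_ddir_le_four (hpos x hx))
      (norm_nonneg _) hC0
    linarith
  · refine ⟨1, one_pos, fun u _ _ => ?_⟩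
    rw [homog_dir, fderiv_id]
    simp [ContinuousLinearMap.det, hδ]

lemma eventually_chord_le {d : ℕ} {η : ℝ} (hη : 0 ≤ η) {e u : Vec d} (he : ‖e‖ = 1)
    (hu : u ∈ openCone η e) : ∀ᶠ y in 𝓝 u, chord η ≤ ‖dir y - e‖ := by
  filter_upwards [(isOpen_openCone η (ne_zero_of_norm_eq_one he)).mem_nhds hu] with y hy
  exact chord_le_norm_sub hη (norm_dir hy.1) he (dir_mem_openCone hy).2.le

lemma homog_comp {d : ℕ} {Ψ V : Vec d → Vec d} (hΨ : ∀ x, Ψ (dir x) = Ψ x) {x : Vec d}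
    (hx : x ≠ 0) (hV : ‖V (dir x)‖ = 1) : homog (fun y => Ψ (V y)) x = homog Ψ (homog V x) := by
  rw [homog, homog, homog, hΨ, norm_smul, hV, mul_one, norm_norm, ← hΨ (‖x‖ • V (dir x)),
    dir_smul (norm_pos_iff.2 hx), hΨ]

lemma abs_mul_sub_mul_le {a b κ c δ : ℝ} (hδ : 0 ≤ δ) (hδ1 : δ ≤ 1) (hκ : 0 ≤ κ) (hc : 0 ≤ c)
    (ha : |a - κ| ≤ δ * κ) (hb : |b - c| ≤ δ * c) : |a * b - κ * c| ≤ 3 * δ * (κ * c) := by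
  have h1 : a * b - κ * c = (a - κ) * (b - c) + (a - κ) * c + κ * (b - c) := by ring
  rw [h1]
  refine (abs_add_le _ _).trans ((add_le_add_left (abs_add_le _ _) _).trans ?_)
  rw [abs_mul, abs_mul, abs_mul, abs_of_nonneg hκ, abs_of_nonneg hc]
  have h2 := mul_le_mul ha hb (abs_nonneg _) (mul_nonneg hδ hκ)
  have h3 := mul_le_mul_of_nonneg_right ha hc
  have h4 := mul_le_mul_of_nonneg_left hb hκ
  have h5 : δ * κ * (δ * c) ≤ δ * (κ * c) := by
    have := mul_le_mul_of_nonneg_right hδ1 (mul_nonneg hδ (mul_nonneg hκ hc))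
    linarith
  linarith

lemma exists_isConeState_succ (d : ℕ) {η r C C' ε : ℝ} (hη0 : 0 < η) (hηπ : η < Real.pi)
    (hr : 0 < r) (hC : 1 ≤ C) (hCC' : C ≤ C') (hε : 0 < ε) (hε1 : ε ≤ 1) :
    ∃ ρ₀ > (0 : ℝ), ∀ ρ ∈ Ioo 0 ρ₀, ∀ (m : ℕ → Vec d) (β : Vec d → Vec d) (k : ℕ)
      (Ψ B : Vec d → Vec d), (∀ j < k + 1, C⁻¹ ≤ ‖m (j + 1) - m j‖) → IsAdmissibleStart C β →
      IsLocalState ρ m β k (dir (m (k + 1) - m k)) r C' (ε / 3) Ψ B →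
      ∃ Ψ' B', IsConeState ρ m β (k + 1) (dir (m (k + 1) - m k)) η ε Ψ' B' := by
  have hc := chord_pos hη0 hηπ
  set c := chord η with hcdef
  obtain ⟨τ₀, hτ₀, hstep⟩ := exists_step_estimates d hc hr (show 0 ≤ C' by linarith)
    (show 0 < ε / 3 by positivity)
  have hC0 : 0 < C := by linarith
  refine ⟨min (τ₀ / C) (C⁻¹ / (C + 1)), by positivity, fun ρ hρ m β k Ψ B hm hβ H => ?_⟩
  have hρ0 := hρ.1
  have hρ1 : ρ * C < τ₀ := (lt_div_iff₀ hC0).1 (hρ.2.trans_le (min_le_left _ _))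
  have hρ2 : ρ * (C + 1) < C⁻¹ :=
    (lt_div_iff₀ (by positivity)).1 (hρ.2.trans_le (min_le_right _ _))
  have hs := hm k k.lt_succ_self
  have hs0 : 0 < ‖m (k + 1) - m k‖ := (inv_pos.2 hC0).trans_le hs
  have hs0' : m (k + 1) - m k ≠ 0 := norm_pos_iff.1 hs0
  set e := dir (m (k + 1) - m k) with he_def
  have he : ‖e‖ = 1 := norm_dir hs0'
  set τ := ρ / ‖m (k + 1) - m k‖ with hτdef
  have hτ0 : 0 < τ := div_pos hρ0 hs0
  have hτ : τ < τ₀ := by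
    refine lt_of_le_of_lt ?_ hρ1
    rw [hτdef, div_le_iff₀ hs0, mul_assoc]
    refine le_mul_of_one_le_right hρ0.le ?_
    rwa [inv_le_iff_one_le_mul₀' hC0] at hs
  obtain ⟨SH, κ₂, hκ₂, hest⟩ := hstep τ ⟨hτ0, hτ⟩ e B he H.contDiffOn_right H.norm_le
    H.norm_fderiv_le
  obtain ⟨κ₁, hκ₁, hjac⟩ := H.jacobian
  have hev : ∀ x ∈ openCone η e, ∀ᶠ y in 𝓝 x, c ≤ ‖dir y - e‖ := fun x hx =>
    eventually_chord_le hη0.le he hx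
  have hx' : ∀ x ∈ openCone η e, c ≤ ‖dir x - e‖ := fun x hx => (hev x hx).self_of_nhds
  have hopen : IsOpen (openCone η e) := isOpen_openCone η (ne_zero_of_norm_eq_one he)
  set V := stepInv τ e B (min r c / 2) with hV
  have hVball : ∀ x ∈ openCone η e, V x ∈ ball e r := fun x hx =>
    SH.mem_ball (SH.stepInv_spec (hx' x hx)).1
  have hV1 : ∀ x ∈ openCone η e, ‖V x‖ = 1 := fun x hx => SH.norm_stepInv (hx' x hx)
  have hVd : ∀ x ∈ openCone η e, ContDiffAt ℝ 1 V x := fun x hx =>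
    SH.contDiffAt_stepInv hx.1 (hev x hx)
  have hVC : ContDiffOn ℝ 1 V (openCone η e) := fun x hx => (hVd x hx).contDiffWithinAt
  have hcoll : ∀ u ∈ openCone η e, ‖u‖ = 1 →
      rayHits ρ (m (k + 1)) (m k + ρ • B (V u)) (V u) ∧
      hitV ρ (m (k + 1)) (m k + ρ • B (V u)) (V u) = u ∧
      hitW ρ (m (k + 1)) (m k + ρ • B (V u)) (V u) = dir (u - V u) ∧
      hitPoint ρ (m (k + 1)) (m k + ρ • B (V u)) (V u) = m (k + 1) + ρ • dir (u - V u) := by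
    intro u hu hu1
    have h1 := (SH.stepInv_spec (hx' u hu)).2
    have h2 := SH.outgoing_sub_ne_zero (hx' u hu) (SH.stepInv_spec (hx' u hu)).1
    rw [dir_of_norm_eq_one hu1] at h1 h2
    exact exists_collision hρ0 (hV1 u hu) hu1 hs0' (_root_.sub_ne_zero.1 h2) h1
  have htraj : ∀ u ∈ openCone η e, ‖u‖ = 1 → IsTrajectory ρ m β k (Ψ (V u)) (V u) :=
    fun u hu hu1 => (H.isTrajectory_iff _ _ (H.norm_left _ (hVball u hu) (hV1 u hu)) (hV1 u hu)
      (hVball u hu)).2 rfl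
  have hchain1 : ∀ u ∈ openCone η e, ‖u‖ = 1 →
      (chain ρ m β (Ψ (V u)) k).1 = m k + ρ • B (V u) := fun u hu hu1 =>
    H.chain_eq _ (hVball u hu) (hV1 u hu)
  refine ⟨fun x => Ψ (V x), fun x => dir (dir x - V x), ⟨⟨?_, ?_, ?_, ?_, ?_, ?_, ?_⟩, ?_, ?_, ?_⟩⟩
  · intro x
    simp only [hV, stepInv_dir]
  · intro x
    simp only [hV, stepInv_dir, dir_dir]
  · exact H.contDiffOn_left.comp hVC fun x hx => hVball x hx
  · intro x hx
    have h1 : dir x - V x ≠ 0 := SH.outgoing_sub_ne_zero (hx' x hx) (SH.stepInv_spec (hx' x hx)).1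
    exact (ContDiffAt.comp (g := dir) x (contDiffAt_dir h1)
      ((contDiffAt_dir hx.1).sub (hVd x hx))).contDiffWithinAt
  · intro v u hv hu1 hu
    rw [isTrajectory_succ]
    constructor
    · rintro ⟨h1, h2, h3⟩
      obtain ⟨hu'1, b, hb, hb'⟩ := chain_spec hC hρ0 hρ2 hβ.1 hv
        (fun j hj => hm j (hj.trans k.lt_succ_self)) h1.1
      set u' := (chain ρ m β v k).2 with hu'
      rw [hb'] at h2 h3
      have h4 := dir_eq_of_rayHits hρ0 hu'1 hs0' (lt_norm_add_smul_sub hρ0 hb hs hρ2) h2 h3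
      have h5 : ‖u' - e‖ ≤ 2 * (τ * (1 + C)) := by
        have h6 := norm_dir_sub_le (ne_zero_of_norm_eq_one he) (e + τ • (dir (u - u') - b))
        rw [h4, dir_of_norm_eq_one he, he, sub_add_cancel_left, norm_neg, norm_smul,
          Real.norm_of_nonneg hτ0.le, norm_sub_rev] at h6
        have h7 : ‖dir (u - u') - b‖ ≤ 1 + C :=
          (norm_sub_le _ _).trans (add_le_add (norm_dir_le _) hb)
        have h8 := mul_le_mul_of_nonneg_left h7 hτ0.le
        linarith
      have h6 : u' ∈ closedBall e (min r c / 2) := by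
        rw [mem_closedBall, dist_eq_norm]
        have h7 := SH.two_mul_lt
        have h8 := mul_le_mul_of_nonneg_left hCC' hτ0.le
        linarith
      have h7 := (H.isTrajectory_iff v u' hv hu'1 (SH.mem_ball h6)).1 h1
      have h8 : b = B u' := by
        have h9 := H.chain_eq u' (SH.mem_ball h6) hu'1
        rw [← h7, hb', add_right_inj] at h9
        exact smul_right_injective _ hρ0.ne' h9
      rw [h8] at h4
      have h9 : u' = V u := SH.eq_stepInv (hx' u hu) h6 (by
        rw [dir_of_norm_eq_one hu1]; exact h4)
      rw [h7, h9]
    · rintro rfl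
      obtain ⟨h1, h2, -, -⟩ := hcoll u hu hu1
      have h3 := htraj u hu hu1
      rw [h3.2, hchain1 u hu hu1]
      exact ⟨h3, h1, h2⟩
  · intro u hu hu1
    exact H.norm_left _ (hVball u hu) (hV1 u hu)
  · intro u hu hu1
    obtain ⟨-, -, -, h1⟩ := hcoll u hu hu1
    rw [chain, (htraj u hu hu1).2, hchain1 u hu hu1, h1, dir_of_norm_eq_one hu1]
  · intro u hu hu1
    have := (hest u hu1 (hev u hu)).1
    rw [dir_of_norm_eq_one hu1]
    linarith
  · intro u hu hu1
    have := (hest u hu1 (hev u hu)).2.1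
    linarith
  · refine ⟨κ₁ * κ₂, by positivity, fun u hu hu1 => ?_⟩
    have h1 := (hest u hu1 (hev u hu)).2.2
    have h2 := hjac (V u) (hVball u hu) (hV1 u hu)
    have h3 : homog (fun x => Ψ (V x)) =ᶠ[𝓝 u] homog Ψ ∘ homog V := by
      filter_upwards [hopen.mem_nhds hu] with x hx
      refine homog_comp H.left_dir hx.1 ?_
      rw [hV, stepInv_dir]
      exact hV1 x hx
    have h4 : homog V u = V u := by rw [homog, hu1, one_smul, dir_of_norm_eq_one hu1]
    have h5 : HasFDerivAt (homog V) (fderiv ℝ (homog V) u) u :=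
      (SH.hasFDerivAt_homog_stepInv hu1 (hev u hu)).differentiableAt.hasFDerivAt
    have h6 : HasFDerivAt (homog Ψ) (fderiv ℝ (homog Ψ) (V u)) (homog V u) := by
      rw [h4]
      refine (hasFDerivAt_homog (hV1 u hu) (A := fderiv ℝ Ψ (V u)) ?_).differentiableAt.hasFDerivAt
      simp only [H.left_dir]
      exact ((H.contDiffOn_left.contDiffAt (isOpen_ball.mem_nhds (hVball u hu))).differentiableAt
        one_ne_zero).hasFDerivAt
    have h7 := ((h6.comp u h5).congr_of_eventuallyEq h3).fderiv
    have h8 : (fderiv ℝ (homog Ψ) (V u) ∘L fderiv ℝ (homog V) u).det =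
        (fderiv ℝ (homog Ψ) (V u)).det * (fderiv ℝ (homog V) u).det := by
      simp only [ContinuousLinearMap.det, ContinuousLinearMap.toLinearMap_comp, LinearMap.det_comp]
    rw [h7, h8, abs_mul]
    have h9 := abs_mul_sub_mul_le (by positivity) (by linarith) hκ₁.le
      (mul_nonneg hκ₂.le (abs_nonneg _)) h2 h1
    have h10 : 3 * (ε / 3) * (κ₁ * (κ₂ * coneJac e u)) = ε * (κ₁ * κ₂ * coneJac e u) := by ring
    have h11 : κ₁ * κ₂ * coneJac e u = κ₁ * (κ₂ * coneJac e u) := by ring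
    rw [← h10, h11]
    exact h9

lemma mem_openCone_of_mem_ball {d : ℕ} {η r : ℝ} (hη : 0 ≤ η) {e e' x : Vec d} (he' : ‖e'‖ = 1)
    (hee' : 2 * η < angle e' e) (hr : r ≤ 1 / 2) (hr' : 2 * r ≤ chord η) (hx : x ∈ ball e' r) :
    x ∈ openCone η e := by
  have h1 := half_le_norm_of_mem_ball he' hr hx
  have hx0 : x ≠ 0 := by rw [← norm_pos_iff]; linarith
  refine ⟨hx0, ?_⟩
  rw [Metric.mem_ball, dist_eq_norm, norm_sub_rev] at hx
  have h2 := norm_dir_sub_le (ne_zero_of_norm_eq_one he') x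
  rw [dir_of_norm_eq_one he', he', norm_sub_rev] at h2
  have h3 := angle_le_of_norm_sub_lt hη (norm_dir hx0) he' (by linarith)
  rw [angle_dir_left _ _ hx0, angle_comm] at h3
  have h4 := angle_le_angle_add_angle e' x e
  linarith

lemma norm_ddir_comp_ddir_le {d : ℕ} {c : ℝ} (hc : 0 < c) {e u : Vec d} (hu : ‖u‖ = 1)
    (h : c ≤ ‖u - e‖) : ‖ddir (u - e) ∘L ddir u‖ ≤ 4 * c⁻¹ := by
  have h1 := norm_ddir_le (u - e)
  have h2 := norm_ddir_le u
  rw [hu, inv_one, mul_one] at h2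
  have h3 : ‖u - e‖⁻¹ ≤ c⁻¹ := inv_anti₀ hc h
  have h4 := mul_le_mul (h1.trans (mul_le_mul_of_nonneg_left h3 zero_le_two)) h2 (norm_nonneg _)
    (by positivity)
  have h5 := ContinuousLinearMap.opNorm_comp_le (ddir (u - e)) (ddir u)
  linarith

lemma exists_isLocalState_of_isConeState (d : ℕ) {η δ : ℝ} (hη0 : 0 < η) (hηπ : η < Real.pi)
    (hδ : 0 < δ) (hδ1 : δ ≤ 1) :
    ∃ r > 0, ∀ (ρ : ℝ) (m : ℕ → Vec d) (β : Vec d → Vec d) (k : ℕ) (e e' : Vec d)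
      (Ψ B : Vec d → Vec d), ‖e‖ = 1 → ‖e'‖ = 1 → 2 * η < angle e' e →
      IsConeState ρ m β k e η (δ / 3) Ψ B →
      IsLocalState ρ m β k e' r (4 * (1 + 4 * (chord η)⁻¹)) δ Ψ B := by
  have hc := chord_pos hη0 hηπ
  set c := chord η with hcdef
  obtain ⟨r₁, hr₁, hosc⟩ := exists_coneJac_oscillation d hc (show 0 < δ / 3 by positivity)
  refine ⟨min (min (1 / 2) (c / 2)) r₁, by positivity,
    fun ρ m β k e e' Ψ B he he' hee' H => ?_⟩
  set r := min (min (1 / 2) (c / 2)) r₁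
  have hr1 : r ≤ 1 / 2 := (min_le_left _ _).trans (min_le_left _ _)
  have hr2 : r ≤ c / 2 := (min_le_left _ _).trans (min_le_right _ _)
  have hsub : ball e' r ⊆ openCone η e := fun x hx =>
    mem_openCone_of_mem_ball hη0.le he' hee' hr1 (by linarith) hx
  have hopen : IsOpen (openCone η e) := isOpen_openCone η (ne_zero_of_norm_eq_one he)
  have hfar : ∀ u ∈ openCone η e, ‖u‖ = 1 → c ≤ ‖u - e‖ := fun u hu hu1 =>
    chord_le_norm_sub hη0.le hu1 he hu.2.le
  have hc' : 0 < c⁻¹ := inv_pos.2 hc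
  refine ⟨H.toIsScatterInverse.mono hsub, fun x hx => ?_, fun x hx => ?_, ?_⟩
  · have h1 := hsub hx
    have h2 := H.near _ (dir_mem_openCone h1) (norm_dir h1.1)
    rw [H.right_dir] at h2
    have h3 := norm_le_norm_sub_add (B x) (dir (dir x - e))
    have h4 := norm_dir_le (dir x - e)
    linarith
  · have h1 := hsub hx
    have h2 := H.fderiv_near _ (dir_mem_openCone h1) (norm_dir h1.1)
    have h3 := norm_le_norm_sub_add (fderiv ℝ B (dir x)) (ddir (dir x - e) ∘L ddir (dir x))
    have h4 := norm_ddir_comp_ddir_le hc (norm_dir h1.1)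
      (hfar _ (dir_mem_openCone h1) (norm_dir h1.1))
    have h5 := norm_ddir_le_four (half_le_norm_of_mem_ball he' hr1 hx)
    have h6 : HasFDerivAt B (fderiv ℝ B (dir x) ∘L ddir x) x := by
      have h7 := ((H.contDiffOn_right.contDiffAt (hopen.mem_nhds (dir_mem_openCone h1))
        ).differentiableAt one_ne_zero).hasFDerivAt.comp x (hasFDerivAt_dir h1.1)
      exact h7.congr_of_eventuallyEq (.of_forall fun y => (H.right_dir y).symm)
    rw [h6.fderiv]
    refine (ContinuousLinearMap.opNorm_comp_le _ _).trans ?_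
    have h7 : ‖fderiv ℝ B (dir x)‖ ≤ 1 + 4 * c⁻¹ := by linarith
    have h8 := mul_le_mul h7 h5 (norm_nonneg _) (by positivity)
    linarith
  · obtain ⟨κ, hκ, hjac⟩ := H.jacobian
    have he'mem : e' ∈ openCone η e := ⟨ne_zero_of_norm_eq_one he', by linarith⟩
    have hfar' := hfar e' he'mem he'
    have hpos : 0 < coneJac e e' := coneJac_pos he he' fun h => by
      rw [h, sub_self, norm_zero] at hfar'
      linarith
    refine ⟨κ * coneJac e e', by positivity, fun u hu hu1 => ?_⟩
    have h1 := hjac u (hsub hu) hu1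
    have h2 := hosc e u e' he hu1 he' (hfar u (hsub hu) hu1) hfar' (by
      rw [← dist_eq_norm]
      exact (Metric.mem_ball.1 hu).trans_le (min_le_right _ _))
    have h3 := abs_le.1 h2
    have h4 : |κ * coneJac e u - κ * coneJac e e'| ≤ δ / 3 * (κ * coneJac e e') := by
      rw [← mul_sub, abs_mul, abs_of_pos hκ]
      have := mul_le_mul_of_nonneg_left h2 hκ.le
      linarith
    have h5 := abs_sub_le (|(fderiv ℝ (homog Ψ) u).det|) (κ * coneJac e u) (κ * coneJac e e')
    have h6 : κ * coneJac e u ≤ 2 * (κ * coneJac e e') := by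
      have h7 := mul_le_mul_of_nonneg_right (show δ / 3 ≤ 1 by linarith)
        (mul_nonneg hκ.le hpos.le)
      have := (abs_le.1 h4).2
      linarith
    have h7 := mul_le_mul_of_nonneg_left h6 (show 0 ≤ δ / 3 by positivity)
    linarith

lemma exists_isConeState (d : ℕ) {η C : ℝ} (hη0 : 0 < η) (hηπ : η < Real.pi) (hC : 1 ≤ C) (k : ℕ) :
    ∀ ε : ℝ, 0 < ε → ε ≤ 1 → ∃ ρ₀ > (0 : ℝ), ∀ ρ ∈ Ioo 0 ρ₀, ∀ (m : ℕ → Vec d) (β : Vec d → Vec d),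
      Admissible η C m (k + 1) → IsAdmissibleStart C β →
      ∃ Ψ B, IsConeState ρ m β (k + 1) (dir (m (k + 1) - m k)) η ε Ψ B := by
  have hC0 : 0 < C := by linarith
  have hne : ∀ (m : ℕ → Vec d) (n j : ℕ), Admissible η C m n → j + 1 ≤ n →
      m (j + 1) - m j ≠ 0 := fun m n j hm hj => by
    rw [← norm_pos_iff]
    exact (inv_pos.2 hC0).trans_le (hm.1 (j + 1) (by omega) hj)
  induction k with
  | zero =>
    intro ε hε hε1
    obtain ⟨ρ₀, hρ₀, h⟩ := exists_isConeState_succ d (r := 1 / 2) (C' := 4 * C) hη0 hηπ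
      (by norm_num) hC (by linarith) hε hε1
    refine ⟨ρ₀, hρ₀, fun ρ hρ m β hm hβ => h ρ hρ m β 0 _ _ (fun j hj => ?_) hβ
      (isLocalState_zero (norm_dir (hne m _ 0 hm le_rfl)) hC0.le le_rfl (by positivity) hβ)⟩
    exact hm.1 (j + 1) (by omega) (by omega)
  | succ k ih =>
    intro ε hε hε1
    obtain ⟨r, hr, hlocal⟩ := exists_isLocalState_of_isConeState d hη0 hηπ
      (show 0 < ε / 3 by positivity) (by linarith)
    obtain ⟨ρ₁, hρ₁, h1⟩ := ih (ε / 3 / 3) (by positivity) (by linarith)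
    have hc' : 0 < (chord η)⁻¹ := inv_pos.2 (chord_pos hη0 hηπ)
    obtain ⟨ρ₂, hρ₂, h2⟩ := exists_isConeState_succ d (C' := 4 * (1 + 4 * (chord η)⁻¹) + C)
      hη0 hηπ hr hC (by linarith) hε hε1
    refine ⟨min ρ₁ ρ₂, by positivity, fun ρ hρ m β hm hβ => ?_⟩
    obtain ⟨Ψ, B, H⟩ := h1 ρ ⟨hρ.1, hρ.2.trans_le (min_le_left _ _)⟩ m β
      ⟨fun j h1 h2 => hm.1 j h1 (by omega), fun j h1 h2 => hm.2 j h1 (by omega)⟩ hβ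
    have hs := hne m _ k hm (by omega)
    have hs' := hne m _ (k + 1) hm le_rfl
    have h3 := hm.2 (k + 1) (by omega) le_rfl
    have h4 := hlocal ρ m β (k + 1) _ (dir (m (k + 1 + 1) - m (k + 1))) Ψ B (norm_dir hs)
      (norm_dir hs') (by
        rw [angle_dir_left _ _ hs', angle_dir_right _ _ hs]
        exact h3) H
    refine h2 ρ ⟨hρ.1, hρ.2.trans_le (min_le_right _ _)⟩ m β (k + 1) Ψ B (fun j hj => ?_) hβ
      ⟨h4.toIsScatterInverse, fun x hx => (h4.norm_le x hx).trans (by linarith),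
        fun x hx => (h4.norm_fderiv_le x hx).trans (by linarith), h4.jacobian⟩
    exact hm.1 (j + 1) (by omega) (by omega)

lemma exists_isConeState_le (d : ℕ) {η C ε : ℝ} (hη0 : 0 < η) (hηπ : η < Real.pi) (hC : 1 ≤ C)
    (hε : 0 < ε) (hε1 : ε ≤ 1) (N : ℕ) :
    ∃ ρ₀ > (0 : ℝ), ∀ ρ ∈ Ioo 0 ρ₀, ∀ (m : ℕ → Vec d) (n : ℕ), 1 ≤ n → n ≤ N →
      Admissible η C m n → ∀ β : Vec d → Vec d, IsAdmissibleStart C β →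
      ∃ Ψ B, IsConeState ρ m β n (dir (m n - m (n - 1))) η ε Ψ B := by
  induction N with
  | zero => exact ⟨1, one_pos, fun ρ _ m n h1 h2 => absurd h1 (by omega)⟩
  | succ N ih =>
    obtain ⟨ρ₁, hρ₁, h1⟩ := ih
    obtain ⟨ρ₂, hρ₂, h2⟩ := exists_isConeState d hη0 hηπ hC N ε hε hε1
    refine ⟨min ρ₁ ρ₂, by positivity, fun ρ hρ m n hn hnN hm β hβ => ?_⟩
    rcases hnN.lt_or_eq with h | rfl
    · exact h1 ρ ⟨hρ.1, hρ.2.trans_le (min_le_left _ _)⟩ m n hn (by omega) hm β hβ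
    · exact h2 ρ ⟨hρ.1, hρ.2.trans_le (min_le_right _ _)⟩ m β hm hβ

/-! ### The diffeomorphism onto the cone -/

lemma homog_apply_of_norm_eq_one {d : ℕ} (f : Vec d → Vec d) {u : Vec d} (hu : ‖u‖ = 1) :
    homog f u = f u := by
  rw [homog, hu, one_smul, dir_of_norm_eq_one hu]

lemma hasFDerivAt_homog_smul {d : ℕ} {f : Vec d → Vec d} {A : Vec d →L[ℝ] Vec d} {x : Vec d}
    (h : HasFDerivAt (homog f) A x) {t : ℝ} (ht : 0 < t) : HasFDerivAt (homog f) A (t • x) := by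
  have h1 : HasFDerivAt (fun y : Vec d => t⁻¹ • y) (t⁻¹ • ContinuousLinearMap.id ℝ (Vec d))
      (t • x) := (hasFDerivAt_id _).const_smul t⁻¹
  have h2 : HasFDerivAt (homog f) A (t⁻¹ • t • x) := by
    rwa [smul_smul, inv_mul_cancel₀ ht.ne', one_smul]
  have h3 := (h2.comp (t • x) h1).const_smul t
  refine (h3.congr_of_eventuallyEq (.of_forall fun y => ?_)).congr_fderiv ?_
  · simp only [Pi.smul_apply, Function.comp]
    rw [homog_smul f (inv_pos.2 ht), smul_smul, mul_inv_cancel₀ ht.ne', one_smul]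
  · ext1 y
    simp [smul_smul, mul_inv_cancel₀ ht.ne']

lemma fderiv_homog_dir {d : ℕ} {f : Vec d → Vec d} {x : Vec d} (hx : x ≠ 0)
    (h : DifferentiableAt ℝ (homog f) x) :
    fderiv ℝ (homog f) (dir x) = fderiv ℝ (homog f) x :=
  (hasFDerivAt_homog_smul h.hasFDerivAt (inv_pos.2 (norm_pos_iff.2 hx))).fderiv

lemma ne_of_mem_openCone {d : ℕ} {η : ℝ} (hη : 0 ≤ η) {e x : Vec d} (hx : x ∈ openCone η e) :
    x ≠ e := by
  rintro rfl
  have := hx.2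
  rw [angle_self hx.1] at this
  linarith

namespace IsScatterInverse

variable {d : ℕ} {ρ η : ℝ} {m : ℕ → Vec d} {β : Vec d → Vec d} {k : ℕ} {e : Vec d}
  {Ψ B : Vec d → Vec d}

lemma chain_snd (H : IsScatterInverse ρ m β k (openCone η e) Ψ B) {u : Vec d}
    (hu : u ∈ openCone η e) (hu1 : ‖u‖ = 1) : (chain ρ m β (Ψ u) k).2 = u :=
  ((H.isTrajectory_iff _ _ (H.norm_left u hu hu1) hu1 hu).2 rfl).2

lemma homog_eq (H : IsScatterInverse ρ m β k (openCone η e) Ψ B) (x : Vec d) :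
    homog Ψ x = ‖x‖ • Ψ x := by rw [homog, H.left_dir]

lemma norm_eq_one (H : IsScatterInverse ρ m β k (openCone η e) Ψ B) {x : Vec d}
    (hx : x ∈ openCone η e) : ‖Ψ x‖ = 1 := by
  rw [← H.left_dir]
  exact H.norm_left _ (dir_mem_openCone hx) (norm_dir hx.1)

lemma norm_homog (H : IsScatterInverse ρ m β k (openCone η e) Ψ B) {x : Vec d}
    (hx : x ∈ openCone η e) : ‖homog Ψ x‖ = ‖x‖ := by
  rw [H.homog_eq, norm_smul, H.norm_eq_one hx, mul_one, norm_norm]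

lemma homog_chain_homog (H : IsScatterInverse ρ m β k (openCone η e) Ψ B) {x : Vec d}
    (hx : x ∈ openCone η e) : homog (fun v => (chain ρ m β v k).2) (homog Ψ x) = x := by
  have h1 : dir (homog Ψ x) = Ψ x := by
    rw [H.homog_eq, dir_smul (norm_pos_iff.2 hx.1), dir_of_norm_eq_one (H.norm_eq_one hx)]
  rw [homog, H.norm_homog hx, h1, ← H.left_dir, H.chain_snd (dir_mem_openCone hx) (norm_dir hx.1),
    norm_smul_dir]

lemma injOn_homog (H : IsScatterInverse ρ m β k (openCone η e) Ψ B) :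
    InjOn (homog Ψ) (openCone η e) := fun x hx y hy hxy => by
  rw [← H.homog_chain_homog hx, hxy, H.homog_chain_homog hy]

lemma contDiffAt_homog (H : IsScatterInverse ρ m β k (openCone η e) Ψ B) (he : ‖e‖ = 1)
    {x : Vec d} (hx : x ∈ openCone η e) : ContDiffAt ℝ 1 (homog Ψ) x := by
  have h1 := H.contDiffOn_left.contDiffAt
    ((isOpen_openCone η (ne_zero_of_norm_eq_one he)).mem_nhds hx)
  exact ((contDiffAt_norm ℝ hx.1).smul h1).congr_of_eventuallyEq (.of_forall H.homog_eq)

end IsScatterInverse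

namespace IsConeState

variable {d : ℕ} {ρ η ε : ℝ} {m : ℕ → Vec d} {β : Vec d → Vec d} {k : ℕ} {e : Vec d}
  {Ψ B : Vec d → Vec d}

lemma det_ne_zero (H : IsConeState ρ m β k e η ε Ψ B) (he : ‖e‖ = 1) (hη : 0 ≤ η) (hε : ε < 1)
    {x : Vec d} (hx : x ∈ openCone η e) : (fderiv ℝ (homog Ψ) x).det ≠ 0 := by
  rw [← fderiv_homog_dir hx.1 ((H.contDiffAt_homog he hx).differentiableAt one_ne_zero)]
  have hd := dir_mem_openCone hx
  obtain ⟨κ, hκ, hjac⟩ := H.jacobian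
  have h1 := hjac _ hd (norm_dir hx.1)
  intro h0
  have h2 : 0 < κ * coneJac e (dir x) :=
    mul_pos hκ (coneJac_pos he (norm_dir hx.1) (ne_of_mem_openCone hη hd))
  rw [h0, abs_zero, zero_sub, abs_neg, abs_of_pos h2] at h1
  nlinarith

/-- The derivative of `homog Ψ` as a linear equivalence. -/
def fderivEquiv (H : IsConeState ρ m β k e η ε Ψ B) (he : ‖e‖ = 1) (hη : 0 ≤ η) (hε : ε < 1)
    {x : Vec d} (hx : x ∈ openCone η e) : Vec d ≃L[ℝ] Vec d :=
  (fderiv ℝ (homog Ψ) x).toContinuousLinearEquivOfDetNeZero (H.det_ne_zero he hη hε hx)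

lemma hasStrictFDerivAt_homog (H : IsConeState ρ m β k e η ε Ψ B) (he : ‖e‖ = 1) (hη : 0 ≤ η)
    (hε : ε < 1) {x : Vec d} (hx : x ∈ openCone η e) :
    HasStrictFDerivAt (homog Ψ) (H.fderivEquiv he hη hε hx : Vec d →L[ℝ] Vec d) x :=
  (H.contDiffAt_homog he hx).hasStrictFDerivAt one_ne_zero

lemma isOpen_image (H : IsConeState ρ m β k e η ε Ψ B) (he : ‖e‖ = 1) (hη : 0 ≤ η) (hε : ε < 1) :
    IsOpen (homog Ψ '' openCone η e) := by
  rw [isOpen_iff_mem_nhds]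
  rintro _ ⟨x, hx, rfl⟩
  rw [← (H.hasStrictFDerivAt_homog he hη hε hx).map_nhds_eq_of_equiv]
  exact image_mem_map ((isOpen_openCone η (ne_zero_of_norm_eq_one he)).mem_nhds hx)

lemma contDiffAt_homog_chain (H : IsConeState ρ m β k e η ε Ψ B) (he : ‖e‖ = 1) (hη : 0 ≤ η)
    (hε : ε < 1) {x : Vec d} (hx : x ∈ openCone η e) :
    ContDiffAt ℝ 1 (homog fun v => (chain ρ m β v k).2) (homog Ψ x) := by
  have h1 := (H.contDiffAt_homog he hx).to_localInverse
    (f' := H.fderivEquiv he hη hε hx)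
    ((H.contDiffAt_homog he hx).differentiableAt one_ne_zero).hasFDerivAt one_ne_zero
  have h2 := ((H.contDiffAt_homog he hx).hasStrictFDerivAt' (f' := H.fderivEquiv he hη hε hx)
    ((H.contDiffAt_homog he hx).differentiableAt one_ne_zero).hasFDerivAt
    one_ne_zero).localInverse_unique (g := homog fun v => (chain ρ m β v k).2) (by
      filter_upwards [(isOpen_openCone η (ne_zero_of_norm_eq_one he)).mem_nhds hx] with y hy
      exact H.homog_chain_homog hy)
  exact h1.congr_of_eventuallyEq h2

lemma c1On_chain (H : IsConeState ρ m β k e η ε Ψ B) (he : ‖e‖ = 1) (hη : 0 ≤ η) (hε : ε < 1) :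
    C1On (fun v => (chain ρ m β v k).2) (homog Ψ '' openCone η e ∩ sph d) := by
  refine ⟨fderiv ℝ (homog fun v => (chain ρ m β v k).2), ?_, ?_⟩
  · rintro _ ⟨⟨x, hx, rfl⟩, -⟩
    exact ((H.contDiffAt_homog_chain he hη hε hx).fderiv_right (m := 0)
      (by norm_num)).continuousAt.continuousWithinAt
  · rintro v ⟨⟨x, hx, rfl⟩, hv⟩
    have h1 := ((H.contDiffAt_homog_chain he hη hε hx).differentiableAt
      one_ne_zero).hasFDerivAt.hasFDerivWithinAt (s := homog Ψ '' openCone η e ∩ sph d)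
    have h2 : ∀ w ∈ sph d, (chain ρ m β w k).2 = homog (fun v => (chain ρ m β v k).2) w :=
      fun w hw =>
      (homog_apply_of_norm_eq_one (fun v => (chain ρ m β v k).2) (by simpa [sph] using hw)).symm
    exact h1.congr (fun w hw => h2 w hw.2) (h2 _ hv)

end IsConeState

lemma C1On.of_contDiffOn {d : ℕ} {f : Vec d → Vec d} {S T : Set (Vec d)} (hS : IsOpen S)
    (hf : ContDiffOn ℝ 1 f S) (h : T ⊆ S) : C1On f T := by
  refine ⟨fderiv ℝ f, (hf.continuousOn_fderiv_of_isOpen hS le_rfl).mono h, fun x hx => ?_⟩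
  exact ((hf.contDiffAt (hS.mem_nhds (h hx))).differentiableAt
    one_ne_zero).hasFDerivAt.hasFDerivWithinAt

lemma IsScatterInverse.mem_image_inter_sph {d : ℕ} {ρ η : ℝ} {m : ℕ → Vec d} {β : Vec d → Vec d}
    {k : ℕ} {e : Vec d} {Ψ B : Vec d → Vec d} (H : IsScatterInverse ρ m β k (openCone η e) Ψ B)
    {u : Vec d} (hu : u ∈ openCone η e) (hu1 : ‖u‖ = 1) :
    Ψ u ∈ homog Ψ '' openCone η e ∩ sph d := by
  refine ⟨⟨u, hu, homog_apply_of_norm_eq_one _ hu1⟩, ?_⟩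
  simpa [sph] using H.norm_left u hu hu1

lemma IsScatterInverse.exists_of_mem {d : ℕ} {ρ η : ℝ} {m : ℕ → Vec d} {β : Vec d → Vec d}
    {k : ℕ} {e : Vec d} {Ψ B : Vec d → Vec d} (H : IsScatterInverse ρ m β k (openCone η e) Ψ B)
    {v : Vec d} (hv : v ∈ homog Ψ '' openCone η e ∩ sph d) :
    ∃ u ∈ openCone η e, ‖u‖ = 1 ∧ Ψ u = v := by
  obtain ⟨⟨x, hx, rfl⟩, hv⟩ := hv
  have h1 : ‖x‖ = 1 := by rw [← H.norm_homog hx]; simpa [sph] using hv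
  exact ⟨x, hx, h1, (homog_apply_of_norm_eq_one _ h1).symm⟩

/-! ### The impact location on the last scatterer -/

lemma impact_eq_dir {d : ℕ} (v u : Vec d) : impact v u = dir (u - v) := rfl

lemma fderiv_impact {d : ℕ} {v u : Vec d} (h : u ≠ v) : fderiv ℝ (impact v) u = ddir (u - v) := by
  have h1 := (hasFDerivAt_dir (_root_.sub_ne_zero.2 h)).comp u ((hasFDerivAt_id u).sub_const v)
  exact h1.fderiv

lemma bddAbove_norm_fderiv_impact (d : ℕ) {η : ℝ} (hη0 : 0 < η) (hηπ : η < Real.pi) :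
    BddAbove {c | ∃ v ∈ sph d, ∃ u ∈ sph d, η < angle u v ∧
      ∃ h : Vec d, ⟪u, h⟫ = 0 ∧ ‖h‖ = 1 ∧ c = ‖fderiv ℝ (impact v) u h‖} := by
  refine ⟨2 * (chord η)⁻¹, ?_⟩
  rintro _ ⟨v, hv, u, hu, huv, h, -, hh, rfl⟩
  rw [sph, mem_sphere_zero_iff_norm] at hu hv
  rw [fderiv_impact (ne_of_mem_openCone hη0.le ⟨ne_zero_of_norm_eq_one hu, huv⟩)]
  refine ((ddir (u - v)).le_opNorm h).trans ?_
  rw [hh, mul_one]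
  refine (norm_ddir_le _).trans (mul_le_mul_of_nonneg_left ?_ zero_le_two)
  exact inv_anti₀ (chord_pos hη0 hηπ) (chord_le_norm_sub hη0.le hu hv huv.le)

lemma norm_ddir_comp_ddir_le_Ceta {d : ℕ} {η : ℝ} (hη0 : 0 < η) (hηπ : η < Real.pi) {e u : Vec d}
    (he : ‖e‖ = 1) (hu : u ∈ openCone η e) (hu1 : ‖u‖ = 1) :
    ‖ddir (u - e) ∘L ddir u‖ ≤ Ceta d η - 1 := by
  have h0 : 0 ≤ Ceta d η - 1 := by
    rw [Ceta, add_sub_cancel_left]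
    refine Real.sSup_nonneg ?_
    rintro _ ⟨v, -, u, -, -, h, -, -, rfl⟩
    exact norm_nonneg _
  refine ContinuousLinearMap.opNorm_le_bound _ h0 fun h => ?_
  rw [ContinuousLinearMap.comp_apply]
  refine le_trans ?_ (mul_le_mul_of_nonneg_left (norm_ddir_apply_le hu1 h) h0)
  rcases eq_or_ne (ddir u h) 0 with h1 | h1
  · simp [h1]
  have h2 : ‖ddir (u - e) (dir (ddir u h))‖ ≤ Ceta d η - 1 := by
    rw [Ceta, add_sub_cancel_left]
    refine le_csSup (bddAbove_norm_fderiv_impact d hη0 hηπ) ⟨e, by simpa [sph] using he, u,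
      by simpa [sph] using hu1, hu.2, dir (ddir u h), ?_, norm_dir h1, ?_⟩
    · rw [dir, inner_smul_right, inner_ddir hu1, mul_zero]
    · rw [fderiv_impact (ne_of_mem_openCone hη0.le hu)]
  have h3 := mul_le_mul_of_nonneg_right h2 (norm_nonneg (ddir u h))
  rwa [dir, map_smul, norm_smul, norm_inv, norm_norm, mul_assoc, mul_comm ‖ddir (u - e) _‖,
    ← mul_assoc, inv_mul_cancel₀ (norm_ne_zero_iff.2 h1), one_mul] at h3

lemma IsScatterInverse.hitW_eq {d : ℕ} {ρ : ℝ} {m : ℕ → Vec d} {β : Vec d → Vec d} {k : ℕ}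
    {S : Set (Vec d)} {Ψ B : Vec d → Vec d} (hρ : ρ ≠ 0) (hk : 1 ≤ k)
    (H : IsScatterInverse ρ m β k S Ψ B) {u : Vec d} (hu : u ∈ S) (hu1 : ‖u‖ = 1) :
    hitW ρ (m k) (chain ρ m β (Ψ u) (k - 1)).1 (chain ρ m β (Ψ u) (k - 1)).2 = B u := by
  obtain ⟨k, rfl⟩ := Nat.exists_eq_add_of_le' hk
  have h1 := H.chain_eq u hu hu1
  simp only [chain] at h1
  rw [hitW, add_tsub_cancel_right, h1, add_sub_cancel_left, smul_smul, inv_mul_cancel₀ hρ, one_smul]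

/-! ### The surface measure on the sphere and homogeneous changes of variables -/

lemma measurable_dir {d : ℕ} : Measurable (dir : Vec d → Vec d) := by
  unfold dir
  fun_prop

lemma sphVol_eq (d : ℕ) : sphVol d =
    (d : ℝ≥0∞) • Measure.map dir ((volume : Measure (Vec d)).restrict (ball 0 1 \ {0})) := by
  ext A hA
  rw [sphVol, Measure.map_apply measurable_subtype_coe hA,
    Measure.toSphere_apply' _ (measurable_subtype_coe hA), finrank_euclideanSpace_fin,
    Measure.smul_apply, Measure.map_apply measurable_dir hA,
    Measure.restrict_apply (measurable_dir hA), smul_eq_mul]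
  congr 2
  ext x
  simp only [Subtype.image_preimage_coe, Set.mem_smul, mem_inter_iff, mem_preimage, Set.mem_sdiff,
    mem_ball_zero_iff, mem_singleton_iff, mem_sphere_zero_iff_norm, mem_Ioo]
  constructor
  · rintro ⟨t, ⟨ht0, ht1⟩, u, ⟨hu, huA⟩, rfl⟩
    rw [dir_smul ht0, dir_of_norm_eq_one hu, norm_smul, hu, mul_one, Real.norm_of_nonneg ht0.le]
    exact ⟨huA, ht1, smul_ne_zero ht0.ne' (ne_zero_of_norm_eq_one hu)⟩
  · rintro ⟨hxA, hx1, hx0⟩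
    exact ⟨‖x‖, ⟨norm_pos_iff.2 hx0, hx1⟩, dir x, ⟨norm_dir hx0, hxA⟩, norm_smul_dir x⟩

lemma measurable_abs_det_fderiv {d : ℕ} (f : Vec d → Vec d) :
    Measurable fun x => |(fderiv ℝ f x).det| :=
  (ContinuousLinearMap.continuous_det (𝕜 := ℝ) (E := Vec d)).abs.measurable.comp
    (measurable_fderiv ℝ f)

lemma measurable_ofReal_abs_det_fderiv {d : ℕ} (f : Vec d → Vec d) :
    Measurable fun x => ENNReal.ofReal |(fderiv ℝ f x).det| :=
  (measurable_abs_det_fderiv f).ennreal_ofReal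

/-- The part in the punctured unit ball of the cone over `A`. -/
def truncCone {d : ℕ} (A : Set (Vec d)) : Set (Vec d) := dir ⁻¹' A ∩ (ball 0 1 \ {0})

lemma measurableSet_truncCone {d : ℕ} {A : Set (Vec d)} (hA : MeasurableSet A) :
    MeasurableSet (truncCone A) :=
  (measurable_dir hA).inter (measurableSet_ball.diff (measurableSet_singleton 0))

lemma sphVol_apply {d : ℕ} {A : Set (Vec d)} (hA : MeasurableSet A) :
    sphVol d A = d * volume (truncCone A) := by
  rw [sphVol_eq, Measure.smul_apply, Measure.map_apply measurable_dir hA,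
    Measure.restrict_apply (measurable_dir hA), smul_eq_mul, truncCone]

lemma mul_volume_image_homog {d : ℕ} {f : Vec d → Vec d} {A : Set (Vec d)} (hA : MeasurableSet A)
    (hf : ∀ u ∈ A, DifferentiableAt ℝ (homog f) u) (hinj : InjOn (homog f) (truncCone A)) :
    d * volume (homog f '' truncCone A) =
      ∫⁻ u in A, ENNReal.ofReal |(fderiv ℝ (homog f) u).det| ∂(sphVol d) := by
  have hd : ∀ x ∈ truncCone A, HasFDerivAt (homog f) (fderiv ℝ (homog f) (dir x)) x := by
    intro x hx
    have h1 := hasFDerivAt_homog_smul (hf _ hx.1).hasFDerivAt (norm_pos_iff.2 hx.2.2)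
    rwa [norm_smul_dir] at h1
  rw [← lintegral_abs_det_fderiv_eq_addHaar_image volume (measurableSet_truncCone hA)
    (fun x hx => (hd x hx).hasFDerivWithinAt) hinj, sphVol_eq, Measure.restrict_smul,
    lintegral_smul_measure, Measure.restrict_map measurable_dir hA,
    lintegral_map (measurable_ofReal_abs_det_fderiv _) measurable_dir,
    Measure.restrict_restrict (measurable_dir hA), smul_eq_mul, truncCone]

lemma image_homog_truncCone {d : ℕ} {f : Vec d → Vec d} {A : Set (Vec d)}
    (hA1 : ∀ u ∈ A, ‖u‖ = 1) (hf : ∀ u ∈ A, ‖f u‖ = 1) :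
    homog f '' truncCone A = truncCone (f '' A) := by
  ext y
  constructor
  · rintro ⟨x, ⟨hxA, hx1, hx0⟩, rfl⟩
    have h1 : ‖homog f x‖ = ‖x‖ := by rw [homog, norm_smul, hf _ hxA, mul_one, norm_norm]
    refine ⟨?_, ?_, ?_⟩
    · rw [mem_preimage, homog, dir_smul (norm_pos_iff.2 hx0), dir_of_norm_eq_one (hf _ hxA)]
      exact ⟨_, hxA, rfl⟩
    · rwa [mem_ball_zero_iff, h1, ← mem_ball_zero_iff]
    · rw [mem_singleton_iff, ← norm_eq_zero, h1, norm_eq_zero]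
      exact hx0
  · rintro ⟨⟨u, hu, huy⟩, hy1, hy0⟩
    have hy : 0 < ‖y‖ := norm_pos_iff.2 hy0
    have h1 : ‖‖y‖ • u‖ = ‖y‖ := by rw [norm_smul, hA1 u hu, mul_one, norm_norm]
    have h2 : dir (‖y‖ • u) = u := by rw [dir_smul hy, dir_of_norm_eq_one (hA1 u hu)]
    refine ⟨‖y‖ • u, ⟨?_, ?_, smul_ne_zero hy.ne' (ne_zero_of_norm_eq_one (hA1 u hu))⟩, ?_⟩
    · rwa [mem_preimage, h2]
    · rwa [mem_ball_zero_iff, h1, ← mem_ball_zero_iff]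
    · rw [homog, h1, h2, huy, norm_smul_dir]

lemma sphVol_image {d : ℕ} {f : Vec d → Vec d} {A : Set (Vec d)} (hA : MeasurableSet A)
    (hA1 : ∀ u ∈ A, ‖u‖ = 1) (hf1 : ∀ u ∈ A, ‖f u‖ = 1) (hfA : MeasurableSet (f '' A))
    (hf : ∀ u ∈ A, DifferentiableAt ℝ (homog f) u) (hinj : InjOn (homog f) (truncCone A)) :
    sphVol d (f '' A) =
      ∫⁻ u in A, ENNReal.ofReal |(fderiv ℝ (homog f) u).det| ∂(sphVol d) := by
  rw [sphVol_apply hfA, ← image_homog_truncCone hA1 hf1, mul_volume_image_homog hA hf hinj]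

lemma map_restrict_sphVol {d : ℕ} {f g : Vec d → Vec d} {S : Set (Vec d)} (hS : MeasurableSet S)
    (hS1 : ∀ u ∈ S, ‖u‖ = 1) (hf1 : ∀ u ∈ S, ‖f u‖ = 1) (hfc : ContinuousOn f S)
    (hgc : ContinuousOn g (f '' S)) (hgf : ∀ u ∈ S, g (f u) = u)
    (hf : ∀ u ∈ S, DifferentiableAt ℝ (homog f) u) (hinj : InjOn (homog f) (truncCone S)) :
    Measure.map g ((sphVol d).restrict (f '' S)) = ((sphVol d).restrict S).withDensity
      fun u => ENNReal.ofReal |(fderiv ℝ (homog f) u).det| := by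
  have hfi : InjOn f S := fun u hu v hv h => by rw [← hgf u hu, h, hgf v hv]
  have him : ∀ A ⊆ S, MeasurableSet A → MeasurableSet (f '' A) := fun A hAS hA =>
    hA.image_of_continuousOn_injOn (hfc.mono hAS) (hfi.mono hAS)
  ext A hA
  have hAS := hA.inter hS
  rw [Measure.map_apply_of_aemeasurable (hgc.aemeasurable (him S subset_rfl hS)) hA,
    Measure.restrict_apply' (him S subset_rfl hS), withDensity_apply _ hA,
    Measure.restrict_restrict hA]
  have h1 : g ⁻¹' A ∩ f '' S = f '' (A ∩ S) := by
    ext y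
    constructor
    · rintro ⟨hy, u, hu, rfl⟩
      rw [mem_preimage, hgf u hu] at hy
      exact ⟨u, ⟨hy, hu⟩, rfl⟩
    · rintro ⟨u, ⟨huA, hu⟩, rfl⟩
      refine ⟨?_, u, hu, rfl⟩
      rwa [mem_preimage, hgf u hu]
  have hsub : truncCone (A ∩ S) ⊆ truncCone S := fun x hx => ⟨hx.1.2, hx.2⟩
  rw [h1, sphVol_image hAS (fun u hu => hS1 u hu.2) (fun u hu => hf1 u hu.2)
    (him _ inter_subset_right hAS) (fun u hu => hf u hu.2)
    (hinj.mono hsub)]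

/-! ### Central projection of a slab onto a hyperplane -/

/-- The slab between the hyperplane `e^⊥` and its translate by the unit vector `e`. -/
def slab {d : ℕ} (e : Vec d) : Set (Vec d) := {x | 0 < ⟪e, x⟫ ∧ ⟪e, x⟫ < 1}

lemma measurableSet_slab {d : ℕ} (e : Vec d) : MeasurableSet (slab e) := by
  have h : Continuous fun x : Vec d => ⟪e, x⟫ := by fun_prop
  exact ((isOpen_lt continuous_const h).inter (isOpen_lt h continuous_const)).measurableSet

/-- The central projection onto the hyperplane `e + e^⊥`, followed by the translation onto `e^⊥`. -/
def centralProj {d : ℕ} (e x : Vec d) : Vec d := ⟪e, x⟫⁻¹ • x - e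

lemma inner_centralProj {d : ℕ} {e x : Vec d} (he : ‖e‖ = 1) (hx : x ∈ slab e) :
    ⟪e, centralProj e x⟫ = 0 := by
  rw [centralProj, inner_sub_right, inner_smul_right, inv_mul_cancel₀ hx.1.ne',
    inner_self_of_norm_eq_one he, sub_self]

lemma map_shear_volume {d : ℕ} {e h : Vec d} (hh : ⟪e, h⟫ = 0) :
    Measure.map (fun x => x + ⟪e, x⟫ • h) (volume : Measure (Vec d)) = volume := by
  have h1 : (LinearMap.transvection (innerSL ℝ e : Vec d →ₗ[ℝ] ℝ) h).det = 1 := by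
    rw [LinearMap.transvection.det]
    simp [hh]
  have h2 := Measure.map_linearMap_addHaar_eq_smul_addHaar (volume : Measure (Vec d))
    (f := LinearMap.transvection (innerSL ℝ e : Vec d →ₗ[ℝ] ℝ) h) (by rw [h1]; exact one_ne_zero)
  rw [h1] at h2
  simp only [inv_one, abs_one, ENNReal.ofReal_one, one_smul] at h2
  exact h2

lemma map_shear_restrict_slab {d : ℕ} {e h : Vec d} (hh : ⟪e, h⟫ = 0) :
    Measure.map (fun x => x + ⟪e, x⟫ • h) ((volume : Measure (Vec d)).restrict (slab e)) =
      volume.restrict (slab e) := by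
  have h1 : (fun x => x + ⟪e, x⟫ • h) ⁻¹' slab e = slab e := by
    ext x
    simp [slab, inner_add_right, inner_smul_right, hh]
  conv_lhs => rw [← h1]
  rw [← Measure.restrict_map (by fun_prop) (measurableSet_slab e), map_shear_volume hh]

/-- The central projection as a map onto the subspace `e^⊥`. -/
def centralProjOnto {d : ℕ} (e x : Vec d) : (ℝ ∙ e)ᗮ :=
  (ℝ ∙ e)ᗮ.orthogonalProjectionOnto (⟪e, x⟫⁻¹ • x)

lemma measurable_centralProjOnto {d : ℕ} (e : Vec d) : Measurable (centralProjOnto e) := by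
  unfold centralProjOnto
  have : Measurable fun x : Vec d => ⟪e, x⟫⁻¹ • x := by fun_prop
  exact ((ℝ ∙ e)ᗮ.orthogonalProjectionOnto).continuous.measurable.comp this

lemma coe_centralProjOnto {d : ℕ} {e x : Vec d} (he : ‖e‖ = 1) (hx : x ∈ slab e) :
    (centralProjOnto e x : Vec d) = centralProj e x := by
  have h1 : ⟪e, x⟫⁻¹ • x = e + centralProj e x := by rw [centralProj, add_sub_cancel]
  have h2 : centralProj e x ∈ (ℝ ∙ e)ᗮ :=
    Submodule.mem_orthogonal_singleton_iff_inner_right.2 (inner_centralProj he hx)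
  rw [centralProjOnto, h1, map_add,
    Submodule.orthogonalProjectionOnto_orthogonalComplement_singleton_eq_zero, zero_add]
  exact congrArg Subtype.val
    (Submodule.orthogonalProjectionOnto_mem_subspace_eq_self (⟨_, h2⟩ : (ℝ ∙ e)ᗮ))

lemma centralProj_shear {d : ℕ} {e x h : Vec d} (hh : ⟪e, h⟫ = 0) (hx : x ∈ slab e) :
    centralProj e (x + ⟪e, x⟫ • h) = h + centralProj e x := by
  rw [centralProj, centralProj, inner_add_right, inner_smul_right, hh, mul_zero, add_zero, smul_add,
    smul_smul, inv_mul_cancel₀ hx.1.ne', one_smul]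
  abel

lemma shear_mem_slab {d : ℕ} {e x h : Vec d} (hh : ⟪e, h⟫ = 0) (hx : x ∈ slab e) :
    x + ⟪e, x⟫ • h ∈ slab e := by
  simpa [slab, inner_add_right, inner_smul_right, hh] using hx

/-- The pushforward of Lebesgue measure on the slab under central projection. -/
def slabMeas {d : ℕ} (e : Vec d) : Measure (ℝ ∙ e)ᗮ :=
  Measure.map (centralProjOnto e) ((volume : Measure (Vec d)).restrict (slab e))

lemma isAddLeftInvariant_slabMeas {d : ℕ} {e : Vec d} (he : ‖e‖ = 1) :
    (slabMeas e).IsAddLeftInvariant := by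
  refine ⟨fun h => ?_⟩
  have hh : ⟪e, (h : Vec d)⟫ = 0 := Submodule.mem_orthogonal_singleton_iff_inner_right.1 h.2
  have h1 : ((h + ·) ∘ centralProjOnto e) =ᵐ[(volume : Measure (Vec d)).restrict (slab e)]
      centralProjOnto e ∘ fun x => x + ⟪e, x⟫ • (h : Vec d) := by
    filter_upwards [ae_restrict_mem (measurableSet_slab e)] with x hx
    apply Subtype.ext
    simp only [Function.comp, Submodule.coe_add]
    rw [coe_centralProjOnto he hx, coe_centralProjOnto he (shear_mem_slab hh hx),
      centralProj_shear hh hx]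
  rw [slabMeas, Measure.map_map (measurable_const_add h) (measurable_centralProjOnto e),
    Measure.map_congr h1, ← Measure.map_map (measurable_centralProjOnto e) (by fun_prop),
    map_shear_restrict_slab hh]

lemma norm_le_of_mem_slab {d : ℕ} {e x : Vec d} (hx : x ∈ slab e) :
    ‖x‖ ≤ ‖e‖ + ‖centralProj e x‖ := by
  have h1 : x = ⟪e, x⟫ • (e + centralProj e x) := by
    rw [centralProj, add_sub_cancel, smul_smul, mul_inv_cancel₀ hx.1.ne', one_smul]
  calc ‖x‖ = ⟪e, x⟫ * ‖e + centralProj e x‖ := by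
        conv_lhs => rw [h1]
        rw [norm_smul, Real.norm_of_nonneg hx.1.le]
    _ ≤ 1 * ‖e + centralProj e x‖ := by gcongr; exact hx.2.le
    _ ≤ _ := by rw [one_mul]; exact norm_add_le _ _

lemma isFiniteMeasureOnCompacts_slabMeas {d : ℕ} {e : Vec d} (he : ‖e‖ = 1) :
    IsFiniteMeasureOnCompacts (slabMeas e) := by
  refine ⟨fun K hK => ?_⟩
  obtain ⟨R, hR⟩ := hK.isBounded.subset_closedBall 0
  refine (measure_mono hR).trans_lt ?_
  rw [slabMeas, Measure.map_apply (measurable_centralProjOnto e) measurableSet_closedBall,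
    Measure.restrict_apply' (measurableSet_slab e)]
  refine (measure_mono (t := closedBall 0 (1 + R)) ?_).trans_lt measure_closedBall_lt_top
  rintro x ⟨hx, hxs⟩
  rw [mem_preimage, mem_closedBall_zero_iff] at hx
  have h1 : ‖centralProjOnto e x‖ = ‖centralProj e x‖ := by
    rw [← coe_centralProjOnto he hxs, Submodule.coe_norm]
  rw [mem_closedBall_zero_iff]
  have := norm_le_of_mem_slab hxs
  linarith

lemma finrank_orthogonal_span {d : ℕ} {e : Vec d} (he : e ≠ 0) :
    (Module.finrank ℝ (ℝ ∙ e)ᗮ : ℝ) = d - 1 := by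
  have h1 := Submodule.finrank_add_finrank_orthogonal (ℝ ∙ e)
  rw [finrank_span_singleton he, finrank_euclideanSpace_fin] at h1
  have h2 : (1 : ℝ) + Module.finrank ℝ (ℝ ∙ e)ᗮ = d := by exact_mod_cast h1
  linarith

lemma exists_volume_slab_inter_eq {d : ℕ} {e : Vec d} (he : ‖e‖ = 1) :
    ∃ c : ℝ≥0∞, c ≠ ∞ ∧ (∀ D : Set (Vec d), MeasurableSet D → (∀ x ∈ D, ⟪x, e⟫ = 0) →
      volume (slab e ∩ centralProj e ⁻¹' D) = c * μH[(d : ℝ) - 1] D) ∧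
      μH[(d : ℝ) - 1] {x : Vec d | ⟪x, e⟫ = 0 ∧ ‖x‖ < 1} ≠ ∞ := by
  have hr := finrank_orthogonal_span (ne_zero_of_norm_eq_one he)
  have i1 := isAddLeftInvariant_slabMeas he
  have i2 := isFiniteMeasureOnCompacts_slabMeas he
  have himg : ∀ D : Set (Vec d), (∀ x ∈ D, ⟪x, e⟫ = 0) →
      ((↑) : (ℝ ∙ e)ᗮ → Vec d) '' ((↑) ⁻¹' D) = D := by
    intro D hD
    exact image_preimage_eq_of_subset fun x hx =>
      ⟨⟨x, Submodule.mem_orthogonal_singleton_iff_inner_left.2 (hD x hx)⟩, rfl⟩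
  have hH : ∀ D : Set (Vec d), (∀ x ∈ D, ⟪x, e⟫ = 0) →
      μH[(d : ℝ) - 1] (((↑) : (ℝ ∙ e)ᗮ → Vec d) ⁻¹' D) = μH[(d : ℝ) - 1] D := by
    intro D hD
    conv_rhs => rw [← himg D hD]
    refine (isometry_subtype_coe.hausdorffMeasure_image (Or.inl ?_) _).symm
    rw [← hr]
    positivity
  obtain ⟨c, h1⟩ : ∃ c : NNReal, slabMeas e = c • μH[(Module.finrank ℝ (ℝ ∙ e)ᗮ : ℝ)] :=
    ⟨_, Measure.isAddLeftInvariant_eq_smul _ _⟩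
  refine ⟨c, ENNReal.coe_ne_top, fun D hD hDe => ?_, ?_⟩
  · have h2 : slabMeas e ((↑) ⁻¹' D) = _ := congrArg (fun μ => μ ((↑) ⁻¹' D)) h1
    rw [Measure.smul_apply, hr, hH D hDe, slabMeas,
      Measure.map_apply (measurable_centralProjOnto e) (measurable_subtype_coe hD),
      Measure.restrict_apply' (measurableSet_slab e)] at h2
    refine Eq.trans ?_ h2
    congr 1
    ext x
    simp only [mem_inter_iff, mem_preimage]
    rw [and_comm]
    refine and_congr_left fun hx => ?_
    rw [coe_centralProjOnto he hx]
  · rw [← hH _ fun x hx => hx.1, ← hr]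
    refine ((measure_mono (t := closedBall 0 1) ?_).trans_lt measure_closedBall_lt_top).ne
    rintro x ⟨-, hx⟩
    rw [mem_closedBall_zero_iff]
    exact hx.le

/-! ### The exit-direction law -/

lemma measurable_scatterDir {d : ℕ} (s : Vec d) : Measurable (scatterDir s) := by
  unfold scatterDir
  fun_prop

/-- The displacement from the center of the scatterer to the ray, in the plane tangent at `e`, as a
function of the exit direction. -/
def shiftedParam {d : ℕ} (e u : Vec d) : Vec d := e + impactParam e u

lemma inner_homog_shiftedParam {d : ℕ} {e : Vec d} (he : ‖e‖ = 1) (x : Vec d) :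
    ⟪e, homog (shiftedParam e) x⟫ = ‖x‖ := by
  rw [homog, shiftedParam, inner_smul_right, inner_add_right, inner_impactParam he,
    inner_self_of_norm_eq_one he, add_zero, mul_one]

lemma centralProj_homog_shiftedParam {d : ℕ} {e x : Vec d} (he : ‖e‖ = 1) (hx : x ≠ 0) :
    centralProj e (homog (shiftedParam e) x) = impactParam e (dir x) := by
  rw [centralProj, inner_homog_shiftedParam he, homog, smul_smul,
    inv_mul_cancel₀ (norm_ne_zero_iff.2 hx), one_smul, shiftedParam, add_sub_cancel_left]

lemma image_homog_shiftedParam {d : ℕ} {e : Vec d} (he : ‖e‖ = 1) {A : Set (Vec d)}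
    (hA : ∀ u ∈ A, ‖u‖ = 1 ∧ u ≠ e) :
    homog (shiftedParam e) '' truncCone A =
      slab e ∩ centralProj e ⁻¹' ({x | ⟪x, e⟫ = 0 ∧ ‖x‖ < 1} ∩ scatterDir e ⁻¹' A) := by
  ext y
  constructor
  · rintro ⟨x, ⟨hxA, hx1, hx0⟩, rfl⟩
    have hu := hA _ hxA
    refine ⟨?_, ?_⟩
    · rw [slab, mem_ofPred_eq, inner_homog_shiftedParam he]
      exact ⟨norm_pos_iff.2 hx0, mem_ball_zero_iff.1 hx1⟩
    · rw [mem_preimage, centralProj_homog_shiftedParam he hx0]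
      refine ⟨⟨?_, norm_impactParam_lt he hu.1 hu.2⟩, ?_⟩
      · rw [real_inner_comm, inner_impactParam he]
      · rw [mem_preimage, scatterDir_impactParam he hu.1 hu.2]
        exact hxA
  · rintro ⟨hy, ⟨-, hp1⟩, hpA⟩
    have hp0 := inner_centralProj he hy
    have h1 := norm_scatterDir he hp0 hp1
    have h2 : ‖⟪e, y⟫ • scatterDir e (centralProj e y)‖ = ⟪e, y⟫ := by
      rw [norm_smul, h1, mul_one, Real.norm_of_nonneg hy.1.le]
    have h3 : dir (⟪e, y⟫ • scatterDir e (centralProj e y)) = scatterDir e (centralProj e y) := by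
      rw [dir_smul hy.1, dir_of_norm_eq_one h1]
    refine ⟨⟪e, y⟫ • scatterDir e (centralProj e y), ⟨?_, ?_, ?_⟩, ?_⟩
    · rwa [mem_preimage, h3]
    · rw [mem_ball_zero_iff, h2]
      exact hy.2
    · exact smul_ne_zero hy.1.ne' (ne_zero_of_norm_eq_one h1)
    · rw [homog, h2, h3, shiftedParam, impactParam_scatterDir he hp0 hp1, centralProj,
        add_sub_cancel, smul_smul, mul_inv_cancel₀ hy.1.ne', one_smul]

lemma injOn_homog_shiftedParam {d : ℕ} {e : Vec d} (he : ‖e‖ = 1) {A : Set (Vec d)}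
    (hA : ∀ u ∈ A, ‖u‖ = 1 ∧ u ≠ e) : InjOn (homog (shiftedParam e)) (truncCone A) := by
  intro x hx y hy hxy
  have h1 : ‖x‖ = ‖y‖ := by
    rw [← inner_homog_shiftedParam he, hxy, inner_homog_shiftedParam he]
  have h2 : dir x = dir y := by
    rw [← scatterDir_impactParam he (hA _ hx.1).1 (hA _ hx.1).2,
      ← centralProj_homog_shiftedParam he hx.2.2, hxy, centralProj_homog_shiftedParam he hy.2.2,
      scatterDir_impactParam he (hA _ hy.1).1 (hA _ hy.1).2]
  rw [← norm_smul_dir x, h1, h2, norm_smul_dir]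

lemma abs_det_fderiv_homog_shiftedParam {d : ℕ} {e u : Vec d} (hu : ‖u‖ = 1) (hue : u ≠ e) :
    |(fderiv ℝ (homog (shiftedParam e)) u).det| = coneJac e u := by
  have h1 : HasFDerivAt (homog (shiftedParam e)) (coneDeriv e u) u :=
    hasFDerivAt_homog_impactParam hu hue
  rw [h1.fderiv, coneJac]

/-- The law `λ_e` without the normalization. -/
def exitMeas {d : ℕ} (e : Vec d) : Measure (Vec d) := Measure.map (scatterDir e) (discMeas e)

lemma exitMeas_apply {d : ℕ} (e : Vec d) {A : Set (Vec d)} (hA : MeasurableSet A) :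
    exitMeas e A =
      μH[(d : ℝ) - 1] ({x : Vec d | ⟪x, e⟫ = 0 ∧ ‖x‖ < 1} ∩ scatterDir e ⁻¹' A) := by
  rw [exitMeas, Measure.map_apply (measurable_scatterDir e) hA, discMeas,
    Measure.restrict_apply (measurable_scatterDir e hA), inter_comm]

lemma measurableSet_disc {d : ℕ} (e : Vec d) :
    MeasurableSet {x : Vec d | ⟪x, e⟫ = 0 ∧ ‖x‖ < 1} := by
  have h : Continuous fun x : Vec d => ⟪x, e⟫ := by fun_prop
  exact (isClosed_eq h continuous_const).measurableSet.inter
    (isOpen_lt continuous_norm continuous_const).measurableSet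

lemma exists_smul_restrict_exitMeas {d : ℕ} {e : Vec d} (he : ‖e‖ = 1) :
    ∃ K : ℝ≥0∞, K ≠ ∞ ∧ ∀ V : Set (Vec d), MeasurableSet V → (∀ u ∈ V, ‖u‖ = 1 ∧ u ≠ e) →
      K • (exitMeas e).restrict V = ((sphVol d).restrict V).withDensity
        fun u => ENNReal.ofReal |(fderiv ℝ (homog (shiftedParam e)) u).det| := by
  obtain ⟨c, hc, hcD, -⟩ := exists_volume_slab_inter_eq he
  refine ⟨d * c, ENNReal.mul_ne_top (ENNReal.natCast_ne_top d) hc, fun V hV hV1 => ?_⟩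
  ext A hA
  have hAV := hA.inter hV
  have hAV1 : ∀ u ∈ A ∩ V, ‖u‖ = 1 ∧ u ≠ e := fun u hu => hV1 u hu.2
  have h1 := mul_volume_image_homog (f := shiftedParam e) hAV
    (fun u hu => (hasFDerivAt_homog_impactParam (hAV1 u hu).1 (hAV1 u hu).2).differentiableAt)
    (injOn_homog_shiftedParam he hAV1)
  rw [image_homog_shiftedParam he hAV1,
    hcD _ ((measurableSet_disc e).inter (measurable_scatterDir e hAV)) (fun x hx => hx.1.1),
    ← exitMeas_apply e hAV, ← mul_assoc] at h1
  rw [Measure.smul_apply, Measure.restrict_apply hA, smul_eq_mul, h1, withDensity_apply _ hA,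
    Measure.restrict_restrict hA]

lemma discMeas_univ_ne_top {d : ℕ} {e : Vec d} (he : ‖e‖ = 1) : discMeas e univ ≠ ∞ := by
  obtain ⟨-, -, -, h⟩ := exists_volume_slab_inter_eq he
  rwa [discMeas, Measure.restrict_apply_univ]

lemma lamSeta_dir {d : ℕ} {s : Vec d} (hs : s ≠ 0) (η : ℝ) : lamSeta (dir s) η = lamSeta s η := by
  have h1 : scatterDir (dir s) = scatterDir s := by
    ext1 x
    rw [scatterDir, scatterDir, dir_dir]
  have h2 : discMeas (dir s) = discMeas s := by
    have : ∀ x : Vec d, ⟪x, dir s⟫ = 0 ↔ ⟪x, s⟫ = 0 := fun x => by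
      rw [dir, inner_smul_right, mul_eq_zero, or_iff_right (inv_ne_zero (norm_ne_zero_iff.2 hs))]
    simp only [discMeas, this]
  have h3 : Vseta (dir s) η = Vseta s η := by
    simp only [Vseta, angle_dir_right _ _ hs]
  rw [lamSeta, lamSeta, lamS, lamS, h1, h2, h3]

lemma neg_mem_openCone {d : ℕ} {η : ℝ} (hη : η < Real.pi) {e : Vec d} (he : e ≠ 0) :
    -e ∈ openCone η e :=
  ⟨neg_ne_zero.2 he, by rwa [angle_neg_self_of_nonzero he]⟩

lemma measurableSet_Vseta {d : ℕ} {s : Vec d} (hs : s ≠ 0) (η : ℝ) : MeasurableSet (Vseta s η) := by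
  have h := isClosed_sphere (x := (0 : Vec d)) (ε := 1)
  rw [Vseta_eq hs]
  convert h.measurableSet.inter
    (isOpen_openCone η (ne_zero_of_norm_eq_one (norm_dir hs))).measurableSet using 1
  ext x
  simp

lemma sphVol_Vseta_ne_zero {d : ℕ} {η : ℝ} (hη : η < Real.pi) {e : Vec d} (he : ‖e‖ = 1) :
    sphVol d (Vseta e η) ≠ 0 := by
  have he0 := ne_zero_of_norm_eq_one he
  have hd : d ≠ 0 := by
    rintro rfl
    exact he0 (Subsingleton.elim _ _)
  rw [sphVol_apply (measurableSet_Vseta he0 η)]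
  refine mul_ne_zero (Nat.cast_ne_zero.2 hd) ?_
  have h1 : openCone η e ∩ ball 0 1 ⊆ truncCone (Vseta e η) := by
    rintro x ⟨hx, hx1⟩
    refine ⟨?_, hx1, hx.1⟩
    rw [mem_preimage, Vseta_eq he0, dir_of_norm_eq_one he]
    exact ⟨norm_dir hx.1, dir_mem_openCone hx⟩
  have h2 : IsOpen (openCone η e ∩ ball 0 1) := (isOpen_openCone η he0).inter isOpen_ball
  refine ((h2.measure_pos volume ⟨(2⁻¹ : ℝ) • -e, ?_, ?_⟩).trans_le (measure_mono h1)).ne'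
  · have h3 := neg_mem_openCone hη he0
    exact ⟨smul_ne_zero (by norm_num) h3.1, by
      rw [angle_smul_left_of_pos _ _ (by norm_num)]; exact h3.2⟩
  · rw [mem_ball_zero_iff, norm_smul, norm_neg, he]
    norm_num

lemma lamSeta_eq {d : ℕ} {η : ℝ} (hη0 : 0 ≤ η) (hη : η < Real.pi) {e : Vec d} (he : ‖e‖ = 1) :
    (∫⁻ u in Vseta e η, ENNReal.ofReal |(fderiv ℝ (homog (shiftedParam e)) u).det| ∂(sphVol d)) ≠ 0 ∧
    (∫⁻ u in Vseta e η, ENNReal.ofReal |(fderiv ℝ (homog (shiftedParam e)) u).det| ∂(sphVol d)) ≠ ∞ ∧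
    lamSeta e η =
      (∫⁻ u in Vseta e η, ENNReal.ofReal |(fderiv ℝ (homog (shiftedParam e)) u).det| ∂(sphVol d))⁻¹ •
      ((sphVol d).restrict (Vseta e η)).withDensity
        fun u => ENNReal.ofReal |(fderiv ℝ (homog (shiftedParam e)) u).det| := by
  have he0 := ne_zero_of_norm_eq_one he
  set j : Vec d → ℝ≥0∞ := fun u => ENNReal.ofReal |(fderiv ℝ (homog (shiftedParam e)) u).det|
    with hj
  have hjm : Measurable j := measurable_ofReal_abs_det_fderiv _
  set V := Vseta e η with hVdef
  have hV : MeasurableSet V := measurableSet_Vseta he0 η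
  have hV1 : ∀ u ∈ V, ‖u‖ = 1 ∧ u ≠ e := by
    intro u hu
    rw [hVdef, Vseta_eq he0, dir_of_norm_eq_one he] at hu
    exact ⟨hu.1, ne_of_mem_openCone hη0 hu.2⟩
  obtain ⟨K, hK, hKV⟩ := exists_smul_restrict_exitMeas he
  have hKV' := hKV V hV hV1
  have hI : ∫⁻ u in V, j u ∂(sphVol d) = K * exitMeas e V := by
    have h1 := congrArg (fun μ => μ univ) hKV'
    rw [Measure.smul_apply, Measure.restrict_apply_univ, withDensity_apply _ MeasurableSet.univ,
      Measure.restrict_univ, smul_eq_mul] at h1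
    exact h1.symm
  have hD := discMeas_univ_ne_top he
  have hVD : exitMeas e V ≤ discMeas e univ := by
    rw [exitMeas, Measure.map_apply (measurable_scatterDir e) hV]
    exact measure_mono (subset_univ _)
  have hV_top : exitMeas e V ≠ ∞ := (hVD.trans_lt hD.lt_top).ne
  have hI0 : ∫⁻ u in V, j u ∂(sphVol d) ≠ 0 := by
    rw [← pos_iff_ne_zero, setLIntegral_pos_iff hjm]
    refine (pos_iff_ne_zero.2 (sphVol_Vseta_ne_zero hη he)).trans_le (measure_mono ?_)
    refine fun u hu => ⟨?_, hu⟩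
    rw [Function.mem_support, hj]
    simp only
    rw [abs_det_fderiv_homog_shiftedParam (hV1 u hu).1 (hV1 u hu).2]
    exact (ENNReal.ofReal_pos.2 (coneJac_pos he (hV1 u hu).1 (hV1 u hu).2)).ne'
  refine ⟨hI0, by rw [hI]; exact ENNReal.mul_ne_top hK hV_top, ?_⟩
  rw [hI] at hI0
  have hK0 := left_ne_zero_of_mul hI0
  have hV0 := right_ne_zero_of_mul hI0
  have hD0 : discMeas e univ ≠ 0 := ((pos_iff_ne_zero.2 hV0).trans_le hVD).ne'
  rw [hI, ← hKV', smul_smul, lamSeta, lamS, ← hVdef, ← exitMeas, Measure.smul_apply,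
    Measure.restrict_smul, smul_smul, smul_eq_mul]
  congr 1
  rw [ENNReal.mul_inv (Or.inl (ENNReal.inv_ne_zero.2 hD)) (Or.inl (ENNReal.inv_ne_top.2 hD0)),
    inv_inv, mul_comm (discMeas e univ), mul_assoc, ENNReal.mul_inv_cancel hD0 hD, mul_one,
    ENNReal.mul_inv (Or.inl hK0) (Or.inl hK), mul_comm K⁻¹, mul_assoc,
    ENNReal.inv_mul_cancel hK0 hK, mul_one]

/-! ### Comparison of densities -/

lemma lintegral_ofReal_le_mul {X : Type*} [MeasurableSpace X] {μ : Measure X} {j J : X → ℝ} {c : ℝ}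
    (hc : 0 ≤ c) (hj : Measurable j) (h : ∀ᵐ u ∂μ, J u ≤ c * j u) :
    ∫⁻ u, ENNReal.ofReal (J u) ∂μ ≤ ENNReal.ofReal c * ∫⁻ u, ENNReal.ofReal (j u) ∂μ := by
  rw [← lintegral_const_mul _ hj.ennreal_ofReal]
  refine lintegral_mono_ae ?_
  filter_upwards [h] with u hu
  rw [← ENNReal.ofReal_mul hc]
  exact ENNReal.ofReal_le_ofReal hu

lemma ratio_mem_Icc {a b c x δ ε : ℝ} (ha : 0 < a) (hx : 0 < x) (hc : 0 < c) (hδ0 : 0 < δ)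
    (hδ1 : δ ≤ 1 / 4) (hδε : 4 * δ ≤ ε) {X : ℝ} (hX1 : (1 - δ) * (c * x) ≤ X)
    (hX2 : X ≤ (1 + δ) * (c * x)) (hb1 : (1 - δ) * c * a ≤ b) (hb2 : b ≤ (1 + δ) * c * a) :
    a / b * (X / x) ∈ Icc (1 - ε) (1 + ε) := by
  have hδ : 0 < 1 - δ := by linarith
  have hb : 0 < b := lt_of_lt_of_le (by positivity) hb1
  rw [div_mul_div_comm, mem_Icc, le_div_iff₀ (by positivity), div_le_iff₀ (by positivity)]
  have hcax : 0 < c * a * x := by positivity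
  constructor
  · have h1 : a * ((1 - δ) * (c * x)) ≤ a * X := by gcongr
    rcases le_or_gt (1 - ε) 0 with h | h
    · have : (1 - ε) * (b * x) ≤ 0 := mul_nonpos_of_nonpos_of_nonneg h (by positivity)
      have : 0 ≤ a * ((1 - δ) * (c * x)) := by positivity
      linarith
    · have h2 : (1 - ε) * (b * x) ≤ (1 - ε) * ((1 + δ) * c * a * x) := by gcongr
      have h3 : 0 ≤ ((1 - δ) - (1 - ε) * (1 + δ)) * (c * a * x) := by
        refine mul_nonneg ?_ hcax.le
        nlinarith
      nlinarith
  · have h1 : a * X ≤ a * ((1 + δ) * (c * x)) := by gcongr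
    have h2 : (1 + ε) * ((1 - δ) * c * a * x) ≤ (1 + ε) * (b * x) := by
      have : 0 < ε := by linarith
      gcongr
    have h3 : 0 ≤ ((1 + ε) * (1 - δ) - (1 + δ)) * (c * a * x) := by
      refine mul_nonneg ?_ hcax.le
      nlinarith
    nlinarith

lemma exists_density_ratio {X : Type*} [MeasurableSpace X] [TopologicalSpace X] {μ : Measure X}
    {V : Set X} (hV : MeasurableSet V) {j J : X → ℝ} (hj : Measurable j) (hJ : Measurable J)
    (hjc : ContinuousOn j V) (hJc : ContinuousOn J V) (hj0 : ∀ u ∈ V, 0 < j u) {κ δ ε : ℝ}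
    (hκ : 0 < κ) (hδ0 : 0 < δ) (hδ1 : δ ≤ 1 / 4) (hδε : 4 * δ ≤ ε)
    (hJj : ∀ u ∈ V, |J u - κ * j u| ≤ δ * (κ * j u))
    (hI0 : ∫⁻ u in V, ENNReal.ofReal (j u) ∂μ ≠ 0) (hI : ∫⁻ u in V, ENNReal.ofReal (j u) ∂μ ≠ ∞) :
    ∃ g : X → ℝ, ContinuousOn g V ∧ (∀ u ∈ V, g u ∈ Icc (1 - ε) (1 + ε)) ∧
      (∫⁻ u in V, ENNReal.ofReal (J u) ∂μ)⁻¹ •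
        (μ.restrict V).withDensity (fun u => ENNReal.ofReal (J u)) =
      ((∫⁻ u in V, ENNReal.ofReal (j u) ∂μ)⁻¹ •
        (μ.restrict V).withDensity (fun u => ENNReal.ofReal (j u))).withDensity
          fun u => ENNReal.ofReal (g u) := by
  set a := ∫⁻ u in V, ENNReal.ofReal (j u) ∂μ with ha
  set b := ∫⁻ u in V, ENNReal.ofReal (J u) ∂μ with hb
  have hlow : ∀ u ∈ V, (1 - δ) * (κ * j u) ≤ J u := fun u hu => by
    have := (abs_le.1 (hJj u hu)).1
    linarith
  have hupp : ∀ u ∈ V, J u ≤ (1 + δ) * (κ * j u) := fun u hu => by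
    have := (abs_le.1 (hJj u hu)).2
    linarith
  have hδ : 0 < 1 - δ := by linarith
  have hb2 : b ≤ ENNReal.ofReal ((1 + δ) * κ) * a := by
    refine lintegral_ofReal_le_mul (by positivity) hj ?_
    filter_upwards [ae_restrict_mem hV] with u hu
    rw [mul_assoc]
    exact hupp u hu
  have hb1 : a ≤ ENNReal.ofReal ((1 - δ) * κ)⁻¹ * b := by
    refine lintegral_ofReal_le_mul (by positivity) hJ ?_
    filter_upwards [ae_restrict_mem hV] with u hu
    rw [← div_eq_inv_mul, le_div_iff₀ (by positivity)]
    linarith [hlow u hu]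
  have hb_top : b ≠ ∞ := (hb2.trans_lt (ENNReal.mul_lt_top ENNReal.ofReal_lt_top hI.lt_top)).ne
  have hb0 : b ≠ 0 := by
    rintro h
    rw [h, mul_zero] at hb1
    exact hI0 (le_antisymm hb1 zero_le)
  have hapos : 0 < a.toReal := ENNReal.toReal_pos hI0 hI
  have hb2' : b.toReal ≤ (1 + δ) * κ * a.toReal := by
    have := ENNReal.toReal_mono (ENNReal.mul_ne_top ENNReal.ofReal_ne_top hI) hb2
    rwa [ENNReal.toReal_mul, ENNReal.toReal_ofReal (by positivity)] at this
  have hb1' : (1 - δ) * κ * a.toReal ≤ b.toReal := by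
    have := ENNReal.toReal_mono (ENNReal.mul_ne_top ENNReal.ofReal_ne_top hb_top) hb1
    rwa [ENNReal.toReal_mul, ENNReal.toReal_ofReal (by positivity), ← div_eq_inv_mul,
      le_div_iff₀ (by positivity), mul_comm] at this
  refine ⟨fun u => a.toReal / b.toReal * (J u / j u),
    continuousOn_const.mul (hJc.div hjc fun u hu => (hj0 u hu).ne'),
    fun u hu => ratio_mem_Icc hapos (hj0 u hu) hκ hδ0 hδ1 hδε (hlow u hu) (hupp u hu) hb1' hb2', ?_⟩
  have hg : Measurable fun u => ENNReal.ofReal (a.toReal / b.toReal * (J u / j u)) := by fun_prop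
  rw [withDensity_smul_measure, ← withDensity_mul _ hj.ennreal_ofReal hg]
  have h1 : ((fun u => ENNReal.ofReal (j u)) *
      fun u => ENNReal.ofReal (a.toReal / b.toReal * (J u / j u))) =ᵐ[μ.restrict V]
      (a / b) • fun u => ENNReal.ofReal (J u) := by
    filter_upwards [ae_restrict_mem hV] with u hu
    have h2 : a / b = ENNReal.ofReal (a.toReal / b.toReal) := by
      rw [← ENNReal.toReal_div, ENNReal.ofReal_toReal (ENNReal.div_ne_top hI hb0)]
    rw [Pi.mul_apply, Pi.smul_apply, h2, smul_eq_mul, ← ENNReal.ofReal_mul (hj0 u hu).le,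
      ← ENNReal.ofReal_mul (by positivity)]
    congr 1
    have := (hj0 u hu).ne'
    field_simp
  rw [withDensity_congr_ae h1, withDensity_smul _ hJ.ennreal_ofReal, smul_smul, div_eq_mul_inv,
    ← mul_assoc, ENNReal.inv_mul_cancel hI0 hI, one_mul]

/-! ### The distortion of the surface measure -/

namespace IsConeState

variable {d : ℕ} {ρ η δ : ℝ} {m : ℕ → Vec d} {β : Vec d → Vec d} {k : ℕ} {e : Vec d}
  {Ψ B : Vec d → Vec d}

lemma image_Vseta (H : IsConeState ρ m β k e η δ Ψ B) (he : ‖e‖ = 1) :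
    Ψ '' Vseta e η = homog Ψ '' openCone η e ∩ sph d := by
  rw [Vseta_eq (ne_zero_of_norm_eq_one he), dir_of_norm_eq_one he]
  ext v
  constructor
  · rintro ⟨u, ⟨hu1, hu⟩, rfl⟩
    exact H.mem_image_inter_sph hu hu1
  · intro hv
    obtain ⟨u, hu, hu1, rfl⟩ := H.exists_of_mem hv
    exact ⟨u, ⟨hu1, hu⟩, rfl⟩

lemma exists_density (H : IsConeState ρ m β k e η δ Ψ B) (he : ‖e‖ = 1) (hη0 : 0 ≤ η)
    (hηπ : η < Real.pi) (hδ0 : 0 < δ) (hδ1 : δ ≤ 1 / 4) {ε : ℝ} (hδε : 4 * δ ≤ ε) :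
    ∃ g : Vec d → ℝ, ContinuousOn g (Vseta e η) ∧
      (∀ u ∈ Vseta e η, g u ∈ Icc (1 - ε) (1 + ε)) ∧
      Measure.map (fun v => (chain ρ m β v k).2)
          ((sphVol d (homog Ψ '' openCone η e ∩ sph d))⁻¹ •
            (sphVol d).restrict (homog Ψ '' openCone η e ∩ sph d)) =
        (lamSeta e η).withDensity fun u => ENNReal.ofReal (g u) := by
  have he0 := ne_zero_of_norm_eq_one he
  have hδlt : δ < 1 := by linarith
  have hVm := measurableSet_Vseta he0 η
  have hVmem : ∀ u ∈ Vseta e η, ‖u‖ = 1 ∧ u ∈ openCone η e := by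
    intro u hu
    rwa [Vseta_eq he0, dir_of_norm_eq_one he] at hu
  have hVne : ∀ u ∈ Vseta e η, u ≠ e := fun u hu => ne_of_mem_openCone hη0 (hVmem u hu).2
  obtain ⟨hI0, hI, hlam⟩ := lamSeta_eq hη0 hηπ he
  obtain ⟨κ, hκ, hjac⟩ := H.jacobian
  have hj : ∀ u ∈ Vseta e η, |(fderiv ℝ (homog (shiftedParam e)) u).det| = coneJac e u :=
    fun u hu => abs_det_fderiv_homog_shiftedParam (hVmem u hu).1 (hVne u hu)
  have hdiff : ∀ u ∈ Vseta e η, DifferentiableAt ℝ (homog Ψ) u := fun u hu =>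
    (H.contDiffAt_homog he (hVmem u hu).2).differentiableAt one_ne_zero
  have hjc : ContinuousOn (fun u => |(fderiv ℝ (homog (shiftedParam e)) u).det|) (Vseta e η) := by
    refine ContinuousOn.congr (f := coneJac e) (fun u hu => ?_) hj
    have h1 := continuousAt_coneJac he0 (hVmem u hu).2.1 (hVne u hu)
    exact (h1.comp (f := fun u => (e, u)) (by fun_prop)).continuousWithinAt
  have hJc : ContinuousOn (fun u => |(fderiv ℝ (homog Ψ) u).det|) (Vseta e η) := fun u hu =>
    ((ContinuousLinearMap.continuous_det (𝕜 := ℝ) (E := Vec d)).abs.continuousAt.comp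
      ((H.contDiffAt_homog he (hVmem u hu).2).fderiv_right (m := 0)
        (by norm_num)).continuousAt).continuousWithinAt
  obtain ⟨g, hgc, hg, hgd⟩ := exists_density_ratio (μ := sphVol d) hVm
    (measurable_abs_det_fderiv (homog (shiftedParam e))) (measurable_abs_det_fderiv (homog Ψ))
    hjc hJc (fun u hu => by rw [hj u hu]; exact coneJac_pos he (hVmem u hu).1 (hVne u hu))
    hκ hδ0 hδ1 hδε (fun u hu => by rw [hj u hu]; exact hjac u (hVmem u hu).2 (hVmem u hu).1)
    hI0 hI
  refine ⟨g, hgc, hg, ?_⟩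
  have hinj : InjOn (homog Ψ) (truncCone (Vseta e η)) := by
    refine H.injOn_homog.mono fun x hx => ?_
    have h1 := (hVmem _ hx.1).2
    exact ⟨hx.2.2, by rw [← angle_dir_left x e hx.2.2]; exact h1.2⟩
  have hΨ1 : ∀ u ∈ Vseta e η, ‖Ψ u‖ = 1 := fun u hu => H.norm_left u (hVmem u hu).2 (hVmem u hu).1
  have hΨc : ContinuousOn Ψ (Vseta e η) := H.contDiffOn_left.continuousOn.mono fun u hu =>
    (hVmem u hu).2
  have hΔ := H.image_Vseta he
  have hΔm : MeasurableSet (Ψ '' Vseta e η) := by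
    rw [hΔ]
    exact (H.isOpen_image he hη0 hδlt).measurableSet.inter isClosed_sphere.measurableSet
  have hΦc : ContinuousOn (fun v => (chain ρ m β v k).2) (Ψ '' Vseta e η) := by
    rw [hΔ]
    obtain ⟨D, -, hD⟩ := H.c1On_chain he hη0 hδlt
    exact fun v hv => (hD v hv).continuousWithinAt
  rw [← hΔ, Measure.map_smul, map_restrict_sphVol hVm (fun u hu => (hVmem u hu).1) hΨ1 hΨc hΦc
    (fun u hu => H.chain_snd (hVmem u hu).2 (hVmem u hu).1) hdiff hinj,
    sphVol_image hVm (fun u hu => (hVmem u hu).1) hΨ1 hΔm hdiff hinj, hgd, hlam]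

end IsConeState

/-- Proposition `REFLPROP` of Marklof–Strömbergsson: iterated scattering
in an admissible sequence of small balls defines a C¹ diffeomorphism `Φ` from an open
subset of the sphere onto `V_{sₙ}^η`, with controlled impact location on the last
scatterer and measure distortion close to `1`. -/
theorem statement10 (d : ℕ) (hd : 2 ≤ d) (N : ℕ) (hN : 0 < N)
    (η : ℝ) (hη : η ∈ Set.Ioo 0 (Real.pi / 100)) (C : ℝ) (hC : 10 ≤ C)
    (ε : ℝ) (hε : 0 < ε) :
    ∃ ρ₀ > (0:ℝ), ∀ ρ ∈ Set.Ioo 0 ρ₀,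
      ∀ (m : ℕ → Vec d) (n : ℕ), 1 ≤ n → n ≤ N → Admissible η C m n →
        ∀ β : Vec d → Vec d, (∀ v ∈ sph d, ‖β v‖ ≤ C) →
          (∃ Dβ : Vec d → Vec d →L[ℝ] Vec d, ContinuousOn Dβ (sph d) ∧
            ∀ v ∈ sph d, HasFDerivWithinAt β (Dβ v) (sph d) v ∧ ‖Dβ v‖ ≤ C) →
          ∃ (Δ : Set (Vec d)) (O : Set (Vec d)) (Φ Φinv : Vec d → Vec d),
            IsOpen O ∧ Δ = O ∩ sph d ∧
            -- (i): `Φ` is a C¹ diffeomorphism from `Δ` onto `V_{sₙ}^η` characterizing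
            -- the trajectories with scattering sequence `(m 0, …, m n)`
            (Set.BijOn Φ Δ (Vseta (m n - m (n - 1)) η) ∧
              (∀ v ∈ Δ, Φinv (Φ v) = v) ∧
              (∀ u ∈ Vseta (m n - m (n - 1)) η, Φinv u ∈ Δ ∧ Φ (Φinv u) = u) ∧
              C1On Φ Δ ∧ C1On Φinv (Vseta (m n - m (n - 1)) η) ∧
              (∀ v ∈ sph d, ∀ u ∈ Vseta (m n - m (n - 1)) η,
                (IsTrajectory ρ m β n v u ↔ v ∈ Δ ∧ Φ v = u))) ∧
            -- (ii): the impact location on the last scatterer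
            ((∀ u ∈ Vseta (m n - m (n - 1)) η,
                ‖hitW ρ (m n) (chain ρ m β (Φinv u) (n - 1)).1
                    (chain ρ m β (Φinv u) (n - 1)).2 -
                  impact (dir (m n - m (n - 1))) u‖ < ε) ∧
              ∃ DB : Vec d → Vec d →L[ℝ] Vec d,
                ContinuousOn DB (Vseta (m n - m (n - 1)) η) ∧
                ∀ u ∈ Vseta (m n - m (n - 1)) η,
                  HasFDerivWithinAt
                      (fun u => hitW ρ (m n) (chain ρ m β (Φinv u) (n - 1)).1
                        (chain ρ m β (Φinv u) (n - 1)).2)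
                      (DB u) (Vseta (m n - m (n - 1)) η) u ∧
                    ‖DB u‖ < Ceta d η) ∧
            -- (iii): measure distortion close to 1
            (∃ g : Vec d → ℝ, ContinuousOn g (Vseta (m n - m (n - 1)) η) ∧
              (∀ u ∈ Vseta (m n - m (n - 1)) η, g u ∈ Set.Icc (1 - ε) (1 + ε)) ∧
              Measure.map Φ ((sphVol d Δ)⁻¹ • (sphVol d).restrict Δ) =
                (lamSeta (m n - m (n - 1)) η).withDensity
                  (fun u => ENNReal.ofReal (g u))) := by
  obtain ⟨hη0, hη1⟩ := hη
  have hηπ : η < Real.pi := by linarith [Real.pi_pos]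
  set δ := min ε 1 / 4 with hδdef
  have hδ0 : 0 < δ := by positivity
  have hδε : 4 * δ ≤ ε := by linarith [min_le_left ε 1]
  have hδ1 : δ ≤ 1 / 4 := by linarith [min_le_right ε 1]
  obtain ⟨ρ₀, hρ₀, h⟩ := exists_isConeState_le d hη0 hηπ (show 1 ≤ C by linarith) hδ0
    (by linarith) N
  refine ⟨ρ₀, hρ₀, fun ρ hρ m n hn hnN hm β hβ hβ' => ?_⟩
  obtain ⟨Ψ, B, H⟩ := h ρ hρ m n hn hnN hm β ⟨hβ, hβ'⟩
  have hs : m n - m (n - 1) ≠ 0 :=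
    norm_pos_iff.1 ((inv_pos.2 (show 0 < C by linarith)).trans_le (hm.1 n hn le_rfl))
  have hV := Vseta_eq hs η
  have hVdir : Vseta (dir (m n - m (n - 1))) η = Vseta (m n - m (n - 1)) η := by
    rw [hV, Vseta_eq (ne_zero_of_norm_eq_one (norm_dir hs)), dir_dir]
  have hlam := lamSeta_dir hs η
  have he : ‖dir (m n - m (n - 1))‖ = 1 := norm_dir hs
  set e := dir (m n - m (n - 1))
  have hopen : IsOpen (openCone η e) := isOpen_openCone η (ne_zero_of_norm_eq_one he)
  have hVS : Vseta (m n - m (n - 1)) η ⊆ openCone η e := fun u hu => by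
    rw [hV] at hu
    exact hu.2
  have hVmem : ∀ u ∈ Vseta (m n - m (n - 1)) η, ‖u‖ = 1 ∧ u ∈ openCone η e := fun u hu => by
    rwa [hV] at hu
  have hδlt : δ < 1 := by linarith
  have hW : ∀ u ∈ Vseta (m n - m (n - 1)) η,
      hitW ρ (m n) (chain ρ m β (Ψ u) (n - 1)).1 (chain ρ m β (Ψ u) (n - 1)).2 = B u :=
    fun u hu => H.hitW_eq hρ.1.ne' hn (hVmem u hu).2 (hVmem u hu).1
  have hinv : ∀ v ∈ homog Ψ '' openCone η e ∩ sph d, 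
      (chain ρ m β v n).2 ∈ Vseta (m n - m (n - 1)) η ∧
      Ψ (chain ρ m β v n).2 = v := by
    intro v hv
    obtain ⟨u, hu, hu1, rfl⟩ := H.exists_of_mem hv
    rw [H.chain_snd hu hu1]
    refine ⟨?_, rfl⟩
    rw [hV]
    exact ⟨hu1, hu⟩
  have hinv' : ∀ u ∈ Vseta (m n - m (n - 1)) η, Ψ u ∈ homog Ψ '' openCone η e ∩ sph d ∧
      (chain ρ m β (Ψ u) n).2 = u := fun u hu =>
    ⟨H.mem_image_inter_sph (hVmem u hu).2 (hVmem u hu).1,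
      H.chain_snd (hVmem u hu).2 (hVmem u hu).1⟩
  refine ⟨_, homog Ψ '' openCone η e, fun v => (chain ρ m β v n).2, Ψ,
    H.isOpen_image he hη0.le hδlt, rfl, ⟨?_, fun v hv => (hinv v hv).2, hinv',
      H.c1On_chain he hη0.le hδlt, .of_contDiffOn hopen H.contDiffOn_left hVS, ?_⟩,
    ⟨fun u hu => ?_, fderiv ℝ B,
      (H.contDiffOn_right.continuousOn_fderiv_of_isOpen hopen le_rfl).mono hVS, fun u hu => ?_⟩, ?_⟩
  · exact ⟨fun v hv => (hinv v hv).1, fun v hv w hw hvw => by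
      rw [← (hinv v hv).2, ← (hinv w hw).2]; exact congrArg Ψ hvw,
      fun u hu => ⟨Ψ u, hinv' u hu⟩⟩
  · intro v hv u hu
    have hv1 : ‖v‖ = 1 := by simpa [sph] using hv
    rw [H.isTrajectory_iff v u hv1 (hVmem u hu).1 (hVmem u hu).2]
    constructor
    · rintro rfl
      exact hinv' u hu
    · rintro ⟨hvΔ, rfl⟩
      exact (hinv v hvΔ).2.symm
  · rw [hW u hu, impact_eq_dir]
    exact (H.near u (hVmem u hu).2 (hVmem u hu).1).trans_le (by linarith)
  · refine ⟨?_, ?_⟩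
    · refine HasFDerivWithinAt.congr ?_ hW (hW u hu)
      exact ((H.contDiffOn_right.contDiffAt (hopen.mem_nhds (hVS hu))).differentiableAt
        one_ne_zero).hasFDerivAt.hasFDerivWithinAt
    · have h1 := H.fderiv_near u (hVmem u hu).2 (hVmem u hu).1
      have h2 := norm_ddir_comp_ddir_le_Ceta hη0 hηπ he (hVmem u hu).2 (hVmem u hu).1
      have h3 := norm_sub_norm_le (fderiv ℝ B u) (ddir (u - e) ∘L ddir u)
      linarith
  · rw [← hVdir, ← hlam]
    exact H.exists_density he hη0.le hηπ hδ0 hδ1 hδε
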